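/- Let D be a Prüfer domain, let K be its fraction field, let K̄ be an algebraic closure of K, and let D⁺ be the integral closure of D in K̄ (the absolute integral closure of D). Then D⁺ is universally Japanese. -/

import Mathlib

set_option synthInstance.maxHeartbeats 400000
set_option maxHeartbeats 800000

universe u

/-- An integral domain `S` is N-1 if the integral closure of `S` in its fraction
field is a finitely generated `S`-module. -/
def IsN1 (S : Type u) [CommRing S] [IsDomain S] : Prop :=
  Module.Finite S (integralClosure S (FractionRing S))

/-- An integral domain `S` is N-2 (Japanese) if for every finite field extension `L`
of its fraction field, the integral closure of `S` in `L` is a finitely generated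
`S`-module. -/
def IsN2 (S : Type u) [CommRing S] [IsDomain S] : Prop :=
  ∀ (L : Type u) [Field L] [Algebra S L] [Algebra (FractionRing S) L]
    [IsScalarTower S (FractionRing S) L],
    FiniteDimensional (FractionRing S) L → Module.Finite S (integralClosure S L)

/-- A commutative ring `R` is universally Japanese if every finite type `R`-algebra
that is an integral domain is N-1. -/
def UniversallyJapanese (R : Type u) [CommRing R] : Prop :=
  ∀ (A : Type u) [CommRing A] [IsDomain A] [Algebra R A],
    Algebra.FiniteType R A → IsN1 A

/-- A Prüfer domain is an integral domain whose localization at every prime ideal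
is a valuation ring. -/
def IsPruferDomain (D : Type u) [CommRing D] [IsDomain D] : Prop :=
  ∀ (P : Ideal D) [P.IsPrime], ValuationRing (Localization.AtPrime P)

open Filter in
/-- Hilbert functions bound the degrees of generators of monomial modules. -/
theorem exists_generation_bound_of_card {J σ : Type*} [Finite J] [Finite σ] (D : ℕ) (h : ℕ → ℕ) :
    ∃ n₀ : ℕ, ∀ I : ℕ → Finset (J × (σ →₀ ℕ)),
      (∀ n, ∀ x ∈ I n, x.2.degree = n + D) →
      (∀ n i, ∀ x ∈ I n, (x.1, x.2 + Finsupp.single i 1) ∈ I (n + 1)) →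
      (∀ n, (I n).card = h n) →
      ∀ n ≥ n₀, ∀ x ∈ I (n + 1), ∃ i, ∃ z ∈ I n, x = (z.1, z.2 + Finsupp.single i 1) := by
  classical
  by_contra! hcon
  choose I hdeg hup hcard N hN x hx hbad using hcon
  have hfin : ∀ n, Finite {x : J × (σ →₀ ℕ) // x.2.degree = n + D} := by
    intro n
    have : ({x : J × (σ →₀ ℕ) | x.2.degree = n + D}).Finite := by
      refine Set.Finite.subset (Set.Finite.prod (Set.finite_univ (α := J))
        (s := Set.univ) (t := {u : σ →₀ ℕ | u.degree = n + D}) ?_) ?_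
      · refine (Finsupp.finite_of_degree_le (n + D)).subset fun u hu => le_of_eq hu
      · rintro ⟨j, u⟩ hu; exact ⟨trivial, hu⟩
    exact this
  let U : Ultrafilter ℕ := hyperfilter ℕ
  -- the limit family
  have hlim : ∀ n, ∃ T : Finset (J × (σ →₀ ℕ)), ∀ᶠ j in (U : Filter ℕ), I j n = T := by
    intro n
    have hf : (Set.range fun j => I j n).Finite := by
      have := hfin n
      let S : Set (J × (σ →₀ ℕ)) := {x | x.2.degree = n + D}
      have hS : S.Finite := this
      refine (hS.toFinset.powerset.finite_toSet).subset ?_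
      rintro _ ⟨j, rfl⟩
      simp only [Finset.coe_powerset, Set.mem_preimage, Set.mem_powerset_iff]
      intro y hy
      simpa [S] using hdeg j n y hy
    have h1 : ∀ᶠ j in (U : Filter ℕ), I j n ∈ Set.range fun j => I j n :=
      Eventually.of_forall fun j => ⟨j, rfl⟩
    rw [← Set.biUnion_of_singleton (Set.range fun j => I j n)] at h1
    have h2 : (⋃ T ∈ Set.range fun j => I j n, {T} : Set _) ∈ U.map (fun j => I j n) := h1
    rw [Ultrafilter.finite_biUnion_mem_iff hf] at h2
    obtain ⟨T, -, hT⟩ := h2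
    exact ⟨T, hT⟩
  choose T hT using hlim
  have hTdeg : ∀ n, ∀ x ∈ T n, x.2.degree = n + D := by
    intro n x hx
    obtain ⟨j, hj⟩ := (hT n).exists
    exact hdeg j n x (hj ▸ hx)
  have hTup : ∀ n i, ∀ x ∈ T n, (x.1, x.2 + Finsupp.single i 1) ∈ T (n + 1) := by
    intro n i x hx
    obtain ⟨j, hj, hj'⟩ := ((hT n).and (hT (n + 1))).exists
    exact hj' ▸ hup j n i x (hj ▸ hx)
  have hTcard : ∀ n, (T n).card = h n := by
    intro n
    obtain ⟨j, hj⟩ := (hT n).exists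
    exact hj ▸ hcard j n
  have hTup' : ∀ (c : σ →₀ ℕ) (n : ℕ) (j : J) (a : σ →₀ ℕ), (j, a) ∈ T n →
      (j, a + c) ∈ T (n + c.degree) := by
    intro c
    induction c using Finsupp.induction_linear with
    | zero => intro n j a h; simpa using h
    | add f g hf hg =>
      intro n j a h
      have := hg _ _ _ (hf _ _ _ h)
      rwa [add_assoc, add_assoc, ← map_add] at this
    | single i k =>
      induction k with
      | zero => intro n j a h; simpa using h
      | succ k ih =>
        intro n j a h
        have := hTup _ i _ (ih _ _ _ h)
        simpa [Finsupp.single_add, add_assoc] using this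
  have hTgen : ∃ n₁, ∀ n ≥ n₁, ∀ x ∈ T (n + 1), ∃ i, ∃ z ∈ T n,
      x = (z.1, z.2 + Finsupp.single i 1) := by
    by_contra! hc
    have hfr : ∃ᶠ n in atTop, ∃ x ∈ T (n + 1), ∀ i, ∀ z ∈ T n,
        x ≠ (z.1, z.2 + Finsupp.single i 1) := by
      rw [frequently_atTop]; exact hc
    obtain ⟨φ, hφ, hb⟩ := extraction_of_frequently_atTop hfr
    choose w hw hwb using hb
    have hJ : WellQuasiOrdered (fun a b : J => a = b) := Finite.wellQuasiOrdered _
    have hS : WellQuasiOrdered (fun a b : σ →₀ ℕ => a ≤ b) := wellQuasiOrdered_le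
    obtain ⟨m, n, hmn, h1, h2⟩ := (hJ.prod hS) w
    obtain ⟨c, hc⟩ := exists_add_of_le h2
    have hd1 := hTdeg _ _ (hw m)
    have hd2 := hTdeg _ _ (hw n)
    have hlt := hφ hmn
    rw [hc, map_add] at hd2
    have hc0 : c ≠ 0 := by
      rintro rfl
      simp at hd2; omega
    obtain ⟨i, hi⟩ := Finsupp.ne_iff.1 hc0
    have hle : Finsupp.single i 1 ≤ c := by
      rw [Finsupp.single_le_iff]
      exact Nat.one_le_iff_ne_zero.2 hi
    obtain ⟨e, rfl⟩ := exists_add_of_le hle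
    have hed : e.degree + 1 = (Finsupp.single i 1 + e).degree := by
      rw [map_add, Finsupp.degree_single, add_comm]
    have hmem := hTup' e _ _ _ (hw m)
    have hdeq : φ m + 1 + e.degree = φ n := by omega
    rw [hdeq] at hmem
    refine hwb n i _ hmem (Prod.ext h1.symm ?_)
    simp only
    rw [hc]
    abel
  obtain ⟨n₁, hn₁⟩ := hTgen
  have hev : ∀ᶠ j in (U : Filter ℕ), ∀ n ∈ Finset.range (n₁ + 1), I j n = T n :=
    (Finset.eventually_all _).2 fun n _ => hT n
  have hge : ∀ᶠ j in (U : Filter ℕ), n₁ ≤ j := by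
    have : (U : Filter ℕ) ≤ atTop := Nat.hyperfilter_le_atTop
    exact this (eventually_ge_atTop n₁)
  obtain ⟨j, hj1, hj2⟩ := (hev.and hge).exists
  have hsub : ∀ n ≥ n₁, T n = I j n := by
    intro n hn
    refine Finset.eq_of_subset_of_card_le ?_ (by rw [hcard, hTcard])
    induction n, hn using Nat.le_induction with
    | base => rw [hj1 _ (by simp)]
    | succ n hn ih =>
      intro x hx
      obtain ⟨i, z, hz, rfl⟩ := hn₁ n hn x hx
      exact hup _ _ _ _ (ih hz)
  have hNj : n₁ ≤ N j := hj2.trans (hN j)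
  obtain ⟨i, z, hz, hxz⟩ := hn₁ (N j) hNj (x j) (by rw [hsub _ (by omega)]; exact hx j)
  exact hbad j i z (by rw [← hsub _ hNj]; exact hz) hxz

section Leading

variable {α β : Type*} [LinearOrder β] {k : Type u} [Field k] {E : Type*} [AddCommGroup E]
  [Module k E]

/-- The index `a` is leading for the subspace `W` with respect to the coordinates `c`. -/
def IsLeading (r : α → β) (c : α → E →ₗ[k] k) (W : Submodule k E) (a : α) : Prop :=
  ∃ x ∈ W, c a x ≠ 0 ∧ ∀ b, r a < r b → c b x = 0

theorem IsLeading.mono {r : α → β} {c : α → E →ₗ[k] k} {W W' : Submodule k E} (h : W ≤ W') {a : α}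
    (ha : IsLeading r c W a) : IsLeading r c W' a := by
  obtain ⟨x, hx, h1⟩ := ha
  exact ⟨x, h hx, h1⟩

theorem finite_of_coordinates (c : α → E →ₗ[k] k) (s : Finset α) (W : Submodule k E)
    (hinj : ∀ x ∈ W, (∀ b ∈ s, c b x = 0) → x = 0) : FiniteDimensional k W := by
  let f : W →ₗ[k] (s → k) := LinearMap.pi fun b => (c b).comp W.subtype
  refine FiniteDimensional.of_injective f ?_
  rw [← LinearMap.ker_eq_bot, LinearMap.ker_eq_bot']
  intro x hx
  refine Subtype.ext (hinj _ x.2 fun b hb => ?_)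
  exact congrFun hx ⟨b, hb⟩

open Classical in
/-- The number of leading indices is the dimension. -/
theorem card_leading {r : α → β} (hr : Function.Injective r) (c : α → E →ₗ[k] k) (s : Finset α) :
    ∀ (W : Submodule k E) (_ : ∀ x ∈ W, ∀ b ∉ s, c b x = 0)
    (_ : ∀ x ∈ W, (∀ b ∈ s, c b x = 0) → x = 0),
    (s.filter (IsLeading r c W)).card = Module.finrank k W := by
  induction s using Finset.induction_on_max_value r with
  | empty =>
    intro W h1 h2
    have : W = ⊥ := by
      rw [eq_bot_iff]; intro x hx; simpa using h2 x hx (by simp)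
    subst this; simp
  | insert a s ha hmax ih =>
    intro W h1 h2
    have hfd := finite_of_coordinates c _ W h2
    let W' := W ⊓ LinearMap.ker (c a)
    have hlt : ∀ b ∈ s, r b < r a := fun b hb =>
      lt_of_le_of_ne (hmax b hb) fun h => ha (hr h ▸ hb)
    have ih' := ih W' (by
        rintro x ⟨hx, hxa⟩ b hb
        by_cases hba : b = a
        · subst hba; exact hxa
        · exact h1 x hx b (by simp [hba, hb]))
      (by
        rintro x ⟨hx, hxa⟩ hb
        refine h2 x hx fun b hb' => ?_
        rcases Finset.mem_insert.1 hb' with rfl | h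
        · exact hxa
        · exact hb b h)
    have hfil : s.filter (IsLeading r c W) = s.filter (IsLeading r c W') := by
      refine Finset.filter_congr fun b hb => ⟨?_, IsLeading.mono inf_le_left⟩
      rintro ⟨x, hx, hxb, hx'⟩
      exact ⟨x, ⟨hx, hx' a (hlt b hb)⟩, hxb, hx'⟩
    have hker : Module.finrank k W' = Module.finrank k (LinearMap.ker ((c a).domRestrict W)) := by
      refine LinearEquiv.finrank_eq (LinearEquiv.symm ?_)
      have : W' = (LinearMap.ker ((c a).domRestrict W)).map W.subtype := by
        ext x
        simp [W', Submodule.mem_map, and_comm]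
      rw [this]
      exact Submodule.equivMapOfInjective _ W.subtype_injective _
    have hrk := LinearMap.finrank_range_add_finrank_ker ((c a).domRestrict W)
    rw [← hker, ← ih', ← hfil] at hrk
    rw [Finset.filter_insert, ← hrk]
    by_cases hz : ∀ x ∈ W, c a x = 0
    · have hnl : ¬ IsLeading r c W a := by
        rintro ⟨x, hx, hxa, -⟩; exact hxa (hz x hx)
      have : LinearMap.range ((c a).domRestrict W) = ⊥ := by
        rw [LinearMap.range_eq_bot]; ext x; exact hz x x.2
      rw [if_neg hnl, this]; simp
    · push Not at hz
      obtain ⟨x, hx, hxa⟩ := hz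
      have hl : IsLeading r c W a := by
        refine ⟨x, hx, hxa, fun b hb => h1 x hx b ?_⟩
        intro hb'
        rcases Finset.mem_insert.1 hb' with rfl | h
        · exact lt_irrefl _ hb
        · exact lt_asymm hb (hlt b h)
      have : LinearMap.range ((c a).domRestrict W) = ⊤ := by
        rw [LinearMap.range_eq_top]
        exact LinearMap.surjective fun h => hxa (by simpa using congrArg (· ⟨x, hx⟩) h)
      rw [if_pos hl, this, Finset.card_insert_of_notMem (by simp [ha])]
      simp [add_comm]

end Leading

open MvPolynomial in
/-- Graded spaces of polynomial vectors with a prescribed Hilbert function are generated in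
bounded degree. -/
theorem exists_generation_bound_of_finrank (m : ℕ) (σ : Type*) [Finite σ] [LinearOrder σ]
    (D : ℕ) (h : ℕ → ℕ) :
    ∃ n₀ : ℕ, ∀ (k : Type u) [Field k] (W : ℕ → Submodule k (Fin m → MvPolynomial σ k)),
      (∀ n, ∀ x ∈ W n, ∀ j, (x j).IsHomogeneous (n + D)) →
      (∀ n i, ∀ x ∈ W n, (X i : MvPolynomial σ k) • x ∈ W (n + 1)) →
      (∀ n, Module.finrank k (W n) = h n) →
      ∀ n ≥ n₀, ∀ x ∈ W (n + 1),
        x ∈ Submodule.span k {z | ∃ i, ∃ y ∈ W n, z = (X i : MvPolynomial σ k) • y} := by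
  classical
  obtain ⟨n₀, hn₀⟩ := exists_generation_bound_of_card (J := Fin m) (σ := σ) D h
  refine ⟨n₀, fun k _ W hdeg hup hrk n hn => ?_⟩
  let r : Fin m × (σ →₀ ℕ) → Fin m ×ₗ Lex (σ →₀ ℕ) := fun a => toLex (a.1, toLex a.2)
  have hr : Function.Injective r := by
    rintro ⟨a, b⟩ ⟨c, d⟩ h
    simpa [r] using h
  let c : Fin m × (σ →₀ ℕ) → (Fin m → MvPolynomial σ k) →ₗ[k] k := fun a =>
    (MvPolynomial.lcoeff k a.2).comp (LinearMap.proj a.1)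
  have hc : ∀ a x, c a x = coeff a.2 (x a.1) := fun a x => rfl
  have hfin : ∀ n, {x : Fin m × (σ →₀ ℕ) | x.2.degree = n + D}.Finite := by
    intro n
    refine Set.Finite.subset (Set.Finite.prod (Set.finite_univ (α := Fin m))
        (s := Set.univ) (t := {u : σ →₀ ℕ | u.degree = n + D}) ?_) ?_
    · refine (Finsupp.finite_of_degree_le (n + D)).subset fun u hu => le_of_eq hu
    · rintro ⟨j, u⟩ hu; exact ⟨trivial, hu⟩
  let s : ℕ → Finset (Fin m × (σ →₀ ℕ)) := fun n => (hfin n).toFinset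
  have hs : ∀ n a, a ∈ s n ↔ a.2.degree = n + D := fun n a => by simp [s]
  have hzero : ∀ n, ∀ x ∈ W n, ∀ b ∉ s n, c b x = 0 := by
    intro n x hx b hb
    rw [hs] at hb
    rw [hc]
    exact (hdeg n x hx b.1).coeff_eq_zero hb
  have hinj : ∀ n, ∀ x ∈ W n, (∀ b ∈ s n, c b x = 0) → x = 0 := by
    intro n x hx hb
    funext j
    ext u
    by_cases hu : (j, u) ∈ s n
    · exact hb _ hu
    · exact hzero n x hx _ hu
  let I : ℕ → Finset (Fin m × (σ →₀ ℕ)) := fun n => (s n).filter (IsLeading r c (W n))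
  have hlead : ∀ i (a : Fin m × (σ →₀ ℕ)) (x : Fin m → MvPolynomial σ k),
      (c a x ≠ 0 ∧ ∀ b, r a < r b → c b x = 0) →
      (c (a.1, a.2 + Finsupp.single i 1) ((X i : MvPolynomial σ k) • x) ≠ 0 ∧
        ∀ b, r (a.1, a.2 + Finsupp.single i 1) < r b →
          c b ((X i : MvPolynomial σ k) • x) = 0) := by
    rintro i ⟨j, v⟩ x ⟨h1, h2⟩
    constructor
    · rw [hc] at h1 ⊢
      simpa [Pi.smul_apply, smul_eq_mul, coeff_X_mul, add_comm v] using h1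
    · rintro ⟨j', w⟩ hb
      rw [hc]
      simp only [Pi.smul_apply, smul_eq_mul, coeff_X_mul']
      split_ifs with hw
      · obtain ⟨w', rfl⟩ := exists_add_of_le (Finsupp.single_le_iff.2
          (Nat.one_le_iff_ne_zero.2 (Finsupp.mem_support_iff.1 hw)))
        rw [add_tsub_cancel_left]
        refine h2 (j', w') ?_
        simp only [r, Prod.Lex.toLex_lt_toLex] at hb ⊢
        rcases hb with hb | ⟨hb, hb'⟩
        · exact Or.inl hb
        · refine Or.inr ⟨hb, ?_⟩
          rw [add_comm, toLex_add, toLex_add] at hb'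
          exact lt_of_add_lt_add_left hb'
      · rfl
  have key := hn₀ I (fun n a ha => (hs n a).1 (Finset.mem_filter.1 ha).1)
    (by
      intro n i a ha
      obtain ⟨ha, x, hx, hax⟩ := Finset.mem_filter.1 ha
      refine Finset.mem_filter.2 ⟨?_, _, hup n i x hx, hlead i a x hax⟩
      rw [hs] at ha ⊢
      simp [ha]; ring)
    (fun n => by rw [← hrk n]; exact card_leading hr c (s n) (W n) (hzero n) (hinj n))
    n hn
  set V := Submodule.span k {z | ∃ i, ∃ y ∈ W n, z = (X i : MvPolynomial σ k) • y} with hV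
  have hVW : V ≤ W (n + 1) := by
    rw [hV, Submodule.span_le]
    rintro _ ⟨i, y, hy, rfl⟩
    exact hup n i y hy
  have hcV := card_leading hr c (s (n + 1)) V (fun x hx => hzero _ x (hVW hx))
    (fun x hx => hinj _ x (hVW hx))
  have hcW := card_leading hr c (s (n + 1)) (W (n + 1)) (hzero _) (hinj _)
  have hfd := finite_of_coordinates c _ _ (hinj (n + 1))
  have : V = W (n + 1) := by
    refine Submodule.eq_of_le_of_finrank_le hVW ?_
    rw [← hcV, ← hcW]
    refine Finset.card_le_card fun a ha => ?_
    obtain ⟨i, z, hz, rfl⟩ := key a ha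
    obtain ⟨-, x, hx, hax⟩ := Finset.mem_filter.1 hz
    refine Finset.mem_filter.2 ⟨(Finset.mem_filter.1 ha).1, _, ?_, hlead i z x hax⟩
    exact Submodule.subset_span ⟨i, x, hx, rfl⟩
  intro x hx
  rw [this]; exact hx

section Growth

open Filter Topology

theorem pow_le_factorial_mul_choose_add (d n : ℕ) : n ^ d ≤ d.factorial * (n + d).choose d := by
  have := Nat.pow_sub_le_descFactorial (n + d) d
  rw [Nat.descFactorial_eq_factorial_mul_choose] at this
  refine le_trans (Nat.pow_le_pow_left ?_ d) this
  omega

theorem factorial_mul_choose_add_le_pow (d n : ℕ) :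
    d.factorial * (n + d).choose d ≤ (n + d) ^ d := by
  rw [← Nat.descFactorial_eq_factorial_mul_choose]
  exact Nat.descFactorial_le_pow _ _

theorem tendsto_add_div_pow (e d : ℕ) :
    Tendsto (fun n : ℕ => (((n + e : ℕ) : ℝ) / n) ^ d) atTop (𝓝 1) := by
  have h : Tendsto (fun n : ℕ => ((n + e : ℕ) : ℝ) / n) atTop (𝓝 1) := by
    have h1 : Tendsto (fun n : ℕ => 1 + (e : ℝ) / n) atTop (𝓝 (1 + 0)) :=
      tendsto_const_nhds.add (tendsto_const_div_atTop_nhds_zero_nat _)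
    rw [add_zero] at h1
    refine h1.congr' ?_
    filter_upwards [eventually_gt_atTop 0] with n hn
    have : (n : ℝ) ≠ 0 := by positivity
    push_cast
    field_simp
  simpa using h.pow d

theorem growth_comparison {d d' a b C : ℕ} (ha : 1 ≤ a)
    (h : ∀ n, a * (n + d').choose d' ≤ b * (n + C + d).choose d) :
    d' < d ∨ (d' = d ∧ a ≤ b) := by
  have key : ∀ n, (a * d.factorial) * n ^ d' ≤ (b * d'.factorial) * (n + (C + d)) ^ d := by
    intro n
    calc (a * d.factorial) * n ^ d' ≤ (a * d.factorial) * (d'.factorial * (n + d').choose d') :=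
          Nat.mul_le_mul_left _ (pow_le_factorial_mul_choose_add _ _)
      _ = d.factorial * d'.factorial * (a * (n + d').choose d') := by ring
      _ ≤ d.factorial * d'.factorial * (b * (n + C + d).choose d) := Nat.mul_le_mul_left _ (h n)
      _ = b * d'.factorial * (d.factorial * (n + C + d).choose d) := by ring
      _ ≤ _ := by
          rw [← add_assoc]
          exact Nat.mul_le_mul_left _ (factorial_mul_choose_add_le_pow _ _)
  have hlim := (tendsto_add_div_pow (C + d) d).const_mul ((b * d'.factorial : ℕ) : ℝ)
  rw [mul_one] at hlim
  have hle : ∀ e, d' = d + e → ∀ n : ℕ, 0 < n → ((a * d.factorial : ℕ) : ℝ) * (n : ℝ) ^ e ≤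
      ((b * d'.factorial : ℕ) : ℝ) * (((n + (C + d) : ℕ) : ℝ) / n) ^ d := by
    intro e he n hn
    have h1 : (((a * d.factorial) * n ^ d' : ℕ) : ℝ) ≤
        (((b * d'.factorial) * (n + (C + d)) ^ d : ℕ) : ℝ) := by exact_mod_cast key n
    have hn' : (0 : ℝ) < (n : ℝ) ^ d := by positivity
    rw [div_pow, ← mul_div_assoc, le_div_iff₀ hn']
    subst he
    rw [pow_add] at h1
    push_cast at h1 ⊢
    linarith
  rcases lt_trichotomy d' d with hlt | heq | hgt
  · exact Or.inl hlt
  · refine Or.inr ⟨heq, ?_⟩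
    have := le_of_tendsto_of_tendsto tendsto_const_nhds hlim
      (show ∀ᶠ n : ℕ in atTop, ((a * d.factorial : ℕ) : ℝ) ≤ _ by
        filter_upwards [eventually_gt_atTop 0] with n hn
        simpa using hle 0 heq n hn)
    subst heq
    have h2 : a * d'.factorial ≤ b * d'.factorial := by exact_mod_cast this
    exact Nat.le_of_mul_le_mul_right h2 (Nat.factorial_pos _)
  · exfalso
    obtain ⟨e, rfl⟩ := Nat.exists_eq_add_of_lt hgt
    have ht : Tendsto (fun n : ℕ => (n : ℝ)) atTop atTop := tendsto_natCast_atTop_atTop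
    refine not_tendsto_nhds_of_tendsto_atTop (tendsto_atTop_mono' _ ?_ ht) _ hlim
    filter_upwards [eventually_gt_atTop 0] with n hn
    refine le_trans ?_ (hle (e + 1) (by omega) n hn)
    have h1 : (1 : ℝ) ≤ ((a * d.factorial : ℕ) : ℝ) := by
      exact_mod_cast Nat.mul_pos ha (Nat.factorial_pos _)
    have h2 : (n : ℝ) ≤ (n : ℝ) ^ (e + 1) := by
      exact_mod_cast Nat.le_self_pow (by omega) n
    have h3 : (0 : ℝ) ≤ (n : ℝ) ^ (e + 1) := by positivity
    nlinarith

end Growth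

open MvPolynomial in
theorem homogeneousSubmodule_eq_span (σ k : Type*) [Finite σ] [Field k] (n : ℕ) :
    homogeneousSubmodule σ k n = Submodule.span k
      (Set.range fun u : {u : σ →₀ ℕ | u.degree = n} => (monomial (u : σ →₀ ℕ) (1 : k))) := by
  apply le_antisymm
  · intro p hp
    rw [p.as_sum]
    refine Submodule.sum_mem _ fun u hu => ?_
    have : monomial u (coeff u p) = coeff u p • monomial u (1 : k) := by
      rw [smul_monomial, smul_eq_mul, mul_one]
    rw [this]
    refine Submodule.smul_mem _ _ (Submodule.subset_span ⟨⟨u, ?_⟩, rfl⟩)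
    by_contra hne
    exact (mem_support_iff.1 hu) (IsHomogeneous.coeff_eq_zero hp hne)
  · rw [Submodule.span_le]
    rintro _ ⟨u, rfl⟩
    exact isHomogeneous_monomial _ u.2

open MvPolynomial in
theorem finrank_homogeneousSubmodule (d n : ℕ) (k : Type*) [Field k] :
    Module.finrank k (homogeneousSubmodule (Fin (d + 1)) k n) = (n + d).choose d ∧
    FiniteDimensional k (homogeneousSubmodule (Fin (d + 1)) k n) := by
  classical
  have hfin : {u : Fin (d + 1) →₀ ℕ | u.degree = n}.Finite :=
    (Finsupp.finite_of_degree_le n).subset fun u hu => le_of_eq hu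
  have := hfin.fintype
  rw [homogeneousSubmodule_eq_span]
  refine ⟨?_, FiniteDimensional.span_of_finite _ (Set.finite_range _)⟩
  rw [finrank_span_eq_card]
  · have : {u : Fin (d + 1) →₀ ℕ | u.degree = n}.toFinset =
        (Finset.univ : Finset (Fin (d + 1))).finsuppAntidiag n := by
      ext u
      simp [Finset.mem_finsuppAntidiag, Finsupp.degree_eq_sum]
    rw [← Set.toFinset_card, this, Finset.card_finsuppAntidiag_nat_eq_choose]
    simp only [Finset.card_univ, Fintype.card_fin]
    rw [show d + 1 + n - 1 = n + d by omega]
    exact Nat.choose_symm_add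
  · have := (basisMonomials (Fin (d + 1)) k).linearIndependent
    exact this.comp (fun u : {u : Fin (d + 1) →₀ ℕ | u.degree = n} => (u : Fin (d + 1) →₀ ℕ))
      Subtype.val_injective

section IntegralElem

variable {R S T : Type*} [CommRing R] [CommRing S] [CommRing T]

theorem RingHom.IsIntegralElem.of_comp_injective {f : R →+* S} {g : S →+* T}
    (hg : Function.Injective g) {x : S} (h : (g.comp f).IsIntegralElem (g x)) :
    f.IsIntegralElem x := by
  obtain ⟨p, hp, hx⟩ := h
  refine ⟨p, hp, hg ?_⟩
  rw [Polynomial.hom_eval₂, hx, map_zero]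

theorem RingHom.IsIntegralElem.of_comp_left {f : R →+* S} {g : S →+* T} {x : T}
    (h : (g.comp f).IsIntegralElem x) : g.IsIntegralElem x := by
  obtain ⟨p, hp, hx⟩ := h
  exact ⟨p.map f, hp.map f, by rw [Polynomial.eval₂_map, hx]⟩

theorem RingHom.IsIntegralElem.trans_of_range {f : R →+* T} {g : S →+* T} {x : T}
    (hf : ∀ r, g.IsIntegralElem (f r)) (h : f.IsIntegralElem x) : g.IsIntegralElem x := by
  let := g.toAlgebra
  have hf' : ∀ r, f r ∈ integralClosure S T := hf
  let f' : R →+* integralClosure S T := f.codRestrict _ hf'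
  have hx : _root_.IsIntegral (integralClosure S T) x := by
    have : ((algebraMap (integralClosure S T) T).comp f').IsIntegralElem x := by
      convert h using 1
      exact RingHom.ext fun r => rfl
    exact this.of_comp_left
  exact isIntegral_trans (R := S) (A := integralClosure S T) x hx

theorem RingHom.IsIntegralElem.sum' {ι : Type*} {f : R →+* S} {s : Finset ι} {x : ι → S}
    (h : ∀ i ∈ s, f.IsIntegralElem (x i)) : f.IsIntegralElem (∑ i ∈ s, x i) := by
  let := f.toAlgebra
  exact IsIntegral.sum (R := R) x h

end IntegralElem

section HomIntegral

open Polynomial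

variable {R S : Type*} [CommRing R] [CommRing S] [Algebra R S] {σ : Type*}

/-- The graded evaluation sending each variable to `y j` in degree one. -/
noncomputable def gradedEval (R : Type*) {S : Type*} [CommRing R] [CommRing S] [Algebra R S]
    {σ : Type*} (y : σ → S) : MvPolynomial σ R →ₐ[R] S[X] :=
  MvPolynomial.aeval fun j => monomial 1 (y j)

/-- `b` is homogeneously integral of degree `n` over the elements `y j`, considered in degree one:
it is a root of a monic polynomial whose coefficients are forms in `y` of the proper degrees. -/
def IsHomIntegral (R : Type*) {S : Type*} [CommRing R] [CommRing S] [Algebra R S]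
    {σ : Type*} (y : σ → S) (n : ℕ) (b : S) : Prop :=
  (gradedEval R y : MvPolynomial σ R →+* S[X]).IsIntegralElem (monomial n b)

namespace IsHomIntegral

variable {y : σ → S} {n m : ℕ} {b c : S}

theorem coe_gradedEval_X (j : σ) :
    (gradedEval R y : MvPolynomial σ R →+* S[X]) (MvPolynomial.X j) = monomial 1 (y j) := by
  simp [gradedEval]

theorem coe_gradedEval_C (r : R) :
    (gradedEval R y : MvPolynomial σ R →+* S[X]) (MvPolynomial.C r) = C (algebraMap R S r) := by
  simp [gradedEval]

theorem add (hb : IsHomIntegral R y n b) (hc : IsHomIntegral R y n c) :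
    IsHomIntegral R y n (b + c) := by
  unfold IsHomIntegral
  rw [map_add]
  exact RingHom.IsIntegralElem.add _ hb hc

theorem zero : IsHomIntegral R y n (0 : S) := by
  unfold IsHomIntegral
  rw [map_zero]
  exact RingHom.isIntegralElem_zero _

theorem mul (hb : IsHomIntegral R y n b) (hc : IsHomIntegral R y m c) :
    IsHomIntegral R y (n + m) (b * c) := by
  unfold IsHomIntegral
  rw [← monomial_mul_monomial]
  exact RingHom.IsIntegralElem.mul _ hb hc

theorem algebraMap_mem (r : R) : IsHomIntegral R y 0 (algebraMap R S r) := by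
  unfold IsHomIntegral
  rw [monomial_zero_left, ← coe_gradedEval_C (σ := σ) (y := y)]
  exact RingHom.isIntegralElem_map _

theorem one : IsHomIntegral R y 0 (1 : S) := by
  simpa using algebraMap_mem (y := y) (1 : R)

theorem smul (r : R) (hb : IsHomIntegral R y n b) : IsHomIntegral R y n (r • b) := by
  rw [Algebra.smul_def]
  simpa using (algebraMap_mem r).mul hb

theorem gen (j : σ) : IsHomIntegral R y 1 (y j) := by
  unfold IsHomIntegral
  rw [← coe_gradedEval_X (R := R)]
  exact RingHom.isIntegralElem_map _

theorem pow (hb : IsHomIntegral R y n b) (q : ℕ) : IsHomIntegral R y (q * n) (b ^ q) := by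
  induction q with
  | zero => simpa using one
  | succ q ih => rw [pow_succ, add_mul, one_mul]; exact ih.mul hb

theorem sum {ι : Type*} {s : Finset ι} {x : ι → S} (h : ∀ i ∈ s, IsHomIntegral R y n (x i)) :
    IsHomIntegral R y n (∑ i ∈ s, x i) := by
  unfold IsHomIntegral
  rw [map_sum]
  exact RingHom.IsIntegralElem.sum' h

theorem map_gradedEval {R' S' : Type*} [CommRing R'] [CommRing S'] [Algebra R' S'] (g : R →+* R')
    (f : S →+* S') (hfg : ∀ r, algebraMap R' S' (g r) = f (algebraMap R S r)) :
    (Polynomial.mapRingHom f).comp (gradedEval R y : MvPolynomial σ R →+* S[X]) =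
    (gradedEval R' (fun j => f (y j)) : MvPolynomial σ R' →+* S'[X]).comp
      (MvPolynomial.map g) := by
  refine MvPolynomial.ringHom_ext (fun r => ?_) fun r => ?_
  · simp only [RingHom.comp_apply, coe_gradedEval_C, MvPolynomial.map_C, coe_mapRingHom, map_C,
      hfg]
  · simp only [RingHom.comp_apply, coe_gradedEval_X, MvPolynomial.map_X, coe_mapRingHom,
      map_monomial]

theorem map {R' S' : Type*} [CommRing R'] [CommRing S'] [Algebra R' S'] (g : R →+* R')
    (f : S →+* S') (hfg : ∀ r, algebraMap R' S' (g r) = f (algebraMap R S r))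
    (hb : IsHomIntegral R y n b) : IsHomIntegral R' (fun j => f (y j)) n (f b) := by
  have := RingHom.IsIntegralElem.map hb (Polynomial.mapRingHom f)
  rw [map_gradedEval g f hfg] at this
  have h := this.of_comp_left
  rwa [coe_mapRingHom, map_monomial] at h

theorem map_algHom {S' : Type*} [CommRing S'] [Algebra R S'] (f : S →ₐ[R] S')
    (hb : IsHomIntegral R y n b) : IsHomIntegral R (fun j => f (y j)) n (f b) :=
  hb.map (RingHom.id R) (f : S →+* S') fun r => (f.commutes r).symm

theorem of_map {S' : Type*} [CommRing S'] [Algebra R S'] (f : S →ₐ[R] S')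
    (hf : Function.Injective f) (hb : IsHomIntegral R (fun j => f (y j)) n (f b)) :
    IsHomIntegral R y n b := by
  unfold IsHomIntegral at hb ⊢
  refine RingHom.IsIntegralElem.of_comp_injective (g := Polynomial.mapRingHom (f : S →+* S'))
    (Polynomial.map_injective _ hf) ?_
  rw [map_gradedEval (RingHom.id R) (f : S →+* S') fun r => (f.commutes r).symm]
  have hid : (MvPolynomial.map (RingHom.id R) : MvPolynomial σ R →+* _) = RingHom.id _ :=
    RingHom.ext fun p => MvPolynomial.map_id p
  rw [hid, RingHom.comp_id, coe_mapRingHom, map_monomial]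
  exact hb

theorem trans {τ : Type*} {z : τ → S} (hz : ∀ j, IsHomIntegral R y 1 (z j))
    (hb : IsHomIntegral R z n b) : IsHomIntegral R y n b := by
  refine RingHom.IsIntegralElem.trans_of_range (fun p => ?_) hb
  induction p using MvPolynomial.induction_on with
  | C r =>
    rw [coe_gradedEval_C, ← coe_gradedEval_C (σ := σ) (y := y)]
    exact RingHom.isIntegralElem_map _
  | add p q hp hq => rw [map_add]; exact RingHom.IsIntegralElem.add _ hp hq
  | mul_X p j hp =>
    rw [map_mul, coe_gradedEval_X]
    exact RingHom.IsIntegralElem.mul _ hp (hz j)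

theorem isIntegralElem (hb : IsHomIntegral R y n b) :
    (MvPolynomial.aeval y : MvPolynomial σ R →ₐ[R] S).toRingHom.IsIntegralElem b := by
  have := RingHom.IsIntegralElem.map hb (Polynomial.evalRingHom (1 : S))
  have h : (Polynomial.evalRingHom (1 : S)).comp (gradedEval R y : MvPolynomial σ R →+* S[X]) =
      (MvPolynomial.aeval y : MvPolynomial σ R →ₐ[R] S).toRingHom := by
    refine MvPolynomial.ringHom_ext (fun r => ?_) fun r => ?_
    · simp only [RingHom.comp_apply, coe_gradedEval_C]; simp
    · simp only [RingHom.comp_apply, coe_gradedEval_X]; simp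
  rw [h] at this
  simpa using this

end IsHomIntegral

theorem coeff_gradedEval_X {k : Type*} [CommRing k] (t : MvPolynomial σ k) (u : σ →₀ ℕ) (j : ℕ) :
    MvPolynomial.coeff u ((gradedEval k (fun j => (MvPolynomial.X j : MvPolynomial σ k)) t).coeff j)
      = if u.degree = j then MvPolynomial.coeff u t else 0 := by
  classical
  induction t using MvPolynomial.induction_on' with
  | add p q hp hq =>
    rw [map_add, coeff_add, MvPolynomial.coeff_add, hp, hq, MvPolynomial.coeff_add]
    split_ifs <;> simp
  | monomial v a =>
    have : gradedEval k (fun j => (MvPolynomial.X j : MvPolynomial σ k))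
        (MvPolynomial.monomial v a) = monomial v.degree (MvPolynomial.monomial v a) := by
      rw [gradedEval, MvPolynomial.aeval_monomial, MvPolynomial.monomial_eq (s := v)]
      simp only [← C_mul_X_eq_monomial, Finsupp.prod, mul_pow, Finset.prod_mul_distrib,
        Finset.prod_pow_eq_pow_sum]
      rw [← C_mul_X_pow_eq_monomial, Finsupp.degree_apply]
      rw [map_mul, map_prod]
      simp only [map_pow, mul_assoc]
      rfl
    rw [this, coeff_monomial, MvPolynomial.coeff_monomial]
    by_cases h : v = u
    · subst h
      rw [if_pos rfl]
      split_ifs <;> simp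
    · split_ifs <;> simp [h]

/-- A polynomial which is homogeneously integral of degree `N` over the variables is
homogeneous of degree `N`. -/
theorem IsHomIntegral.isHomogeneous {k : Type*} [Field k] {N : ℕ} {t : MvPolynomial σ k}
    (ht : IsHomIntegral k (fun j => (MvPolynomial.X j : MvPolynomial σ k)) N t) :
    t.IsHomogeneous N := by
  classical
  let Q := FractionRing ((MvPolynomial σ k)[X])
  let T : Q := algebraMap ((MvPolynomial σ k)[X]) Q X
  have hT : T ≠ 0 := by
    simp [T]
  let φ : MvPolynomial σ k →ₐ[k] (MvPolynomial σ k)[X] := gradedEval k MvPolynomial.X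
  let θ : (MvPolynomial σ k)[X] →+* Q :=
    eval₂RingHom ((algebraMap ((MvPolynomial σ k)[X]) Q).comp
      (φ : MvPolynomial σ k →+* (MvPolynomial σ k)[X])) T⁻¹
  have hθ : θ.comp (gradedEval k (fun j => (MvPolynomial.X j : MvPolynomial σ k)) :
      MvPolynomial σ k →+* (MvPolynomial σ k)[X]) =
      algebraMap (MvPolynomial σ k) Q := by
    refine MvPolynomial.ringHom_ext (fun r => ?_) fun r => ?_
    · simp only [RingHom.comp_apply, IsHomIntegral.coe_gradedEval_C]
      simp only [θ, coe_eval₂RingHom, eval₂_C, RingHom.comp_apply]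
      rw [IsScalarTower.algebraMap_apply (MvPolynomial σ k) ((MvPolynomial σ k)[X]) Q]
      congr 1
      simp [φ, gradedEval]
    · simp only [RingHom.comp_apply, IsHomIntegral.coe_gradedEval_X]
      simp only [θ, coe_eval₂RingHom, eval₂_monomial, RingHom.comp_apply, pow_one]
      have : (φ : MvPolynomial σ k →+* (MvPolynomial σ k)[X]) (MvPolynomial.X r) =
          C (MvPolynomial.X r) * X := by
        rw [IsHomIntegral.coe_gradedEval_X, C_mul_X_eq_monomial]
      rw [this, map_mul, mul_assoc, mul_inv_cancel₀ hT, mul_one]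
      rfl
  have h1 := RingHom.IsIntegralElem.map ht θ
  rw [hθ] at h1
  have h2 : IsIntegral ((MvPolynomial σ k)[X]) (θ (monomial N t)) := by
    have h1' : IsIntegral (MvPolynomial σ k) (θ (monomial N t)) := h1
    exact h1'.tower_top
  obtain ⟨g, hg⟩ := IsIntegrallyClosed.isIntegral_iff.1 h2
  have hgi : IsIntegral (MvPolynomial σ k) g := by
    have h1' : IsIntegral (MvPolynomial σ k) (θ (monomial N t)) := h1
    rw [← hg] at h1'
    exact (isIntegral_algebraMap_iff (IsFractionRing.injective ((MvPolynomial σ k)[X]) Q)).1 h1'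
  have hdeg : g.natDegree = 0 := by
    by_contra hne
    refine Polynomial.transcendental g hne ?_ hgi.isAlgebraic
    exact mem_nonZeroDivisors_of_ne_zero (leadingCoeff_ne_zero.2 (by rintro rfl; simp at hne))
  rw [eq_C_of_natDegree_eq_zero hdeg] at hg
  have h3 : φ t = monomial N (g.coeff 0) := by
    apply IsFractionRing.injective ((MvPolynomial σ k)[X]) Q
    have h4 : θ (monomial N t) = algebraMap ((MvPolynomial σ k)[X]) Q (φ t) * T⁻¹ ^ N := by
      simp [θ, eval₂_monomial]
    rw [h4] at hg
    rw [← C_mul_X_pow_eq_monomial, map_mul, hg, map_pow, mul_assoc, ← mul_pow,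
      inv_mul_cancel₀ hT, one_pow, mul_one]
  intro u hu
  have h5 := coeff_gradedEval_X t u u.degree
  rw [if_pos rfl] at h5
  have hw : Finsupp.weight (1 : σ → ℕ) u = u.degree :=
    (DFunLike.congr_fun (Finsupp.degree_eq_weight_one (R := ℕ) (σ := σ)) u).symm
  rw [hw]
  by_contra hne
  apply hu
  rw [← h5]
  change MvPolynomial.coeff u ((φ t).coeff u.degree) = 0
  rw [h3, coeff_monomial, if_neg (Ne.symm hne), MvPolynomial.coeff_zero]

end HomIntegral

open MvPolynomial in
/-- Over a perfect field there are enough graded additive maps of the polynomial ring which are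
inverse to the `q`-power Frobenius. -/
theorem exists_frobenius_projection {σ k : Type*} [Finite σ] [Nonempty σ] [Field k] (p N : ℕ)
    [ExpChar k p] [PerfectRing k p] {g : MvPolynomial σ k} (hg : g ≠ 0) :
    ∃ π : MvPolynomial σ k →+ MvPolynomial σ k,
      (∀ a h, π (a ^ p ^ N * h) = a * π h) ∧
      (∀ n h, h.IsHomogeneous (p ^ N * n) → (π h).IsHomogeneous n) ∧ π g ≠ 0 := by
  classical
  have := Fintype.ofFinite σ
  set q := p ^ N with hq
  have hq0 : 0 < q := pow_pos (expChar_pos k p) N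
  let e := iterateFrobeniusEquiv k p N
  have he : ∀ x, e x = x ^ q := fun x => iterateFrobeniusEquiv_def k p N x
  obtain ⟨v, hv⟩ := MvPolynomial.ne_zero_iff.1 hg
  let c : σ →₀ ℕ := Finsupp.equivFunOnFinite.symm fun i => v i % q
  let w : σ →₀ ℕ := Finsupp.equivFunOnFinite.symm fun i => v i / q
  have hc : ∀ i, c i < q := fun i => Nat.mod_lt _ hq0
  have hvw : v = q • w + c := by
    ext i
    simp [c, w, Nat.div_add_mod]
  have hinj : Function.Injective fun u : σ →₀ ℕ => q • u + c := by
    intro u u' h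
    ext i
    have := DFunLike.congr_fun h i
    simp only [Finsupp.coe_add, Finsupp.coe_smul, Pi.add_apply, Pi.smul_apply, smul_eq_mul,
      add_left_inj] at this
    exact Nat.eq_of_mul_eq_mul_left hq0 this
  have hex : ∀ h : MvPolynomial σ k, ∃ h' : MvPolynomial σ k,
      ∀ u, coeff u h' = e.symm (coeff (q • u + c) h) := by
    intro h
    refine ⟨∑ u ∈ h.support.preimage _ hinj.injOn, monomial u (e.symm (coeff (q • u + c) h)),
      fun u => ?_⟩
    rw [coeff_sum]
    simp only [coeff_monomial]
    rw [Finset.sum_ite_eq']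
    split_ifs with hu
    · rfl
    · rw [Finset.mem_preimage, notMem_support_iff] at hu
      rw [hu, map_zero]
  choose π₀ hπ₀ using hex
  let π₁ : MvPolynomial σ k →+ MvPolynomial σ k :=
    { toFun := π₀
      map_zero' := by ext u; simp [hπ₀]
      map_add' := fun a b => by ext u; simp [hπ₀] }
  have hπ₁ : ∀ h u, coeff u (π₁ h) = e.symm (coeff (q • u + c) h) := hπ₀
  have hlin : ∀ a h, π₁ (a ^ q * h) = a * π₁ h := by
    intro a h
    induction a using MvPolynomial.induction_on' with
    | add a b ha hb =>
      rw [hq, add_pow_expChar_pow, ← hq, add_mul, map_add, ha, hb, add_mul]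
    | monomial s α =>
      ext u
      rw [hπ₁, monomial_pow, coeff_monomial_mul', coeff_monomial_mul']
      have hiff : q • s ≤ q • u + c ↔ s ≤ u := by
        constructor
        · intro hle i
          have h1 := hle i
          simp only [Finsupp.coe_add, Finsupp.coe_smul, Pi.add_apply, Pi.smul_apply,
            smul_eq_mul] at h1
          by_contra hlt
          have h2 : u i + 1 ≤ s i := by omega
          have h3 := Nat.mul_le_mul_left q h2
          have := hc i
          rw [mul_add] at h3
          omega
        · intro hle
          exact (nsmul_le_nsmul_right hle q).trans le_self_add
      by_cases hsu : s ≤ u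
      · rw [if_pos (hiff.2 hsu), if_pos hsu, map_mul, hπ₁, ← he, RingEquiv.symm_apply_apply]
        congr 3
        obtain ⟨t, rfl⟩ := exists_add_of_le hsu
        rw [add_tsub_cancel_left, smul_add, add_assoc, add_tsub_cancel_left]
      · rw [if_neg (fun h => hsu (hiff.1 h)), if_neg hsu, map_zero]
  let i₀ : σ := Classical.arbitrary σ
  refine ⟨(AddMonoidHom.mulLeft (X i₀ ^ (c.degree / q))).comp π₁, ?_, ?_, ?_⟩
  · intro a h
    simp only [AddMonoidHom.comp_apply, AddMonoidHom.coe_mulLeft, hlin]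
    ring
  · intro n h hh
    simp only [AddMonoidHom.comp_apply, AddMonoidHom.coe_mulLeft]
    have hcoeff : ∀ u, coeff u (π₁ h) ≠ 0 → c.degree / q + u.degree = n := by
      intro u hu
      rw [hπ₁] at hu
      have h1 : coeff (q • u + c) h ≠ 0 := fun h0 => hu (by rw [h0, map_zero])
      have h2 : (q • u + c).degree = q * n := by
        by_contra hne
        exact h1 (hh.coeff_eq_zero hne)
      rw [map_add, map_nsmul, smul_eq_mul] at h2
      have h3 := Nat.mul_add_div hq0 u.degree c.degree
      rw [h2, Nat.mul_div_cancel_left _ hq0] at h3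
      omega
    rw [(π₁ h).as_sum, Finset.mul_sum]
    refine IsHomogeneous.sum _ _ _ fun u hu => ?_
    rw [← hcoeff u (mem_support_iff.1 hu)]
    refine IsHomogeneous.mul ?_ (isHomogeneous_monomial _ rfl)
    exact isHomogeneous_X_pow _ _
  · simp only [AddMonoidHom.comp_apply, AddMonoidHom.coe_mulLeft]
    refine mul_ne_zero (pow_ne_zero _ (X_ne_zero _)) fun h0 => hv ?_
    have h1 := hπ₁ g w
    rw [h0, coeff_zero, ← hvw] at h1
    exact (map_eq_zero_iff _ e.symm.injective).1 h1.symm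

/-- A nonzero element of a reduced torsion-free integral algebra survives in an algebraically
closed field. -/
theorem exists_algHom_ne_zero {R G Ω : Type*} [CommRing R] [IsDomain R] [CommRing G] [Algebra R G]
    [IsReduced G] [Module.IsTorsionFree R G] [Algebra.IsIntegral R G] [Field Ω] [IsAlgClosed Ω]
    [Algebra R Ω] [Module.IsTorsionFree R Ω] {g : G} (hg : g ≠ 0) :
    ∃ ψ : G →ₐ[R] Ω, ψ g ≠ 0 := by
  let M : Submonoid G := (nonZeroDivisors R).map (algebraMap R G) ⊔ Submonoid.powers g
  have hM : Disjoint ((⊥ : Ideal G) : Set G) M := by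
    rw [Set.disjoint_left]
    intro z hz hzM
    obtain ⟨_, ⟨a, ha, rfl⟩, _, ⟨n, rfl⟩, rfl⟩ := Submonoid.mem_sup.1 hzM
    have hz' : algebraMap R G a * g ^ n = 0 := hz
    rw [← Algebra.smul_def] at hz'
    rcases smul_eq_zero.1 hz' with h | h
    · exact nonZeroDivisors.ne_zero ha h
    · exact hg (eq_zero_of_pow_eq_zero h)
  obtain ⟨P, hP, -, hPM⟩ := Ideal.exists_le_prime_disjoint _ _ hM
  have hinj : Function.Injective (algebraMap R (G ⧸ P)) := by
    rw [injective_iff_map_eq_zero]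
    intro a ha
    by_contra hne
    have : algebraMap R G a ∈ P := by
      rw [← Ideal.Quotient.eq_zero_iff_mem]; exact ha
    exact Set.disjoint_left.1 hPM this
      (Submonoid.mem_sup_left ⟨a, mem_nonZeroDivisors_of_ne_zero hne, rfl⟩)
  have : Module.IsTorsionFree R (G ⧸ P) :=
    Module.isTorsionFree_iff_algebraMap_injective.2 hinj
  let f : (G ⧸ P) →ₐ[R] Ω := IsAlgClosed.lift
  refine ⟨f.comp (Ideal.Quotient.mkₐ R P), ?_⟩
  have hker : RingHom.ker f = ⊥ := by
    refine Ideal.eq_bot_of_comap_eq_bot (R := R) ?_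
    rw [eq_bot_iff]
    intro a ha
    have h1 : f (algebraMap R (G ⧸ P) a) = 0 := ha
    rw [f.commutes] at h1
    exact FaithfulSMul.algebraMap_injective R Ω (by rw [h1, map_zero])
  have hf : Function.Injective f := (RingHom.injective_iff_ker_eq_bot f).2 hker
  intro h0
  have h1 : Ideal.Quotient.mk P g = 0 := hf (by rw [map_zero]; exact h0)
  rw [Ideal.Quotient.eq_zero_iff_mem] at h1
  exact Set.disjoint_left.1 hPM h1 (Submonoid.mem_sup_right ⟨1, pow_one g⟩)

section

open MvPolynomial

theorem exists_frobenius_trace {k : Type*} [Field k] {σ : Type*} {G : Type*}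
    [CommRing G] [Algebra (MvPolynomial σ k) G] [Algebra k G]
    [IsScalarTower k (MvPolynomial σ k) G] [IsReduced G] [Module.IsTorsionFree (MvPolynomial σ k) G]
    [Algebra.IsIntegral (MvPolynomial σ k) G] (p : ℕ) [ExpChar k p]
    {m : ℕ} (b : Fin m → G) (S : Subalgebra (MvPolynomial σ k) G)
    (hS : ∀ g ∈ S, ∃ a : MvPolynomial σ k, a ≠ 0 ∧
      a • g ∈ Submodule.span (MvPolynomial σ k) (Set.range b))
    {g : G} (hgS : g ∈ S) (hg : g ≠ 0) :
    ∃ N : ℕ, ∃ τ : S →+ MvPolynomial σ k,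
      (∀ a x, τ (a • x) = a ^ p ^ N * τ x) ∧
      (∀ n (x : S), IsHomIntegral k (fun j => algebraMap (MvPolynomial σ k) G (X j)) n (x : G) →
        (τ x).IsHomogeneous (p ^ N * n)) ∧
      ∃ x : S, τ (⟨g, hgS⟩ * x) ≠ 0 := by
  classical
  let F := FractionRing (MvPolynomial σ k)
  let Ω := AlgebraicClosure F
  have hYF : Function.Injective (algebraMap (MvPolynomial σ k) F) := IsFractionRing.injective _ _
  have hYΩ : Function.Injective (algebraMap (MvPolynomial σ k) Ω) := by
    rw [IsScalarTower.algebraMap_eq (MvPolynomial σ k) F Ω]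
    exact (algebraMap F Ω).injective.comp hYF
  have : Module.IsTorsionFree (MvPolynomial σ k) Ω :=
    Module.isTorsionFree_iff_algebraMap_injective.2 hYΩ
  obtain ⟨ψ, hψ⟩ := exists_algHom_ne_zero (R := MvPolynomial σ k) (Ω := Ω) hg
  have : ExpChar F p := expChar_of_injective_algebraMap (algebraMap k F).injective p
  have : ExpChar Ω p := expChar_of_injective_algebraMap (algebraMap k Ω).injective p
  have hsep : ∀ x : Ω, ∃ n, x ^ p ^ n ∈ separableClosure F Ω := by
    intro x
    have : ExpChar (separableClosure F Ω) p := 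
      expChar_of_injective_algebraMap (algebraMap F (separableClosure F Ω)).injective p
    obtain ⟨n, y, hy⟩ := IsPurelyInseparable.pow_mem (separableClosure F Ω) p x
    exact ⟨n, hy ▸ y.2⟩
  choose ν hν using fun i => hsep (ψ (b i))
  let N := ∑ i, ν i
  set q := p ^ N with hq
  have hbsep : ∀ i, ψ (b i) ^ q ∈ separableClosure F Ω := by
    intro i
    have hle : ν i ≤ N :=
      Finset.single_le_sum (f := ν) (fun _ _ => Nat.zero_le _) (Finset.mem_univ i)
    rw [hq, ← Nat.add_sub_cancel' hle, pow_add, pow_mul]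
    exact pow_mem (hν i) _
  let T : Set Ω := (fun x => ψ x ^ q) '' (S : Set G)
  have hTspan : T ⊆ Submodule.span F (Set.range fun i => ψ (b i) ^ q) := by
    rintro _ ⟨x, hx, rfl⟩
    obtain ⟨a, ha, hax⟩ := hS x hx
    obtain ⟨c, hc⟩ := (Submodule.mem_span_range_iff_exists_fun _).1 hax
    have h1 : algebraMap F Ω (algebraMap _ F a) ^ q * ψ x ^ q =
        ∑ i, algebraMap F Ω (algebraMap _ F (c i)) ^ q * ψ (b i) ^ q := by
      have := congrArg (fun z => ψ z ^ q) hc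
      simp only [map_sum, Algebra.smul_def] at this
      rw [hq, ← iterateFrobenius_def, map_sum, ← hq] at this
      simp only [iterateFrobenius_def, ← hq, map_mul, AlgHom.commutes, mul_pow] at this
      exact this.symm
    have h2 : (algebraMap _ F a) ^ q ≠ 0 := by
      refine pow_ne_zero _ ?_
      simpa using hYF.ne ha
    refine (Submodule.smul_mem_iff _ h2).1 ?_
    rw [Algebra.smul_def, map_pow]
    simp only
    rw [h1]
    refine Submodule.sum_mem _ fun i _ => ?_
    rw [← map_pow, ← Algebra.smul_def]
    exact Submodule.smul_mem _ _ (Submodule.subset_span ⟨i, rfl⟩)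
  let TM : Submonoid Ω :=
    { carrier := T
      one_mem' := ⟨1, S.one_mem, by simp⟩
      mul_mem' := by
        rintro _ _ ⟨x, hx, rfl⟩ ⟨y, hy, rfl⟩
        exact ⟨x * y, S.mul_mem hx hy, by simp [mul_pow]⟩ }
  let E := IntermediateField.adjoin F T
  have hEspan : Subalgebra.toSubmodule E.toSubalgebra = Submodule.span F T := by
    rw [IntermediateField.adjoin_toSubalgebra_of_isAlgebraic fun x _ =>
      Algebra.IsAlgebraic.isAlgebraic x, Algebra.adjoin_eq_span]
    congr 1
    exact congrArg _ (Submonoid.closure_eq TM)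
  have hEmem : ∀ x, x ∈ E ↔ x ∈ Submodule.span F T := fun x => by rw [← hEspan]; rfl
  have : FiniteDimensional F E := by
    have h1 : Subalgebra.toSubmodule E.toSubalgebra ≤
        Submodule.span F (Set.range fun i => ψ (b i) ^ q) := by
      rw [hEspan, Submodule.span_le]; exact hTspan
    have : FiniteDimensional F (Submodule.span F (Set.range fun i => ψ (b i) ^ q)) :=
      FiniteDimensional.span_of_finite _ (Set.finite_range _)
    exact Submodule.finiteDimensional_of_le h1
  have : Algebra.IsSeparable F E := by
    rw [← le_separableClosure_iff, IntermediateField.adjoin_le_iff]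
    intro x hx
    refine Submodule.span_induction (p := fun x _ => x ∈ separableClosure F Ω) ?_ ?_ ?_ ?_
      (hTspan hx)
    · rintro _ ⟨i, rfl⟩; exact hbsep i
    · exact zero_mem _
    · intro x y _ _ hx hy; exact add_mem hx hy
    · intro a x _ hx; exact IntermediateField.smul_mem _ hx
  have hTE : ∀ x : S, ψ x ^ q ∈ E := fun x => IntermediateField.subset_adjoin _ _ ⟨x, x.2, rfl⟩
  let e : S → E := fun x => ⟨ψ x ^ q, hTE x⟩
  have he_add : ∀ x y, e (x + y) = e x + e y := fun x y => Subtype.ext (by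
    simp only [e, AddMemClass.coe_add, map_add, hq, add_pow_expChar_pow])
  have he_mul : ∀ x y, e (x * y) = e x * e y := fun x y => Subtype.ext (by
    simp only [e, MulMemClass.coe_mul, map_mul, mul_pow])
  have he_smul : ∀ (a : MvPolynomial σ k) x, e (a • x) = (algebraMap _ F (a ^ q)) • e x :=
    fun a x => Subtype.ext (by
      simp only [e, Subalgebra.coe_smul, map_smul, IntermediateField.coe_smul, smul_pow,
        algebraMap_smul])
  have : IsScalarTower (MvPolynomial σ k) E Ω := IsScalarTower.of_algebraMap_eq fun _ => rfl
  have hint : ∀ x : S, IsIntegral (MvPolynomial σ k) (e x) := by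
    intro x
    have h1 : IsIntegral (MvPolynomial σ k) (ψ x ^ q) :=
      ((Algebra.IsIntegral.isIntegral (R := MvPolynomial σ k) (x : G)).map ψ).pow q
    exact (isIntegral_algebraMap_iff (B := Ω) (algebraMap E Ω).injective).1 h1
  have htr : ∀ x : S, ∃ t : MvPolynomial σ k, algebraMap _ F t = Algebra.trace F E (e x) :=
    fun x => IsIntegrallyClosed.isIntegral_iff.1 (Algebra.isIntegral_trace (hint x))
  choose t ht using htr
  let τ : S →+ MvPolynomial σ k := AddMonoidHom.mk' t fun x y => hYF (by
    rw [map_add, ht, ht, ht, he_add, map_add])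
  refine ⟨N, τ, ?_, ?_, ?_⟩
  · intro a x
    apply hYF
    change algebraMap _ F (t (a • x)) = algebraMap _ F (a ^ q * t x)
    rw [ht, he_smul, map_smul, map_mul, ht, smul_eq_mul]
  · intro n x hx
    refine IsHomIntegral.isHomogeneous ?_
    change IsHomIntegral k _ (q * n) (t x)
    have h1 := hx.map_algHom (ψ.restrictScalars k)
    have h2 := h1.pow q
    have h3 : IsHomIntegral k (fun j => algebraMap (MvPolynomial σ k) E (X j)) (q * n) (e x) := by
      refine IsHomIntegral.of_map (E.val.restrictScalars k) E.val.injective ?_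
      convert h2 using 2
      · exact (ψ.commutes _).symm
      · rfl
    refine IsHomIntegral.of_map (IsScalarTower.toAlgHom k (MvPolynomial σ k) Ω) hYΩ ?_
    have h4 : IsScalarTower.toAlgHom k (MvPolynomial σ k) Ω (t x) = ∑ s : E →ₐ[F] Ω, s (e x) := by
      rw [← trace_eq_sum_embeddings, ← ht]
      rfl
    rw [h4]
    refine IsHomIntegral.sum fun s _ => ?_
    have h5 := h3.map_algHom (s.restrictScalars k)
    convert h5 using 2
    · exact ((s.restrictScalars (MvPolynomial σ k)).commutes _).symm
    · rfl
  · by_contra! hcon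
    have hz : e ⟨g, hgS⟩ ≠ 0 := by
      intro h
      exact pow_ne_zero q hψ (congrArg Subtype.val h)
    refine hz ((traceForm_nondegenerate F E).1 _ fun y => ?_)
    have hy := (hEmem y).1 y.2
    have key : ∀ (h : (y : Ω) ∈ E), Algebra.traceForm F E (e ⟨g, hgS⟩) ⟨y, h⟩ = 0 := by
      refine Submodule.span_induction (p := fun y _ => ∀ (h : (y : Ω) ∈ E),
        Algebra.traceForm F E (e ⟨g, hgS⟩) ⟨y, h⟩ = 0) ?_ ?_ ?_ ?_ hy
      · rintro _ ⟨x, hx, rfl⟩ h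
        have h1 := hcon ⟨x, hx⟩
        have h2 := ht (⟨g, hgS⟩ * ⟨x, hx⟩)
        rw [Algebra.traceForm_apply]
        have h3 : t (⟨g, hgS⟩ * ⟨x, hx⟩) = 0 := h1
        rw [h3, map_zero, he_mul] at h2
        exact h2.symm
      · intro h
        exact map_zero _
      · intro x y hx hy hx' hy' h
        have := (Algebra.traceForm F E (e ⟨g, hgS⟩)).map_add ⟨x, (hEmem x).2 hx⟩
          ⟨y, (hEmem y).2 hy⟩
        rw [hx', hy', add_zero] at this
        exact this
      · intro a x hx hx' h
        have := (Algebra.traceForm F E (e ⟨g, hgS⟩)).map_smul a ⟨x, (hEmem x).2 hx⟩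
        rw [hx', smul_zero] at this
        exact this
    exact key y.2

end

section

open MvPolynomial

section

variable {k : Type*} [Field k] [PerfectField k] {σ : Type*} [Finite σ] [Nonempty σ] {G : Type*}
    [CommRing G] [Algebra (MvPolynomial σ k) G] [Algebra k G]
    [IsScalarTower k (MvPolynomial σ k) G] [IsReduced G] [Module.IsTorsionFree (MvPolynomial σ k) G]
    [Algebra.IsIntegral (MvPolynomial σ k) G]
    {m : ℕ} (b : Fin m → G) (S : Subalgebra (MvPolynomial σ k) G)
    (hS : ∀ g ∈ S, ∃ a : MvPolynomial σ k, a ≠ 0 ∧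
      a • g ∈ Submodule.span (MvPolynomial σ k) (Set.range b))
    (hbS : ∀ i, b i ∈ S) {D : ℕ}
    (hb : ∀ i, IsHomIntegral k (fun j => algebraMap (MvPolynomial σ k) G (X j)) D (b i))

include hS hbS hb in
theorem exists_graded_functional_ne_zero {g : S} (hg : g ≠ 0) :
    ∃ f : S →ₗ[MvPolynomial σ k] MvPolynomial σ k,
      (∀ n (x : S), IsHomIntegral k (fun j => algebraMap (MvPolynomial σ k) G (X j)) n (x : G) →
        (f x).IsHomogeneous (n + D)) ∧ f g ≠ 0 := by
  obtain ⟨p, hp⟩ := ExpChar.exists k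
  have : PerfectRing k p := inferInstance
  obtain ⟨N, τ, hτs, hτh, x, hx⟩ := exists_frobenius_trace p b S hS g.2
    (fun h => hg (Subtype.ext h))
  obtain ⟨π, hπs, hπh, hπ⟩ := exists_frobenius_projection p N hx
  let f : S →ₗ[MvPolynomial σ k] MvPolynomial σ k :=
    { toFun := fun z => π (τ z)
      map_add' := fun y z => by rw [map_add, map_add]
      map_smul' := fun a z => by rw [hτs, hπs, smul_eq_mul, RingHom.id_apply] }
  obtain ⟨a, ha, hax⟩ := hS x x.2
  obtain ⟨c, hc⟩ := (Submodule.mem_span_range_iff_exists_fun _).1 hax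
  let b' : Fin m → S := fun i => ⟨b i, hbS i⟩
  have hc' : ∑ i, c i • b' i = a • x := Subtype.ext (by simpa [b'] using hc)
  have hex : ∃ i, f (g * b' i) ≠ 0 := by
    by_contra! hcon
    have h1 : f (g * (a • x)) = 0 := by
      rw [← hc', Finset.mul_sum, map_sum]
      refine Finset.sum_eq_zero fun i _ => ?_
      rw [mul_smul_comm, map_smul, hcon, smul_zero]
    rw [mul_smul_comm, map_smul, smul_eq_mul] at h1
    exact (mul_ne_zero ha hπ) h1
  obtain ⟨i, hi⟩ := hex
  refine ⟨f ∘ₗ LinearMap.mulRight _ (b' i), fun n z hz => ?_, hi⟩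
  exact hπh _ _ (hτh (n + D) (z * b' i) (hz.mul (hb i)))

include hS hbS hb in
theorem exists_graded_embedding :
    ∃ φ : S →ₗ[MvPolynomial σ k] (Fin m → MvPolynomial σ k), Function.Injective φ ∧
      ∀ n (x : S), IsHomIntegral k (fun j => algebraMap (MvPolynomial σ k) G (X j)) n (x : G) →
        ∀ j, (φ x j).IsHomogeneous (n + D) := by
  classical
  let Λ := {f : S →ₗ[MvPolynomial σ k] MvPolynomial σ k //
    ∀ n (x : S), IsHomIntegral k (fun j => algebraMap (MvPolynomial σ k) G (X j)) n (x : G) →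
        (f x).IsHomogeneous (n + D)}
  obtain ⟨T, hT, hmax⟩ := exists_maximal_linearIndepOn (MvPolynomial σ k) (fun f : Λ => f.1)
  let b' : Fin m → S := fun i => ⟨b i, hbS i⟩
  let ρ : (S →ₗ[MvPolynomial σ k] MvPolynomial σ k) →ₗ[MvPolynomial σ k]
      (Fin m → MvPolynomial σ k) := LinearMap.pi fun i => LinearMap.applyₗ (b' i)
  have hρ : LinearMap.ker ρ = ⊥ := by
    rw [LinearMap.ker_eq_bot']
    intro f hf
    ext1 x
    obtain ⟨a, ha, hax⟩ := hS x x.2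
    obtain ⟨c, hc⟩ := (Submodule.mem_span_range_iff_exists_fun _).1 hax
    have hc' : ∑ i, c i • b' i = a • x := Subtype.ext (by simpa [b'] using hc)
    have h1 : f (a • x) = 0 := by
      rw [← hc', map_sum]
      refine Finset.sum_eq_zero fun i _ => ?_
      rw [map_smul, show f (b' i) = 0 from congrFun hf i, smul_zero]
    rw [map_smul, smul_eq_mul] at h1
    exact (mul_eq_zero.1 h1).resolve_left ha
  have hind := LinearIndependent.map' hT ρ hρ
  have hfin : Finite T := hind.finite_of_isNoetherian
  have := Fintype.ofFinite T
  have hcard : Fintype.card T ≤ m := by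
    simpa using hind.fintype_card_le_finrank
  have hemb : Nonempty (T ↪ Fin m) := Function.Embedding.nonempty_of_card_le (by simpa using hcard)
  obtain ⟨e⟩ := hemb
  let w : Fin m → (S →ₗ[MvPolynomial σ k] MvPolynomial σ k) :=
    Function.extend e (fun t => t.1.1) 0
  have hw : ∀ t, w (e t) = t.1.1 := fun t => e.injective.extend_apply _ _ _
  refine ⟨LinearMap.pi w, ?_, ?_⟩
  · rw [← LinearMap.ker_eq_bot, LinearMap.ker_eq_bot']
    intro g hg
    by_contra hne
    obtain ⟨f, hf, hfg⟩ := exists_graded_functional_ne_zero b S hS hbS hb hne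
    have hTg : ∀ t ∈ T, t.1 g = 0 := by
      intro t ht
      have := congrFun hg (e ⟨t, ht⟩)
      rwa [LinearMap.pi_apply, hw] at this
    by_cases hfT : (⟨f, hf⟩ : Λ) ∈ T
    · exact hfg (hTg _ hfT)
    · obtain ⟨a, ha, haf⟩ := hmax _ hfT
      have h1 : Submodule.span (MvPolynomial σ k) ((fun f : Λ => f.1) '' T) ≤
          LinearMap.ker (LinearMap.applyₗ (R := MvPolynomial σ k)
            (M₂ := MvPolynomial σ k) g) := by
        rw [Submodule.span_le]
        rintro _ ⟨t, ht, rfl⟩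
        exact hTg t ht
      have h2 : a • f g = 0 := h1 haf
      exact (mul_ne_zero ha hfg) h2
  · intro n x hx j
    by_cases hj : ∃ t, e t = j
    · obtain ⟨t, rfl⟩ := hj
      rw [LinearMap.pi_apply, hw]
      exact t.1.2 n x hx
    · have : w j = 0 := Function.extend_apply' _ _ _ hj
      rw [LinearMap.pi_apply, this]
      exact isHomogeneous_zero _ _ _

end

end

section

open MvPolynomial

/-- A multiplicative filtration-like grading on an integral extension of a polynomial ring, whose
pieces consist of homogeneously integral elements. -/
structure IsGradedSystem (k : Type*) [Field k] (d : ℕ) (G : Type*) [CommRing G]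
    [Algebra (MvPolynomial (Fin (d + 1)) k) G] [Algebra k G] (Gr : ℕ → Submodule k G) : Prop where
  isHomIntegral : ∀ n, ∀ x ∈ Gr n,
    IsHomIntegral k (fun j => algebraMap (MvPolynomial (Fin (d + 1)) k) G (X j)) n x
  one_mem : (1 : G) ∈ Gr 0
  mul_mem : ∀ n m, ∀ x ∈ Gr n, ∀ y ∈ Gr m, x * y ∈ Gr (n + m)
  X_mem : ∀ j, algebraMap (MvPolynomial (Fin (d + 1)) k) G (X j) ∈ Gr 1

/-- The elements having a nonzero multiple in the span of the `b i`. -/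
def saturatedSpan (Y : Type*) [CommRing Y] [IsDomain Y] {G : Type*} [CommRing G] [Algebra Y G]
    {m : ℕ} (b : Fin m → G) : Submodule Y G where
  carrier := {g | ∃ a : Y, a ≠ 0 ∧ a • g ∈ Submodule.span Y (Set.range b)}
  zero_mem' := ⟨1, one_ne_zero, by simp⟩
  add_mem' := by
    rintro x y ⟨a, ha, hx⟩ ⟨c, hc, hy⟩
    refine ⟨a * c, mul_ne_zero ha hc, ?_⟩
    rw [smul_add]
    refine Submodule.add_mem _ ?_ ?_
    · rw [mul_comm, mul_smul]; exact Submodule.smul_mem _ _ hx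
    · rw [mul_smul]; exact Submodule.smul_mem _ _ hy
  smul_mem' := by
    rintro c x ⟨a, ha, hx⟩
    exact ⟨a, ha, by rw [smul_comm]; exact Submodule.smul_mem _ _ hx⟩

section saturatedSpan

variable {Y : Type*} [CommRing Y] [IsDomain Y] {G : Type*} [CommRing G] [Algebra Y G]
  {m : ℕ} {b : Fin m → G}

theorem mem_saturatedSpan_of_smul {a : Y} (ha : a ≠ 0) {g : G} (h : a • g ∈ saturatedSpan Y b) :
    g ∈ saturatedSpan Y b := by
  obtain ⟨c, hc, h⟩ := h
  exact ⟨c * a, mul_ne_zero hc ha, by rwa [mul_smul]⟩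

theorem self_mem_saturatedSpan (i : Fin m) : b i ∈ saturatedSpan Y b :=
  ⟨1, one_ne_zero, by rw [one_smul]; exact Submodule.subset_span ⟨i, rfl⟩⟩

theorem saturatedSpan_mul_mem (h : ∀ i j, b i * b j ∈ saturatedSpan Y b) {x y : G}
    (hx : x ∈ saturatedSpan Y b) (hy : y ∈ saturatedSpan Y b) : x * y ∈ saturatedSpan Y b := by
  obtain ⟨a, ha, hx⟩ := hx
  obtain ⟨c, hc, hy⟩ := hy
  refine mem_saturatedSpan_of_smul (mul_ne_zero ha hc) ?_
  rw [← smul_mul_smul_comm]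
  refine Submodule.span_induction₂ (p := fun x y _ _ => x * y ∈ saturatedSpan Y b)
    ?_ ?_ ?_ ?_ ?_ ?_ ?_ hx hy
  · rintro _ _ ⟨i, rfl⟩ ⟨j, rfl⟩; exact h i j
  · intros; simp
  · intros; simp
  · intro x y z _ _ _ h1 h2; rw [add_mul]; exact add_mem h1 h2
  · intro x y z _ _ _ h1 h2; rw [mul_add]; exact add_mem h1 h2
  · intro r x y _ _ h; rw [smul_mul_assoc]; exact Submodule.smul_mem _ _ h
  · intro r x y _ _ h; rw [mul_smul_comm]; exact Submodule.smul_mem _ _ h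

/-- Rescaling an independent family and adjoining a rescaled element outside its saturated span
gives an independent family. -/
theorem linearIndependent_snoc_of_notMem_saturatedSpan (hb : LinearIndependent Y b) {g : G}
    (hg : g ∉ saturatedSpan Y b) {a c : Y} (ha : a ≠ 0) (hc : c ≠ 0) :
    LinearIndependent Y (Fin.snoc (fun i => a • b i) (c • g) : Fin (m + 1) → G) := by
  rw [Fintype.linearIndependent_iff] at hb ⊢
  intro t ht
  rw [Fin.sum_univ_castSucc] at ht
  simp only [Fin.snoc_castSucc, Fin.snoc_last, smul_smul] at ht
  have hlast : t (Fin.last m) = 0 := by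
    by_contra hne
    refine hg (mem_saturatedSpan_of_smul (mul_ne_zero hne hc) ?_)
    rw [eq_neg_iff_add_eq_zero.2 ((add_comm _ _).trans ht)]
    exact neg_mem (Submodule.sum_mem _ fun i _ =>
      Submodule.smul_mem _ _ (self_mem_saturatedSpan i))
  rw [hlast, zero_mul, zero_smul, add_zero] at ht
  have := hb _ ht
  intro i
  induction i using Fin.lastCases with
  | last => exact hlast
  | cast i => exact (mul_eq_zero.1 (this i)).resolve_right ha

theorem saturatedSpan_le_snoc {a : Y} (ha : a ≠ 0) (g : G) :
    saturatedSpan Y b ≤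
      saturatedSpan Y (Fin.snoc (fun i => a • b i) g : Fin (m + 1) → G) := by
  rintro x ⟨c, hc, hx⟩
  refine mem_saturatedSpan_of_smul hc ?_
  revert hx
  generalize c • x = z
  refine fun hz => (Submodule.span_le.2 ?_ :
    Submodule.span Y (Set.range b) ≤ saturatedSpan Y _) hz
  rintro _ ⟨i, rfl⟩
  refine mem_saturatedSpan_of_smul ha ?_
  have := self_mem_saturatedSpan (Y := Y)
    (b := (Fin.snoc (fun i => a • b i) g : Fin (m + 1) → G)) i.castSucc
  rwa [Fin.snoc_castSucc] at this

end saturatedSpan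

section

variable {k : Type*} [Field k] {d : ℕ} {G : Type*}
    [CommRing G] [Algebra (MvPolynomial (Fin (d + 1)) k) G] [Algebra k G]
    [IsScalarTower k (MvPolynomial (Fin (d + 1)) k) G]
    {Gr : ℕ → Submodule k G} 

namespace IsGradedSystem

omit [IsScalarTower k (MvPolynomial (Fin (d + 1)) k) G] in
theorem pow_mem (h : IsGradedSystem k d G Gr) (j : Fin (d + 1)) (n : ℕ) :
    algebraMap (MvPolynomial (Fin (d + 1)) k) G (X j ^ n) ∈ Gr n := by
  induction n with
  | zero => simpa using h.one_mem
  | succ n ih => rw [pow_succ, map_mul]; exact h.mul_mem _ _ _ ih _ (h.X_mem j)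

omit [IsScalarTower k (MvPolynomial (Fin (d + 1)) k) G] in
theorem pow_smul_mem (h : IsGradedSystem k d G Gr) (j : Fin (d + 1)) {n m l : ℕ}
    (hl : n + m = l) {x : G} (hx : x ∈ Gr m) :
    (X j ^ n : MvPolynomial (Fin (d + 1)) k) • x ∈ Gr l := by
  rw [Algebra.smul_def, ← hl]
  exact h.mul_mem _ _ _ (h.pow_mem j n) _ hx

theorem algebraMap_mem (h : IsGradedSystem k d G Gr) {n : ℕ} {f : MvPolynomial (Fin (d + 1)) k}
    (hf : f.IsHomogeneous n) : algebraMap (MvPolynomial (Fin (d + 1)) k) G f ∈ Gr n := by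
  classical
  have hprod : ∀ (s : Finset (Fin (d + 1))) (u : Fin (d + 1) → ℕ),
      algebraMap (MvPolynomial (Fin (d + 1)) k) G (∏ i ∈ s, X i ^ u i) ∈ Gr (∑ i ∈ s, u i) := by
    intro s u
    induction s using Finset.induction_on with
    | empty => simpa using h.one_mem
    | insert a s ha ih =>
      rw [Finset.prod_insert ha, Finset.sum_insert ha, map_mul]
      exact h.mul_mem _ _ _ (h.pow_mem a _) _ ih
  rw [f.as_sum, map_sum]
  refine Submodule.sum_mem _ fun u hu => ?_
  have hdeg : ∑ i ∈ u.support, u i = n := by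
    rw [← Finsupp.degree_apply]
    by_contra hne
    exact mem_support_iff.1 hu (hf.coeff_eq_zero hne)
  rw [monomial_eq, ← smul_eq_C_mul, Algebra.algebraMap_eq_smul_one, smul_assoc,
    ← Algebra.algebraMap_eq_smul_one, Finsupp.prod]
  exact Submodule.smul_mem _ _ (hdeg ▸ hprod _ _)

theorem smul_mem (h : IsGradedSystem k d G Gr) {n m : ℕ} {f : MvPolynomial (Fin (d + 1)) k}
    (hf : f.IsHomogeneous n) {x : G} (hx : x ∈ Gr m) : f • x ∈ Gr (n + m) := by
  rw [Algebra.smul_def]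
  exact h.mul_mem _ _ _ (h.algebraMap_mem hf) _ hx

/-- Lower bound for the dimension of a graded piece. -/
theorem mul_choose_le_finrank (h : IsGradedSystem k d G Gr) {m : ℕ} {b : Fin m → G}
    (hb : LinearIndependent (MvPolynomial (Fin (d + 1)) k) b) {D : ℕ} (hbD : ∀ i, b i ∈ Gr D)
    (n : ℕ) [FiniteDimensional k (Gr (n + D))] :
    m * (n + d).choose d ≤ Module.finrank k (Gr (n + D)) := by
  have := (finrank_homogeneousSubmodule d n k).2
  let f : (Fin m → homogeneousSubmodule (Fin (d + 1)) k n) →ₗ[k] Gr (n + D) :=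
    { toFun := fun c => ⟨∑ i, (c i).1 • b i, Submodule.sum_mem _ fun i _ =>
        h.smul_mem (c i).2 (hbD i)⟩
      map_add' := fun c c' => Subtype.ext (by simp [add_smul, Finset.sum_add_distrib])
      map_smul' := fun a c => Subtype.ext (by simp [Finset.smul_sum]) }
  have hf : Function.Injective f := by
    rw [← LinearMap.ker_eq_bot, LinearMap.ker_eq_bot']
    intro c hc
    funext i
    exact Subtype.ext (Fintype.linearIndependent_iff.1 hb _ (congrArg Subtype.val hc) i)
  have := LinearMap.finrank_le_finrank_of_injective hf
  rwa [Module.finrank_pi_fintype, Finset.sum_const, Finset.card_univ, Fintype.card_fin,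
    (finrank_homogeneousSubmodule d n k).1, smul_eq_mul] at this

end IsGradedSystem

end

end

section

open MvPolynomial

section

variable {k : Type*} [Field k] {d : ℕ} {G : Type*}
    [CommRing G] [Algebra (MvPolynomial (Fin (d + 1)) k) G] [Algebra k G]
    {Gr : ℕ → Submodule k G} {m : ℕ} {b : Fin m → G} {D : ℕ}

namespace IsGradedSystem

theorem exists_snoc (h : IsGradedSystem k d G Gr)
    (hb : LinearIndependent (MvPolynomial (Fin (d + 1)) k) b) (hbD : ∀ i, b i ∈ Gr D)
    {n N : ℕ} (hn : n ≤ D + N) {g : G} (hg : g ∈ Gr n)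
    (hgb : g ∉ saturatedSpan (MvPolynomial (Fin (d + 1)) k) b) :
    ∃ b' : Fin (m + 1) → G, LinearIndependent (MvPolynomial (Fin (d + 1)) k) b' ∧
      (∀ i, b' i ∈ Gr (D + N)) ∧ saturatedSpan (MvPolynomial (Fin (d + 1)) k) b ≤
        saturatedSpan (MvPolynomial (Fin (d + 1)) k) b' := by
  have hX : ∀ n, (X 0 ^ n : MvPolynomial (Fin (d + 1)) k) ≠ 0 := fun n =>
    pow_ne_zero _ (X_ne_zero _)
  refine ⟨_, linearIndependent_snoc_of_notMem_saturatedSpan hb hgb (hX N) (hX (D + N - n)), ?_,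
    saturatedSpan_le_snoc (hX N) _⟩
  intro i
  induction i using Fin.lastCases with
  | last => rw [Fin.snoc_last]; exact h.pow_smul_mem 0 (by omega) hg
  | cast i => rw [Fin.snoc_castSucc]; exact h.pow_smul_mem 0 (by omega) (hbD i)

variable [IsScalarTower k (MvPolynomial (Fin (d + 1)) k) G] [IsReduced G]
    [Module.IsTorsionFree (MvPolynomial (Fin (d + 1)) k) G]
    [Algebra.IsIntegral (MvPolynomial (Fin (d + 1)) k) G] [PerfectField k]

theorem exists_embedding (h : IsGradedSystem k d G Gr) (hbD : ∀ i, b i ∈ Gr D)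
    (hb1 : (1 : G) ∈ saturatedSpan (MvPolynomial (Fin (d + 1)) k) b)
    (hbb : ∀ i j, b i * b j ∈ saturatedSpan (MvPolynomial (Fin (d + 1)) k) b) :
    ∃ φ : saturatedSpan (MvPolynomial (Fin (d + 1)) k) b →ₗ[MvPolynomial (Fin (d + 1)) k]
      (Fin m → MvPolynomial (Fin (d + 1)) k), Function.Injective φ ∧
      ∀ n, ∀ x : saturatedSpan (MvPolynomial (Fin (d + 1)) k) b, (x : G) ∈ Gr n →
        ∀ j, (φ x j).IsHomogeneous (n + D) := by
  obtain ⟨φ, hφ, hφh⟩ := exists_graded_embedding b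
    ((saturatedSpan (MvPolynomial (Fin (d + 1)) k) b).toSubalgebra hb1
      fun x y hx hy => saturatedSpan_mul_mem hbb hx hy)
    (fun g hg => hg) self_mem_saturatedSpan (fun i => h.isHomIntegral _ _ (hbD i))
  exact ⟨φ, hφ, fun n x hx => hφh n x (h.isHomIntegral n _ hx)⟩

theorem finrank_le (h : IsGradedSystem k d G Gr) (hbD : ∀ i, b i ∈ Gr D)
    (hb1 : (1 : G) ∈ saturatedSpan (MvPolynomial (Fin (d + 1)) k) b)
    (hbb : ∀ i j, b i * b j ∈ saturatedSpan (MvPolynomial (Fin (d + 1)) k) b) {n : ℕ}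
    (hn : ∀ x ∈ Gr n, x ∈ saturatedSpan (MvPolynomial (Fin (d + 1)) k) b) :
    FiniteDimensional k (Gr n) ∧ Module.finrank k (Gr n) ≤ m * (n + D + d).choose d := by
  obtain ⟨φ, hφ, hφh⟩ := h.exists_embedding hbD hb1 hbb
  have := (finrank_homogeneousSubmodule d (n + D) k).2
  let f : Gr n →ₗ[k] (Fin m → homogeneousSubmodule (Fin (d + 1)) k (n + D)) :=
    { toFun := fun x i => ⟨φ ⟨x.1, hn x.1 x.2⟩ i, hφh n _ x.2 i⟩
      map_add' := fun x y => by
        funext i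
        exact Subtype.ext (congrFun (φ.map_add ⟨x.1, hn x.1 x.2⟩ ⟨y.1, hn y.1 y.2⟩) i)
      map_smul' := fun a x => by
        funext i
        exact Subtype.ext (congrFun ((φ.restrictScalars k).map_smul a ⟨x.1, hn x.1 x.2⟩) i) }
  have hf : Function.Injective f := by
    intro x y hxy
    have : (⟨x.1, hn x.1 x.2⟩ : saturatedSpan (MvPolynomial (Fin (d + 1)) k) b) =
        ⟨y.1, hn y.1 y.2⟩ := hφ (by
      funext i
      exact congrArg Subtype.val (congrFun hxy i))
    exact Subtype.ext (Subtype.mk.inj this)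
  refine ⟨Module.Finite.of_injective f hf, ?_⟩
  have := LinearMap.finrank_le_finrank_of_injective hf
  rwa [Module.finrank_pi_fintype, Finset.sum_const, Finset.card_univ, Fintype.card_fin,
    (finrank_homogeneousSubmodule d (n + D) k).1, smul_eq_mul] at this

/-- If independent families are bounded in size, the dimensions of the pieces of a graded system
grow like a multiple of those of the polynomial ring. -/
theorem exists_growth [Nontrivial G] (h : IsGradedSystem k d G Gr) {M : ℕ}
    (hM : ∀ m (b : Fin m → G), LinearIndependent (MvPolynomial (Fin (d + 1)) k) b → m ≤ M) :
    (∀ n, FiniteDimensional k (Gr n)) ∧ ∃ r C : ℕ, 1 ≤ r ∧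
      (∀ n, Module.finrank k (Gr n) ≤ r * (n + C + d).choose d) ∧
      ∀ n, r * (n + d).choose d ≤ Module.finrank k (Gr (n + C)) := by
  classical
  let P : ℕ → Prop := fun m => ∃ (D : ℕ) (b : Fin m → G),
    LinearIndependent (MvPolynomial (Fin (d + 1)) k) b ∧ ∀ i, b i ∈ Gr D
  have hP0 : P 0 := ⟨0, Fin.elim0, linearIndependent_empty_type, fun i => i.elim0⟩
  let r := Nat.findGreatest P M
  obtain ⟨D, b, hb, hbD⟩ : P r := Nat.findGreatest_spec (Nat.zero_le M) hP0
  have hmax : ∀ n, ∀ x ∈ Gr n, x ∈ saturatedSpan (MvPolynomial (Fin (d + 1)) k) b := by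
    intro n x hx
    by_contra hxb
    obtain ⟨b', hb', hbD', -⟩ := h.exists_snoc hb hbD (N := n) (by omega) hx hxb
    have := Nat.le_findGreatest (P := P) (hM _ _ hb') ⟨_, b', hb', hbD'⟩
    exact absurd this (by simp [r])
  have hb1 := hmax 0 1 h.one_mem
  have hbb := fun i j => hmax _ _ (h.mul_mem _ _ _ (hbD i) _ (hbD j))
  have key := fun n => h.finrank_le hbD hb1 hbb (hmax n)
  refine ⟨fun n => (key n).1, r, D, ?_, fun n => (key n).2, fun n => ?_⟩
  · by_contra hr
    have hr : r = 0 := by omega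
    obtain ⟨φ, hφ, -⟩ := h.exists_embedding hbD hb1 hbb
    have h1 : (⟨1, hb1⟩ : saturatedSpan (MvPolynomial (Fin (d + 1)) k) b) = 0 := by
      refine hφ ?_
      funext i
      exact absurd i.2 (by omega)
    have h2 : (1 : G) = 0 := congrArg Subtype.val h1
    exact one_ne_zero h2
  · have := (key (n + D)).1
    exact h.mul_choose_le_finrank hb hbD n

end IsGradedSystem
end

/-- From degree `n₀` on, every graded system with Hilbert function `h` is generated by the
variables. -/
def IsUniformGenerationBound (d : ℕ) (h : ℕ → ℕ) (n₀ : ℕ) : Prop :=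
  ∀ (k G : Type u) [Field k] [CommRing G]
    [Algebra (MvPolynomial (Fin (d + 1)) k) G] [Algebra k G]
    [IsScalarTower k (MvPolynomial (Fin (d + 1)) k) G] [IsReduced G]
    [Module.IsTorsionFree (MvPolynomial (Fin (d + 1)) k) G]
    [Algebra.IsIntegral (MvPolynomial (Fin (d + 1)) k) G] [PerfectField k] [Nontrivial G]
    (Gr : ℕ → Submodule k G), IsGradedSystem k d G Gr →
    (∀ n, FiniteDimensional k (Gr n)) → (∀ n, Module.finrank k (Gr n) = h n) →
    ∀ n ≥ n₀, ∀ x ∈ Gr (n + 1), x ∈ Submodule.span k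
      {z | ∃ i, ∃ y ∈ Gr n, z = algebraMap (MvPolynomial (Fin (d + 1)) k) G (X i) * y}

/-- Graded systems over perfect fields with prescribed Hilbert function satisfy a
uniform bound for the degrees of generators. -/
theorem exists_uniform_generation_bound (d r C : ℕ) (hr : 1 ≤ r) (h : ℕ → ℕ)
    (hup : ∀ n, h n ≤ r * (n + C + d).choose d) (hlow : ∀ n, r * (n + d).choose d ≤ h (n + C)) :
    ∃ n₀ : ℕ, IsUniformGenerationBound.{u} d h n₀ := by
  have claim : ∀ m, 1 ≤ m → m ≤ r → ∃ D : ℕ, ∀ (k G : Type u) [Field k] [CommRing G]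
      [Algebra (MvPolynomial (Fin (d + 1)) k) G] [Algebra k G]
      [IsScalarTower k (MvPolynomial (Fin (d + 1)) k) G] [IsReduced G]
      [Module.IsTorsionFree (MvPolynomial (Fin (d + 1)) k) G]
      [Algebra.IsIntegral (MvPolynomial (Fin (d + 1)) k) G] [PerfectField k] [Nontrivial G]
      (Gr : ℕ → Submodule k G), IsGradedSystem k d G Gr →
      (∀ n, FiniteDimensional k (Gr n)) → (∀ n, Module.finrank k (Gr n) = h n) →
      ∃ b : Fin m → G, LinearIndependent (MvPolynomial (Fin (d + 1)) k) b ∧ (∀ i, b i ∈ Gr D) ∧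
        (1 : G) ∈ saturatedSpan (MvPolynomial (Fin (d + 1)) k) b := by
    intro m hm
    induction m, hm using Nat.le_induction with
    | base =>
      intro _
      refine ⟨0, ?_⟩
      intro k G _ _ _ _ _ _ _ _ _ _ Gr hGr _ _
      refine ⟨fun _ => 1, ?_, fun _ => hGr.one_mem, self_mem_saturatedSpan (b := fun _ => 1) 0⟩
      rw [Fintype.linearIndependent_iff]
      intro g hg i
      rw [Fin.sum_univ_one] at hg
      rw [Fin.eq_zero i]
      exact (smul_eq_zero.1 hg).resolve_right one_ne_zero
    | succ m hm ih =>
      intro hmr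
      obtain ⟨D, hD⟩ := ih (by omega)
      have hgrow : ∃ n, m * (n + (3 * D + C) + d).choose d < r * (n + d).choose d := by
        by_contra! hcon
        rcases growth_comparison hr hcon with h | h <;> omega
      obtain ⟨n, hn⟩ := hgrow
      let N := n + 2 * D + C
      refine ⟨D + N, ?_⟩
      intro k G _ _ _ _ _ _ _ _ _ _ Gr hGr hfd hrank
      obtain ⟨b, hb, hbD, hb1⟩ := hD k G Gr hGr hfd hrank
      have hex : ∃ l ≤ N, ∃ g ∈ Gr l, g ∉ saturatedSpan (MvPolynomial (Fin (d + 1)) k) b := by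
        by_contra! hcon
        have h1 := (hGr.finrank_le hbD hb1
          (fun i j => hcon (D + D) (by omega) _ (hGr.mul_mem _ _ _ (hbD i) _ (hbD j)))
          (hcon N le_rfl)).2
        rw [hrank] at h1
        have h2 := hlow (n + 2 * D)
        have h3 : (n + d).choose d ≤ (n + 2 * D + d).choose d :=
          Nat.choose_le_choose d (by omega)
        have h4 : N + D + d = n + (3 * D + C) + d := by omega
        rw [h4] at h1
        exact absurd ((Nat.mul_le_mul_left r h3).trans (h2.trans h1)) (by omega)
      obtain ⟨l, hl, g, hg, hgb⟩ := hex
      obtain ⟨b', hb', hbD', hle⟩ := hGr.exists_snoc hb hbD (N := N) (by omega) hg hgb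
      exact ⟨b', hb', hbD', hle hb1⟩
  obtain ⟨D, hD⟩ := claim r hr le_rfl
  obtain ⟨n₀, hn₀⟩ := exists_generation_bound_of_finrank r (Fin (d + 1)) D h
  refine ⟨n₀, ?_⟩
  intro k G _ _ _ _ _ _ _ _ _ _ Gr hGr hfd hrank n hn x hx
  obtain ⟨b, hb, hbD, hb1⟩ := hD k G Gr hGr hfd hrank
  have hmax : ∀ l, ∀ g ∈ Gr l, g ∈ saturatedSpan (MvPolynomial (Fin (d + 1)) k) b := by
    intro l g hg
    by_contra hgb
    obtain ⟨b', hb', hbD', -⟩ := hGr.exists_snoc hb hbD (N := l) (by omega) hg hgb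
    have h1 : ∀ j, (r + 1) * (j + d).choose d ≤ r * (j + (D + l + C) + d).choose d := by
      intro j
      have h2 := hGr.mul_choose_le_finrank hb' hbD' j
      rw [hrank] at h2
      have h3 := hup (j + (D + l))
      rw [show j + (D + l) + C = j + (D + l + C) by omega] at h3
      exact h2.trans h3
    rcases growth_comparison (by omega) h1 with h | h <;> omega
  have hbb := fun i j => hmax _ _ (hGr.mul_mem _ _ _ (hbD i) _ (hbD j))
  obtain ⟨φ, hφ, hφh⟩ := hGr.exists_embedding hbD hb1 hbb
  let ι : ∀ l, Gr l →ₗ[k] saturatedSpan (MvPolynomial (Fin (d + 1)) k) b := fun l =>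
    { toFun := fun x => ⟨x.1, hmax l _ x.2⟩
      map_add' := fun _ _ => rfl
      map_smul' := fun _ _ => rfl }
  let ψ : ∀ l, Gr l →ₗ[k] (Fin r → MvPolynomial (Fin (d + 1)) k) := fun l =>
    (φ.restrictScalars k) ∘ₗ ι l
  have hψ : ∀ l, Function.Injective (ψ l) := fun l x y hxy =>
    Subtype.ext (Subtype.mk.inj (hφ hxy))
  have key := hn₀ k (fun l => LinearMap.range (ψ l)) ?_ ?_ ?_ n hn (ψ (n + 1) ⟨x, hx⟩) ⟨_, rfl⟩
  · have h1 : ∀ z ∈ Submodule.span k {z : Fin r → MvPolynomial (Fin (d + 1)) k |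
        ∃ i, ∃ y ∈ LinearMap.range (ψ n), z = (X i : MvPolynomial (Fin (d + 1)) k) • y},
        ∃ w : saturatedSpan (MvPolynomial (Fin (d + 1)) k) b, φ w = z ∧
          (w : G) ∈ Submodule.span k
        {z | ∃ i, ∃ y ∈ Gr n, z = algebraMap (MvPolynomial (Fin (d + 1)) k) G (X i) * y} := by
      intro z hz
      induction hz using Submodule.span_induction with
      | mem z hz =>
        obtain ⟨i, _, ⟨y, rfl⟩, rfl⟩ := hz
        refine ⟨(X i : MvPolynomial (Fin (d + 1)) k) • ι n y, map_smul _ _ _,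
          Submodule.subset_span ⟨i, y, y.2, ?_⟩⟩
        rw [← Algebra.smul_def]
        rfl
      | zero => exact ⟨0, map_zero _, zero_mem _⟩
      | add z z' _ _ h h' =>
        obtain ⟨w, rfl, hw⟩ := h
        obtain ⟨w', rfl, hw'⟩ := h'
        exact ⟨w + w', map_add _ _ _, add_mem hw hw'⟩
      | smul a z _ h =>
        obtain ⟨w, rfl, hw⟩ := h
        exact ⟨a • w, (φ.restrictScalars k).map_smul a w, Submodule.smul_mem _ a hw⟩
    obtain ⟨w, hw, hw'⟩ := h1 _ key
    have h2 : w = ι (n + 1) ⟨x, hx⟩ := hφ hw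
    rw [h2] at hw'
    exact hw'
  · rintro l _ ⟨y, rfl⟩ j
    exact hφh l _ y.2 j
  · rintro l i _ ⟨y, rfl⟩
    refine ⟨⟨_, hGr.pow_smul_mem i (add_comm 1 l) y.2⟩, ?_⟩
    have : ι (l + 1) ⟨_, hGr.pow_smul_mem i (add_comm 1 l) y.2⟩ =
      (X i : MvPolynomial (Fin (d + 1)) k) • ι l y := Subtype.ext (by
        change (X i ^ 1 : MvPolynomial (Fin (d + 1)) k) • (y : G) = X i • (y : G)
        rw [pow_one])
    change φ (ι (l + 1) ⟨_, hGr.pow_smul_mem i (add_comm 1 l) y.2⟩) = _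
    rw [this, map_smul]
    rfl
  · intro l
    rw [LinearMap.finrank_range_of_inj (hψ l), hrank]

end

section

/-- A homomorphism to an algebraically closed field extends along an integral extension. -/
theorem exists_ringHom_comp_algebraMap_eq {A B K : Type*} [CommRing A] [CommRing B] [Algebra A B]
    [Algebra.IsIntegral A B] [FaithfulSMul A B] [Field K] [IsAlgClosed K] (φ : A →+* K) :
    ∃ ψ : B →+* K, ψ.comp (algebraMap A B) = φ := by
  let P := RingHom.ker φ
  have hP : P.IsPrime := RingHom.ker_isPrime φ
  obtain ⟨Q, -, hQ, hQP⟩ := Ideal.exists_ideal_over_prime_of_isIntegral P (⊥ : Ideal B) (by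
    rw [← RingHom.ker_eq_comap_bot,
      (RingHom.injective_iff_ker_eq_bot _).1 (FaithfulSMul.algebraMap_injective A B)]
    exact bot_le)
  have : Q.LiesOver P := ⟨hQP.symm⟩
  let := (Ideal.Quotient.lift P φ fun a ha => ha).toAlgebra
  have hinj : Function.Injective (algebraMap (A ⧸ P) K) := RingHom.kerLift_injective φ
  have : Module.IsTorsionFree (A ⧸ P) K := Module.isTorsionFree_iff_algebraMap_injective.2 hinj
  have hinj' : Function.Injective (algebraMap (A ⧸ P) (B ⧸ Q)) :=
    FaithfulSMul.algebraMap_injective _ _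
  have : Module.IsTorsionFree (A ⧸ P) (B ⧸ Q) :=
    Module.isTorsionFree_iff_algebraMap_injective.2 hinj'
  let f : (B ⧸ Q) →ₐ[A ⧸ P] K := IsAlgClosed.lift
  refine ⟨(f : (B ⧸ Q) →+* K).comp (Ideal.Quotient.mk Q), ?_⟩
  ext a
  exact f.commutes (Ideal.Quotient.mk P a)

end

section

open Polynomial

section

variable {V : Type*} [CommRing V] [IsDomain V]

theorem IsIntegrallyClosed.exists_eval_eq_zero [IsIntegrallyClosed V] (K : Type*) [Field K]
    [Algebra V K] [IsFractionRing V K] [IsAlgClosed K] {p : V[X]} (hp : p.Monic)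
    (hd : p.natDegree ≠ 0) : ∃ x, p.eval x = 0 := by
  have hd' : (p.map (algebraMap V K)).degree ≠ 0 := by
    rw [hp.degree_map, degree_eq_natDegree hp.ne_zero]
    exact_mod_cast hd
  obtain ⟨z, hz⟩ := IsAlgClosed.exists_root _ hd'
  have hz' : eval₂ (algebraMap V K) z p = 0 := by rwa [IsRoot, eval_map] at hz
  obtain ⟨x, rfl⟩ := IsIntegrallyClosed.isIntegral_iff.1 (⟨p, hp, hz'⟩ : IsIntegral V z)
  refine ⟨x, IsFractionRing.injective V K ?_⟩
  rwa [eval₂_at_apply, ← map_zero (algebraMap V K)] at hz'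

theorem isAlgClosed_residueField [IsIntegrallyClosed V] [IsLocalRing V] (K : Type*) [Field K]
    [Algebra V K] [IsFractionRing V K] [IsAlgClosed K] :
    IsAlgClosed (IsLocalRing.ResidueField V) := by
  refine IsAlgClosed.of_exists_root _ fun p hp hirr => ?_
  have hl : p ∈ lifts (IsLocalRing.residue V) := by
    rw [lifts_iff_coeff_lifts]
    exact fun n => IsLocalRing.residue_surjective _
  obtain ⟨q, hq, hqd, hqm⟩ := lifts_and_natDegree_eq_and_monic hl hp
  obtain ⟨x, hx⟩ := IsIntegrallyClosed.exists_eval_eq_zero K hqm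
    (by rw [hqd]; exact hirr.natDegree_pos.ne')
  exact ⟨IsLocalRing.residue V x, by rw [← hq, eval_map_apply, hx, map_zero]⟩

theorem exists_isUnit_root [IsIntegrallyClosed V] [IsLocalRing V] (K : Type*) [Field K]
    [Algebra V K] [IsFractionRing V K] [IsAlgClosed K] {p : V[X]} (hp : p.Monic) {i : ℕ}
    (hi : i < p.natDegree) (hu : IsUnit (p.coeff i)) : ∃ x, IsUnit x ∧ p.eval x = 0 := by
  by_contra! hcon
  have key : ∀ n (q : V[X]), q.Monic → q.natDegree = n → (∀ x, IsUnit x → q.eval x ≠ 0) →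
      q.map (IsLocalRing.residue V) = X ^ n := by
    intro n
    induction n with
    | zero =>
      intro q hq hqn _
      rw [hq.natDegree_eq_zero.1 hqn]
      simp
    | succ n ih =>
      intro q hq hqn hroot
      obtain ⟨x, hx⟩ := IsIntegrallyClosed.exists_eval_eq_zero K hq (by omega)
      obtain ⟨q', rfl⟩ := dvd_iff_isRoot.2 hx
      have hq' : q'.Monic := (monic_X_sub_C x).of_mul_monic_left hq
      rw [(monic_X_sub_C x).natDegree_mul hq', natDegree_X_sub_C] at hqn
      have hxm : IsLocalRing.residue V x = 0 := by
        by_contra hne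
        exact hroot x ((IsLocalRing.residue_ne_zero_iff_isUnit x).1 hne) hx
      rw [Polynomial.map_mul, ih q' hq' (by omega) fun y hy hy' =>
        hroot y hy (by rw [eval_mul, hy', mul_zero])]
      simp [hxm, pow_succ']
  have h1 := key _ p hp rfl fun x hx => hcon x hx
  have h2 := congrArg (fun q => q.coeff i) h1
  simp only [coeff_map, coeff_X_pow, hi.ne, if_false] at h2
  exact (IsLocalRing.residue_ne_zero_iff_isUnit _).2 hu h2

end

end

section

open Polynomial

variable (V K σ : Type*) [CommRing V] [Field K] [Algebra V K]
  {B : Type*} [CommRing B] [Algebra (MvPolynomial σ K) B]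

/-- The element `f` of an extension of `K[X]` is integral over `V[X]`. -/
def IsBallElem (f : B) : Prop :=
  ((algebraMap (MvPolynomial σ K) B).comp
    (MvPolynomial.map (algebraMap V K))).IsIntegralElem f

variable {V K σ} [IsDomain V] [ValuationRing V] [IsFractionRing V K] [IsAlgClosed K]
  [Algebra K B] [IsScalarTower K (MvPolynomial σ K) B] [IsDomain B]
  [FaithfulSMul (MvPolynomial σ K) B] [Algebra.IsIntegral (MvPolynomial σ K) B]

theorem exists_specialization_of_root {f : B} (η : σ → K) {z : K}
    (hz : (minpoly (MvPolynomial σ K) f).eval₂ (MvPolynomial.eval η) z = 0) :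
    ∃ P : B →ₐ[K] K, (∀ a, P (algebraMap (MvPolynomial σ K) B a) = MvPolynomial.eval η a) ∧
      P f = z := by
  have hf := Algebra.IsIntegral.isIntegral (R := MvPolynomial σ K) f
  have : Module.IsTorsionFree (MvPolynomial σ K) B :=
    Module.isTorsionFree_iff_algebraMap_injective.2 (FaithfulSMul.algebraMap_injective _ _)
  let φ : Algebra.adjoin (MvPolynomial σ K) {f} →+* K :=
    (AdjoinRoot.lift (MvPolynomial.eval η) z hz).comp (minpoly.equivAdjoin hf).symm
  have hφ : ∀ a, φ (algebraMap _ _ a) = MvPolynomial.eval η a := by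
    intro a
    change (AdjoinRoot.lift (MvPolynomial.eval η) z hz) ((minpoly.equivAdjoin hf).symm _) = _
    rw [AlgEquiv.commutes]
    exact AdjoinRoot.lift_of hz
  have hφf : φ ⟨f, Algebra.subset_adjoin rfl⟩ = z := by
    change (AdjoinRoot.lift (MvPolynomial.eval η) z hz) ((minpoly.equivAdjoin hf).symm _) = _
    rw [show (⟨f, Algebra.subset_adjoin rfl⟩ : Algebra.adjoin (MvPolynomial σ K) {f}) =
      minpoly.equivAdjoin hf (AdjoinRoot.root _) from Subtype.ext (by
        simp [AdjoinRoot.Minpoly.toAdjoin]), AlgEquiv.symm_apply_apply]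
    exact AdjoinRoot.lift_root hz
  have : Algebra.IsIntegral (Algebra.adjoin (MvPolynomial σ K) {f}) B :=
    Algebra.IsIntegral.tower_top (R := MvPolynomial σ K)
  have : FaithfulSMul (Algebra.adjoin (MvPolynomial σ K) {f}) B :=
    (faithfulSMul_iff_algebraMap_injective _ _).2 Subtype.val_injective
  obtain ⟨ψ, hψ⟩ := exists_ringHom_comp_algebraMap_eq (B := B) φ
  have h1 : ∀ a, ψ (algebraMap (MvPolynomial σ K) B a) = MvPolynomial.eval η a := fun a => by
    rw [← hφ, ← hψ]; rfl
  refine ⟨⟨ψ, fun r => ?_⟩, h1, ?_⟩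
  · change ψ (algebraMap K B r) = r
    rw [IsScalarTower.algebraMap_apply K (MvPolynomial σ K) B, h1]
    simp
  · change ψ f = z
    rw [← hφf, ← hψ]; rfl

/-- Every nonzero element can be rescaled to an integral element having unit values at suitable
specializations, at which a given polynomial with nonzero residue takes a unit value. -/
theorem exists_smul_specialization [Finite σ] {f : B} (hf : f ≠ 0) :
    ∃ γ : K, γ ≠ 0 ∧ ∃ f' : B, f = γ • f' ∧ IsBallElem V K σ f' ∧
      ∀ a : MvPolynomial σ V, MvPolynomial.map (IsLocalRing.residue V) a ≠ 0 →
        ∃ P : B →ₐ[K] K,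
          (∀ j, P (algebraMap (MvPolynomial σ K) B (MvPolynomial.X j)) ∈ (algebraMap V K).range) ∧
          (∃ u : V, IsUnit u ∧ P f' = algebraMap V K u) ∧
          ∃ u : V, IsUnit u ∧ P (algebraMap (MvPolynomial σ K) B
            (MvPolynomial.map (algebraMap V K) a)) = algebraMap V K u := by
  classical
  have hint := Algebra.IsIntegral.isIntegral (R := MvPolynomial σ K) f
  set q := minpoly (MvPolynomial σ K) f with hq
  have hqm : q.Monic := minpoly.monic hint
  set e := q.natDegree with he
  have hqf : f ^ e + ∑ i ∈ Finset.range e, q.coeff i • f ^ i = 0 := by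
    have h1 := minpoly.aeval (MvPolynomial σ K) f
    rw [← hq, hqm.as_sum] at h1
    simpa [Algebra.smul_def] using h1
  let s : Finset (Σ _ : ℕ, σ →₀ ℕ) := (Finset.range e).sigma fun i => (q.coeff i).support
  have hs : s.Nonempty := by
    rw [Finset.nonempty_iff_ne_empty]
    intro hempty
    refine hf (eq_zero_of_pow_eq_zero (n := e) ?_)
    rw [← hqf, left_eq_add]
    refine Finset.sum_eq_zero fun i hi => ?_
    have : q.coeff i = 0 := by
      rw [← MvPolynomial.support_eq_empty]
      by_contra hne
      obtain ⟨u, hu⟩ := Finset.nonempty_iff_ne_empty.2 hne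
      have : (⟨i, u⟩ : Σ _ : ℕ, σ →₀ ℕ) ∈ s := Finset.mem_sigma.2 ⟨hi, hu⟩
      rw [hempty] at this
      exact absurd this (Finset.notMem_empty _)
    rw [this, zero_smul]
  have ht : ∀ z : Σ _ : ℕ, σ →₀ ℕ, ∃ t : K, z ∈ s → t ^ (e - z.1) =
      MvPolynomial.coeff z.2 (q.coeff z.1) := by
    intro z
    by_cases hz : z ∈ s
    · obtain ⟨t, ht⟩ := IsAlgClosed.exists_pow_nat_eq (MvPolynomial.coeff z.2 (q.coeff z.1))
        (n := e - z.1) (by have := Finset.mem_range.1 (Finset.mem_sigma.1 hz).1; omega)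
      exact ⟨t, fun _ => ht⟩
    · exact ⟨0, fun h => absurd h hz⟩
  choose t ht using ht
  obtain ⟨⟨i₀, u₀⟩, hz₀, hmax⟩ := Finset.exists_max_image s
    (fun z => ValuationRing.valuation V K (t z)) hs
  obtain ⟨hi₀, hu₀⟩ := Finset.mem_sigma.1 hz₀
  simp only [Finset.mem_range] at hi₀
  change i₀ < e at hi₀
  set γ := t ⟨i₀, u₀⟩ with hγ
  have hγ0 : γ ≠ 0 := by
    intro h0
    have h1 := ht _ hz₀
    rw [← hγ, h0, zero_pow (show e - i₀ ≠ 0 by omega)] at h1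
    exact MvPolynomial.mem_support_iff.1 hu₀ h1.symm
  have hcoef : ∀ i < e, ∀ u, γ⁻¹ ^ (e - i) * MvPolynomial.coeff u (q.coeff i) ∈
      (algebraMap V K).range := by
    intro i hi u
    by_cases hu : MvPolynomial.coeff u (q.coeff i) = 0
    · rw [hu, mul_zero]; exact zero_mem _
    · have hz : (⟨i, u⟩ : Σ _ : ℕ, σ →₀ ℕ) ∈ s :=
        Finset.mem_sigma.2 ⟨Finset.mem_range.2 hi, MvPolynomial.mem_support_iff.2 hu⟩
      rw [← ht _ hz, ← mul_pow]
      refine pow_mem ?_ _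
      refine (ValuationRing.mem_integer_iff V K _).1 ?_
      rw [Valuation.mem_integer_iff, map_mul, map_inv₀]
      have h1 := hmax _ hz
      rw [mul_comm, ← div_eq_mul_inv]
      exact div_le_one_of_le₀ h1 zero_le
  have hpoly : ∀ i, ∃ a : MvPolynomial σ V, i < e → MvPolynomial.map (algebraMap V K) a =
      γ⁻¹ ^ (e - i) • q.coeff i := by
    intro i
    by_cases hi : i < e
    · have : γ⁻¹ ^ (e - i) • q.coeff i ∈ (MvPolynomial.map (σ := σ) (algebraMap V K)).range := by
        refine MvPolynomial.mem_range_map_iff_coeffs_subset.2 fun z hz => ?_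
        obtain ⟨u, -, rfl⟩ := MvPolynomial.mem_coeffs_iff.1 hz
        rw [MvPolynomial.coeff_smul, smul_eq_mul]
        exact hcoef i hi u
      obtain ⟨a, ha⟩ := this
      exact ⟨a, fun _ => ha⟩
    · exact ⟨0, fun h => absurd h hi⟩
  choose c hc using hpoly
  have hc₀ : MvPolynomial.map (IsLocalRing.residue V) (c i₀) ≠ 0 := by
    intro h0
    have h1 := congrArg (MvPolynomial.coeff u₀) (hc i₀ hi₀)
    rw [MvPolynomial.coeff_map, MvPolynomial.coeff_smul, ← ht _ hz₀, ← hγ, smul_eq_mul,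
      ← mul_pow, inv_mul_cancel₀ hγ0, one_pow, ← map_one (algebraMap V K)] at h1
    have h2 := congrArg (MvPolynomial.coeff u₀) h0
    rw [MvPolynomial.coeff_map, IsFractionRing.injective V K h1, map_one,
      MvPolynomial.coeff_zero] at h2
    exact one_ne_zero h2
  let Q : (MvPolynomial σ V)[X] := X ^ e + ∑ i ∈ Finset.range e, C (c i) * X ^ i
  have hdeg : (∑ i ∈ Finset.range e, C (c i) * X ^ i : (MvPolynomial σ V)[X]).degree < e := by
    refine (degree_sum_le _ _).trans_lt ?_
    refine (Finset.sup_lt_iff (WithBot.bot_lt_coe e)).2 fun i hi => ?_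
    exact (degree_C_mul_X_pow_le _ _).trans_lt (WithBot.coe_lt_coe.2 (Finset.mem_range.1 hi))
  have hQm : Q.Monic := monic_X_pow_add hdeg
  have hQd : Q.natDegree = e := by
    refine natDegree_eq_of_degree_eq_some ?_
    rw [degree_add_eq_left_of_degree_lt (by rwa [degree_X_pow]), degree_X_pow]
  have hQc : Q.coeff i₀ = c i₀ := by
    simp [Q, coeff_X_pow, hi₀.ne, hi₀]
  have hgamma : γ • (γ⁻¹ • f) = f := by rw [smul_smul, mul_inv_cancel₀ hγ0, one_smul]
  refine ⟨γ, hγ0, γ⁻¹ • f, hgamma.symm, ⟨Q, hQm, ?_⟩, ?_⟩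
  · simp only [Q, eval₂_add, eval₂_X_pow, eval₂_finsetSum, eval₂_mul, eval₂_C, RingHom.comp_apply]
    have h1 := congrArg (fun z => γ⁻¹ ^ e • z) hqf
    simp only [smul_add, smul_zero, Finset.smul_sum] at h1
    rw [← h1, _root_.smul_pow]
    congr 1
    refine Finset.sum_congr rfl fun i hi => ?_
    rw [hc i (Finset.mem_range.1 hi), ← Algebra.smul_def, _root_.smul_pow, smul_assoc,
      smul_comm _ (γ⁻¹ ^ i),
      smul_smul, ← pow_add]
    rw [Nat.sub_add_cancel (Finset.mem_range.1 hi).le]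
  · intro a ha
    have := isAlgClosed_residueField (V := V) K
    obtain ⟨η', hη'⟩ : ∃ η' : σ → IsLocalRing.ResidueField V, MvPolynomial.eval η'
        (MvPolynomial.map (IsLocalRing.residue V) (a * c i₀)) ≠ 0 := by
      by_contra! hcon
      have : MvPolynomial.map (IsLocalRing.residue V) (a * c i₀) = 0 :=
        MvPolynomial.funext fun x => by rw [hcon x, map_zero]
      rw [map_mul] at this
      exact mul_ne_zero ha hc₀ this
    choose η hη using fun j => IsLocalRing.residue_surjective (η' j)
    have hres : ∀ p : MvPolynomial σ V, MvPolynomial.eval η'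
        (MvPolynomial.map (IsLocalRing.residue V) p) =
          IsLocalRing.residue V (MvPolynomial.eval η p) := by
      intro p
      rw [MvPolynomial.map_eval, show (IsLocalRing.residue V) ∘ η = η' from funext hη]
    rw [hres, map_mul, IsLocalRing.residue_ne_zero_iff_isUnit, IsUnit.mul_iff] at hη'
    have hK : ∀ p : MvPolynomial σ V, MvPolynomial.eval (fun j => algebraMap V K (η j))
        (MvPolynomial.map (algebraMap V K) p) = algebraMap V K (MvPolynomial.eval η p) := by
      intro p
      rw [MvPolynomial.map_eval]
      rfl
    obtain ⟨ρ, hρ, hρQ⟩ := exists_isUnit_root K (hQm.map (MvPolynomial.eval η)) (i := i₀)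
      (by rw [hQm.natDegree_map, hQd]; exact hi₀) (by rw [coeff_map, hQc]; exact hη'.2)
    obtain ⟨P, hP, hPf⟩ := exists_specialization_of_root (f := f)
      (fun j => algebraMap V K (η j)) (z := γ * algebraMap V K ρ) (by
        rw [← hq, hqm.as_sum]
        simp only [eval₂_add, eval₂_X_pow, eval₂_finsetSum, eval₂_mul, eval₂_C]
        have h1 := congrArg (fun z => γ ^ e * algebraMap V K z) hρQ
        simp only [Q, Polynomial.map_add, Polynomial.map_pow, map_X, Polynomial.map_sum,
          Polynomial.map_mul, map_C, eval_add, eval_pow, eval_X, eval_finsetSum, eval_mul, eval_C,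
          map_add, map_sum, map_mul, map_pow, map_zero, mul_zero, mul_add, Finset.mul_sum] at h1
        rw [← h1, mul_pow]
        congr 1
        refine Finset.sum_congr rfl fun i hi => ?_
        have hi' := Finset.mem_range.1 hi
        change _ = γ ^ e * (algebraMap V K (MvPolynomial.eval η (c i)) * _)
        rw [← hK, hc i hi', MvPolynomial.smul_eval, mul_pow]
        have h2 : γ ^ e * γ⁻¹ ^ (e - i) = γ ^ i := by
          rw [← Nat.sub_add_cancel hi'.le, pow_add, mul_right_comm, Nat.sub_add_cancel hi'.le,
            ← mul_pow, mul_inv_cancel₀ hγ0, one_pow, one_mul]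
        rw [← h2]
        ring)
    refine ⟨P, fun j => ?_, ⟨ρ, hρ, ?_⟩, ⟨_, hη'.1, ?_⟩⟩
    · rw [hP, MvPolynomial.eval_X]
      exact ⟨η j, rfl⟩
    · rw [map_smul, hPf, smul_eq_mul, inv_mul_cancel_left₀ hγ0]
    · rw [hP, hK]

end

section

variable {V K σ : Type*} [CommRing V] [Field K] [Algebra V K]
  {B : Type*} [CommRing B] [Algebra (MvPolynomial σ K) B]

variable (V K σ B) in
/-- The subring of elements integral over `V[X]` in an extension of `K[X]`. -/
def ballSubring : Subring B where
  carrier := {f | IsBallElem V K σ f}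
  mul_mem' := fun ha hb => RingHom.IsIntegralElem.mul _ ha hb
  one_mem' := RingHom.isIntegralElem_one _
  add_mem' := fun ha hb => RingHom.IsIntegralElem.add _ ha hb
  zero_mem' := RingHom.isIntegralElem_zero _
  neg_mem' := fun ha => RingHom.IsIntegralElem.neg _ ha

theorem mem_ballSubring {f : B} : f ∈ ballSubring V K σ B ↔ IsBallElem V K σ f := Iff.rfl

theorem algebraMap_map_mem_ballSubring (a : MvPolynomial σ V) :
    algebraMap (MvPolynomial σ K) B (MvPolynomial.map (algebraMap V K) a) ∈
      ballSubring V K σ B :=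
  RingHom.isIntegralElem_map ((algebraMap (MvPolynomial σ K) B).comp
    (MvPolynomial.map (algebraMap V K))) (x := a)

variable [Algebra K B] [IsScalarTower K (MvPolynomial σ K) B]

theorem algebraMap_mem_ballSubring (v : V) :
    algebraMap K B (algebraMap V K v) ∈ ballSubring V K σ B := by
  have := algebraMap_map_mem_ballSubring (K := K) (B := B) (MvPolynomial.C (σ := σ) v)
  rwa [MvPolynomial.map_C, ← MvPolynomial.algebraMap_eq,
    ← IsScalarTower.algebraMap_apply K (MvPolynomial σ K) B] at this

theorem smul_mem_ballSubring (v : V) {f : B} (hf : f ∈ ballSubring V K σ B) :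
    algebraMap V K v • f ∈ ballSubring V K σ B := by
  rw [Algebra.smul_def]
  exact mul_mem (algebraMap_mem_ballSubring v) hf

variable [IsDomain V] [ValuationRing V] [IsFractionRing V K]

theorem specialization_mem_range {f : B} (hf : f ∈ ballSubring V K σ B) (P : B →ₐ[K] K)
    (hP : ∀ j, P (algebraMap (MvPolynomial σ K) B (MvPolynomial.X j)) ∈ (algebraMap V K).range) :
    P f ∈ (algebraMap V K).range := by
  choose η hη using hP
  have h1 := RingHom.IsIntegralElem.map hf (P : B →+* K)
  have h2 : (P : B →+* K).comp ((algebraMap (MvPolynomial σ K) B).comp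
      (MvPolynomial.map (algebraMap V K))) =
      (algebraMap V K).comp (MvPolynomial.eval η) := by
    refine MvPolynomial.ringHom_ext (fun r => ?_) fun r => ?_
    · simp only [RingHom.comp_apply, MvPolynomial.map_C, MvPolynomial.eval_C]
      rw [← MvPolynomial.algebraMap_eq, ← IsScalarTower.algebraMap_apply K (MvPolynomial σ K) B]
      exact P.commutes _
    · simp only [RingHom.comp_apply, MvPolynomial.map_X, MvPolynomial.eval_X]
      exact (hη r).symm
  rw [h2] at h1
  exact IsIntegrallyClosed.isIntegral_iff.1 (h1.of_comp_left : IsIntegral V (P f))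

variable (V K σ B) in
/-- The extension of the maximal ideal of `V` to the ring of elements integral over `V[X]`. -/
def ballIdeal : Ideal (ballSubring V K σ B) where
  carrier := {f | ∃ μ ∈ IsLocalRing.maximalIdeal V, ∃ g ∈ ballSubring V K σ B,
    (f : B) = algebraMap V K μ • g}
  zero_mem' := ⟨0, zero_mem _, 0, zero_mem _, by simp⟩
  add_mem' := by
    rintro a b ⟨μ, hμ, g, hg, ha⟩ ⟨ν, hν, g', hg', hb⟩
    rcases ValuationRing.dvd_total μ ν with ⟨c, rfl⟩ | ⟨c, rfl⟩
    · refine ⟨μ, hμ, g + algebraMap V K c • g', add_mem hg (smul_mem_ballSubring c hg'), ?_⟩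
      rw [Subring.coe_add, ha, hb, smul_add, smul_smul, map_mul]
    · refine ⟨ν, hν, algebraMap V K c • g + g', add_mem (smul_mem_ballSubring c hg) hg', ?_⟩
      rw [Subring.coe_add, ha, hb, smul_add, smul_smul, map_mul]
  smul_mem' := by
    rintro c a ⟨μ, hμ, g, hg, ha⟩
    refine ⟨μ, hμ, c * g, mul_mem c.2 hg, ?_⟩
    rw [smul_eq_mul, Subring.coe_mul, ha, mul_smul_comm]

theorem specialization_mem_of_mem_ballIdeal {f : ballSubring V K σ B}
    (hf : f ∈ ballIdeal V K σ B) (P : B →ₐ[K] K)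
    (hP : ∀ j, P (algebraMap (MvPolynomial σ K) B (MvPolynomial.X j)) ∈ (algebraMap V K).range) :
    ∃ μ ∈ IsLocalRing.maximalIdeal V, P f = algebraMap V K μ := by
  obtain ⟨μ, hμ, g, hg, h⟩ := hf
  obtain ⟨v, hv⟩ := specialization_mem_range hg P hP
  exact ⟨μ * v, Ideal.mul_mem_right _ _ hμ, by rw [h, map_smul, ← hv, map_mul, smul_eq_mul]⟩

variable [IsAlgClosed K] [IsDomain B] [FaithfulSMul (MvPolynomial σ K) B]
  [Algebra.IsIntegral (MvPolynomial σ K) B] [Finite σ]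

theorem mem_ballIdeal_of_specialization {f : ballSubring V K σ B} {a : MvPolynomial σ V}
    (ha : MvPolynomial.map (IsLocalRing.residue V) a ≠ 0)
    (h : ∀ P : B →ₐ[K] K,
      (∀ j, P (algebraMap (MvPolynomial σ K) B (MvPolynomial.X j)) ∈ (algebraMap V K).range) →
      (∃ u : V, IsUnit u ∧ P (algebraMap (MvPolynomial σ K) B
            (MvPolynomial.map (algebraMap V K) a)) = algebraMap V K u) →
      ∃ μ ∈ IsLocalRing.maximalIdeal V, P f = algebraMap V K μ) :
    f ∈ ballIdeal V K σ B := by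
  by_cases hf : (f : B) = 0
  · exact ⟨0, zero_mem _, 0, zero_mem _, by simp [hf]⟩
  · obtain ⟨γ, -, f', hff, hf', hP⟩ := exists_smul_specialization (V := V) (K := K) (σ := σ) hf
    obtain ⟨P, hPy, ⟨u, hu, hPf⟩, hPa⟩ := hP a ha
    obtain ⟨μ, hμ, hPμ⟩ := h P hPy hPa
    obtain ⟨w, hw⟩ := hu.exists_right_inv
    refine ⟨μ * w, Ideal.mul_mem_right _ _ hμ, f', hf', ?_⟩
    rw [hff, map_smul, hPf, smul_eq_mul] at hPμ
    rw [map_mul, ← hPμ, mul_assoc, ← map_mul, hw, map_one, mul_one]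
    exact hff

theorem mem_ballIdeal_of_mul_mem {f : ballSubring V K σ B} {a : MvPolynomial σ V}
    (ha : MvPolynomial.map (IsLocalRing.residue V) a ≠ 0)
    (h : ⟨_, algebraMap_map_mem_ballSubring a⟩ * f ∈ ballIdeal V K σ B) :
    f ∈ ballIdeal V K σ B := by
  refine mem_ballIdeal_of_specialization ha fun P hP ⟨u, hu, hPu⟩ => ?_
  obtain ⟨μ, hμ, h1⟩ := specialization_mem_of_mem_ballIdeal h P hP
  obtain ⟨w, hw⟩ := hu.exists_left_inv
  refine ⟨w * μ, Ideal.mul_mem_left _ _ hμ, ?_⟩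
  rw [map_mul, ← h1, Subring.coe_mul, map_mul, hPu, ← mul_assoc, ← map_mul, hw, map_one, one_mul]

theorem mem_ballIdeal_of_pow_mem {f : ballSubring V K σ B} {n : ℕ}
    (h : f ^ n ∈ ballIdeal V K σ B) : f ∈ ballIdeal V K σ B := by
  refine mem_ballIdeal_of_specialization (a := 1) (by simp) fun P hP _ => ?_
  obtain ⟨μ, hμ, h1⟩ := specialization_mem_of_mem_ballIdeal h P hP
  obtain ⟨v, hv⟩ := specialization_mem_range f.2 P hP
  refine ⟨v, ?_, hv.symm⟩
  rw [Subring.coe_pow, map_pow, ← hv, ← map_pow] at h1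
  rw [← IsFractionRing.injective V K h1] at hμ
  exact (Ideal.IsMaximal.isPrime' _).mem_of_pow_mem _ hμ

theorem one_notMem_ballIdeal : (1 : ballSubring V K σ B) ∉ ballIdeal V K σ B := by
  intro h
  obtain ⟨_, _, _, _, _, hP⟩ := exists_smul_specialization (V := V) (K := K) (σ := σ)
    (one_ne_zero (α := B))
  obtain ⟨P, hPy, -, -⟩ := hP 1 (by simp)
  obtain ⟨μ, hμ, h1⟩ := specialization_mem_of_mem_ballIdeal h P hPy
  rw [Subring.coe_one, map_one, ← map_one (algebraMap V K)] at h1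
  rw [← IsFractionRing.injective V K h1] at hμ
  exact (Ideal.ne_top_iff_one _).1 (Ideal.IsMaximal.ne_top inferInstance) hμ

end

section

variable (V K : Type u) (σ : Type*) [CommRing V] [Field K] [Algebra V K]
  (B : Type u) [CommRing B] [Algebra (MvPolynomial σ K) B]
  [Algebra K B] [IsScalarTower K (MvPolynomial σ K) B]
  [IsDomain V] [ValuationRing V] [IsFractionRing V K]
  [IsAlgClosed K] [IsDomain B] [FaithfulSMul (MvPolynomial σ K) B]
  [Algebra.IsIntegral (MvPolynomial σ K) B] [Finite σ]

/-- The special fibre of the ring of elements integral over `V[X]`. -/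
theorem exists_special_fibre : ∃ (G : Type u) (_ : CommRing G)
    (_ : Algebra (MvPolynomial σ (IsLocalRing.ResidueField V)) G)
    (_ : Algebra (IsLocalRing.ResidueField V) G)
    (_ : IsScalarTower (IsLocalRing.ResidueField V)
      (MvPolynomial σ (IsLocalRing.ResidueField V)) G)
    (π : ballSubring V K σ B →+* G), IsReduced G ∧ Nontrivial G ∧
      Module.IsTorsionFree (MvPolynomial σ (IsLocalRing.ResidueField V)) G ∧
      Algebra.IsIntegral (MvPolynomial σ (IsLocalRing.ResidueField V)) G ∧
      Function.Surjective π ∧ (∀ f, π f = 0 ↔ f ∈ ballIdeal V K σ B) ∧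
      (∀ a, algebraMap (MvPolynomial σ (IsLocalRing.ResidueField V)) G
        (MvPolynomial.map (IsLocalRing.residue V) a) =
          π ⟨_, algebraMap_map_mem_ballSubring a⟩) ∧
      ∀ v : V, algebraMap (IsLocalRing.ResidueField V) G (IsLocalRing.residue V v) =
        π ⟨_, algebraMap_mem_ballSubring v⟩ := by
  let G := ballSubring V K σ B ⧸ ballIdeal V K σ B
  let π : ballSubring V K σ B →+* G := Ideal.Quotient.mk _
  let α : MvPolynomial σ V →+* ballSubring V K σ B :=
    ((algebraMap (MvPolynomial σ K) B).comp (MvPolynomial.map (algebraMap V K))).codRestrict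
      (ballSubring V K σ B) algebraMap_map_mem_ballSubring
  have hπ : ∀ f, π f = 0 ↔ f ∈ ballIdeal V K σ B := fun f => Ideal.Quotient.eq_zero_iff_mem
  have hC : ∀ v : V, α (MvPolynomial.C v) = ⟨_, algebraMap_mem_ballSubring v⟩ := fun v => by
    refine Subtype.ext ?_
    change algebraMap (MvPolynomial σ K) B (MvPolynomial.map (algebraMap V K) _) = _
    rw [MvPolynomial.map_C, ← MvPolynomial.algebraMap_eq,
      ← IsScalarTower.algebraMap_apply K (MvPolynomial σ K) B]
  let ε₀ : IsLocalRing.ResidueField V →+* G :=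
    Ideal.Quotient.lift (IsLocalRing.maximalIdeal V) ((π.comp α).comp MvPolynomial.C) (by
      intro a ha
      change π (α (MvPolynomial.C a)) = 0
      rw [hC, hπ]
      exact ⟨a, ha, 1, one_mem _, by rw [Algebra.smul_def, mul_one]⟩)
  have hε₀ : ∀ v, ε₀ (IsLocalRing.residue V v) = π (α (MvPolynomial.C v)) := fun v => rfl
  let ε : MvPolynomial σ (IsLocalRing.ResidueField V) →+* G :=
    MvPolynomial.eval₂Hom ε₀ fun j => π (α (MvPolynomial.X j))
  have hε : ε.comp (MvPolynomial.map (IsLocalRing.residue V)) = π.comp α := by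
    refine MvPolynomial.ringHom_ext (fun r => ?_) fun r => ?_
    · simp only [RingHom.comp_apply, MvPolynomial.map_C, ε, MvPolynomial.coe_eval₂Hom,
        MvPolynomial.eval₂_C, hε₀]
    · simp only [RingHom.comp_apply, MvPolynomial.map_X, ε, MvPolynomial.coe_eval₂Hom,
        MvPolynomial.eval₂_X]
  let i1 : Algebra (MvPolynomial σ (IsLocalRing.ResidueField V)) G := ε.toAlgebra
  let i2 : Algebra (IsLocalRing.ResidueField V) G := ε₀.toAlgebra
  have i3 : IsScalarTower (IsLocalRing.ResidueField V)
      (MvPolynomial σ (IsLocalRing.ResidueField V)) G :=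
    IsScalarTower.of_algebraMap_eq fun r => by
      change ε₀ r = ε (MvPolynomial.C r)
      simp [ε]
  refine ⟨G, inferInstance, i1, i2, i3, π, ⟨?_⟩, ?_, ?_, ⟨?_⟩, Ideal.Quotient.mk_surjective, hπ,
    fun a => DFunLike.congr_fun hε a, fun v => by rw [← hC]; exact hε₀ v⟩
  · rintro x ⟨n, hn⟩
    obtain ⟨f, rfl⟩ := Ideal.Quotient.mk_surjective x
    change (π f) ^ n = 0 at hn
    rw [← map_pow, hπ] at hn
    exact (hπ f).2 (mem_ballIdeal_of_pow_mem hn)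
  · exact Ideal.Quotient.nontrivial_iff.2 ((Ideal.ne_top_iff_one _).2 one_notMem_ballIdeal)
  · refine Module.IsTorsionFree.mk fun r hr => ?_
    intro x y hxy
    obtain ⟨a, rfl⟩ := MvPolynomial.map_surjective _ IsLocalRing.residue_surjective r
    obtain ⟨f, rfl⟩ := Ideal.Quotient.mk_surjective x
    obtain ⟨g, rfl⟩ := Ideal.Quotient.mk_surjective y
    simp only [Algebra.smul_def] at hxy
    rw [← sub_eq_zero, ← mul_sub] at hxy
    rw [← sub_eq_zero]
    change ε (MvPolynomial.map _ a) * (π f - π g) = 0 at hxy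
    change π f - π g = 0
    rw [← map_sub] at hxy ⊢
    rw [show ε (MvPolynomial.map _ a) = π (α a) from DFunLike.congr_fun hε a, ← map_mul, hπ] at hxy
    rw [hπ]
    exact mem_ballIdeal_of_mul_mem hr.ne_zero hxy
  · intro x
    obtain ⟨f, rfl⟩ := Ideal.Quotient.mk_surjective x
    have h1 : α.IsIntegralElem f :=
      RingHom.IsIntegralElem.of_comp_injective (g := (ballSubring V K σ B).subtype)
        Subtype.val_injective f.2
    have h2 := h1.map π
    rw [← hε] at h2
    exact h2.of_comp_left

end

section

variable {V K σ : Type*} [CommRing V] [Field K] [Algebra V K]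
  {B : Type*} [CommRing B] [Algebra (MvPolynomial σ K) B]
  [Algebra K B]

variable (V K σ B) in
/-- The `V`-span of the specializations with values of the coordinates in `V`. -/
def specializationSpan : Submodule V (B →ₗ[K] K) :=
  Submodule.span V {l | ∃ P : B →ₐ[K] K,
    (∀ j, P (algebraMap (MvPolynomial σ K) B (MvPolynomial.X j)) ∈ (algebraMap V K).range) ∧
      l = P.toLinearMap}

variable [IsScalarTower K (MvPolynomial σ K) B]
  [IsDomain V] [ValuationRing V] [IsFractionRing V K]

theorem apply_mem_range_of_mem_specializationSpan {f : B} (hf : f ∈ ballSubring V K σ B)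
    {l : B →ₗ[K] K} (hl : l ∈ specializationSpan V K σ B) : l f ∈ (algebraMap V K).range := by
  induction hl using Submodule.span_induction with
  | mem l hl =>
    obtain ⟨P, hP, rfl⟩ := hl
    exact specialization_mem_range hf P hP
  | zero => exact zero_mem _
  | add l l' _ _ h h' => exact add_mem h h'
  | smul v l _ h =>
    rw [LinearMap.smul_apply, Algebra.smul_def]
    exact mul_mem ⟨v, rfl⟩ h

theorem apply_mem_maximalIdeal_of_mem_specializationSpan {f : ballSubring V K σ B}
    (hf : f ∈ ballIdeal V K σ B) {l : B →ₗ[K] K} (hl : l ∈ specializationSpan V K σ B) :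
    ∃ μ ∈ IsLocalRing.maximalIdeal V, l f = algebraMap V K μ := by
  obtain ⟨μ, hμ, g, hg, h⟩ := hf
  obtain ⟨v, hv⟩ := apply_mem_range_of_mem_specializationSpan hg hl
  exact ⟨μ * v, Ideal.mul_mem_right _ _ hμ, by rw [h, map_smul, ← hv, map_mul, smul_eq_mul]⟩

variable [IsAlgClosed K] [IsDomain B] [FaithfulSMul (MvPolynomial σ K) B]
  [Algebra.IsIntegral (MvPolynomial σ K) B] [Finite σ]

variable (V σ) in
/-- A finite-dimensional space has a basis of elements integral over `V[X]` whose dual basis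
consists of `V`-combinations of specializations. -/
theorem exists_dual_specializations (E : Submodule K B) [FiniteDimensional K E] :
    ∃ (m : ℕ) (f : Fin m → B) (l : Fin m → B →ₗ[K] K), (∀ i, f i ∈ E) ∧
      (∀ i, f i ∈ ballSubring V K σ B) ∧ (∀ i, l i ∈ specializationSpan V K σ B) ∧
      (∀ i j, l i (f j) = if i = j then 1 else 0) ∧ ∀ g ∈ E, g = ∑ i, l i g • f i := by
  obtain ⟨n, hn⟩ : ∃ n, Module.finrank K E ≤ n := ⟨_, le_rfl⟩
  induction n generalizing E with
  | zero =>
    have hE : E = ⊥ := Submodule.finrank_eq_zero.1 (Nat.le_zero.1 hn)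
    subst hE
    exact ⟨0, Fin.elim0, Fin.elim0, fun i => i.elim0, fun i => i.elim0, fun i => i.elim0,
      fun i => i.elim0, fun g hg => by simpa using hg⟩
  | succ n ih =>
    by_cases hE : E = ⊥
    · exact ih E (by rw [hE]; simp)
    obtain ⟨g, hgE, hg⟩ := Submodule.exists_mem_ne_zero_of_ne_bot hE
    obtain ⟨γ, hγ, f', hgf, hf', hP⟩ := exists_smul_specialization (V := V) (K := K) (σ := σ) hg
    obtain ⟨P, hPy, ⟨u, hu, hPu⟩, -⟩ := hP 1 (by simp)
    have hfE : f' ∈ E := by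
      rw [show f' = γ⁻¹ • g by rw [hgf, smul_smul, inv_mul_cancel₀ hγ, one_smul]]
      exact E.smul_mem _ hgE
    obtain ⟨w, hw⟩ := hu.exists_left_inv
    let l₀ : B →ₗ[K] K := w • P.toLinearMap
    have hl₀ : l₀ ∈ specializationSpan V K σ B :=
      Submodule.smul_mem _ _ (Submodule.subset_span ⟨P, hPy, rfl⟩)
    have hl₀f : l₀ f' = 1 := by
      change w • P f' = 1
      rw [hPu, Algebra.smul_def, ← map_mul, hw, map_one]
    have hlt : E ⊓ LinearMap.ker l₀ < E := by
      refine lt_of_le_of_ne inf_le_left fun h => ?_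
      have h1 := h.ge hfE
      rw [Submodule.mem_inf, LinearMap.mem_ker, hl₀f] at h1
      exact one_ne_zero h1.2
    have : FiniteDimensional K ↥(E ⊓ LinearMap.ker l₀) :=
      Submodule.finiteDimensional_of_le inf_le_left
    obtain ⟨m, f, l, hfE', hfb, hl, hlf, hgen⟩ := ih (E ⊓ LinearMap.ker l₀) (by
      have := Submodule.finrank_lt_finrank_of_lt hlt
      omega)
    choose c hc using fun i => apply_mem_range_of_mem_specializationSpan hf' (hl i)
    have hlf0 : ∀ j, l₀ (f j) = 0 := fun j => (Submodule.mem_inf.1 (hfE' j)).2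
    refine ⟨m + 1, Fin.cons f' f, Fin.cons l₀ fun i => l i - c i • l₀, ?_, ?_, ?_, ?_, ?_⟩
    · exact Fin.cases hfE fun i => (Submodule.mem_inf.1 (hfE' i)).1
    · exact Fin.cases hf' hfb
    · exact Fin.cases hl₀ fun i => sub_mem (hl i) (Submodule.smul_mem _ _ hl₀)
    · refine Fin.cases (Fin.cases ?_ fun j => ?_) fun i => Fin.cases ?_ fun j => ?_
      · simpa using hl₀f
      · simpa [(Fin.succ_ne_zero j).symm] using hlf0 j
      · simp [hl₀f, ← hc, Algebra.smul_def]
      · simp [hlf0, hlf]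
    · intro g hg
      have h1 := hgen (g - l₀ g • f') (Submodule.mem_inf.2
        ⟨sub_mem hg (E.smul_mem _ hfE), by simp [hl₀f]⟩)
      rw [sub_eq_iff_eq_add] at h1
      rw [Fin.sum_univ_succ, add_comm]
      simp only [Fin.cons_zero, Fin.cons_succ]
      conv_lhs => rw [h1]
      congr 1
      refine Finset.sum_congr rfl fun i _ => ?_
      congr 1
      rw [map_sub, map_smul, LinearMap.sub_apply, LinearMap.smul_apply (c i),
        Algebra.smul_def (c i),
        hc, smul_eq_mul, mul_comm]

end

section

variable {V K σ : Type*} [CommRing V] [Field K] [Algebra V K]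
  {B : Type*} [CommRing B] [Algebra (MvPolynomial σ K) B]
  [Algebra K B] [IsScalarTower K (MvPolynomial σ K) B]
  [IsDomain V] [ValuationRing V]
  {G : Type*} [CommRing G] [Algebra (IsLocalRing.ResidueField V) G]
  (π : ballSubring V K σ B →+* G)
  (hπ : ∀ v : V, algebraMap (IsLocalRing.ResidueField V) G (IsLocalRing.residue V v) =
        π ⟨_, algebraMap_mem_ballSubring v⟩)

/-- The reduction of the elements of a `K`-subspace integral over `V[X]`. -/
def reductionSubmodule (E : Submodule K B) : Submodule (IsLocalRing.ResidueField V) G where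
  carrier := {x | ∃ f : ballSubring V K σ B, (f : B) ∈ E ∧ π f = x}
  zero_mem' := ⟨0, zero_mem _, map_zero _⟩
  add_mem' := by
    rintro _ _ ⟨f, hf, rfl⟩ ⟨g, hg, rfl⟩
    exact ⟨f + g, add_mem hf hg, map_add _ _ _⟩
  smul_mem' := by
    rintro r _ ⟨f, hf, rfl⟩
    obtain ⟨v, rfl⟩ := IsLocalRing.residue_surjective r
    refine ⟨⟨_, smul_mem_ballSubring v f.2⟩, E.smul_mem _ hf, ?_⟩
    refine Eq.trans ?_ (Algebra.smul_def _ _).symm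
    rw [hπ, ← map_mul]
    exact congrArg π (Subtype.ext (Algebra.smul_def _ _))

variable [IsFractionRing V K]
  [IsAlgClosed K] [IsDomain B] [FaithfulSMul (MvPolynomial σ K) B]
  [Algebra.IsIntegral (MvPolynomial σ K) B] [Finite σ]

theorem finrank_reductionSubmodule (hker : ∀ f, π f = 0 ↔ f ∈ ballIdeal V K σ B)
    (E : Submodule K B) [FiniteDimensional K E] :
    FiniteDimensional (IsLocalRing.ResidueField V) (reductionSubmodule π hπ E) ∧
    Module.finrank (IsLocalRing.ResidueField V) (reductionSubmodule π hπ E) =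
      Module.finrank K E := by
  obtain ⟨m, f, l, hfE, hfb, hl, hlf, hgen⟩ := exists_dual_specializations V σ E
  have hliK : LinearIndependent K f := by
    rw [Fintype.linearIndependent_iff]
    intro c hc i
    have h1 := congrArg (l i) hc
    simpa [hlf] using h1
  have hE : E = Submodule.span K (Set.range f) := by
    refine le_antisymm (fun g hg => ?_) (Submodule.span_le.2 (Set.range_subset_iff.2 hfE))
    rw [hgen g hg]
    exact sum_mem fun i _ => Submodule.smul_mem _ _ (Submodule.subset_span ⟨i, rfl⟩)
  have hsmul : ∀ (v : V) (g : ballSubring V K σ B), IsLocalRing.residue V v • π g =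
      π ⟨_, smul_mem_ballSubring v g.2⟩ := by
    intro v g
    rw [Algebra.smul_def, hπ, ← map_mul]
    congr 1
    exact Subtype.ext (Algebra.smul_def _ _).symm
  have hlik : LinearIndependent (IsLocalRing.ResidueField V) fun i => π ⟨f i, hfb i⟩ := by
    rw [Fintype.linearIndependent_iff]
    intro c hc i
    choose c' hc' using fun i => IsLocalRing.residue_surjective (c i)
    simp only [← hc', hsmul] at hc
    rw [← map_sum, hker] at hc
    obtain ⟨μ, hμ, h1⟩ := apply_mem_maximalIdeal_of_mem_specializationSpan hc (hl i)
    rw [AddSubmonoidClass.coe_finsetSum, map_sum] at h1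
    simp only [map_smul, hlf] at h1
    simp only [smul_eq_mul, mul_ite, mul_one, mul_zero, Finset.sum_ite_eq, Finset.mem_univ,
      if_true] at h1
    rw [← hc', IsFractionRing.injective V K h1]
    exact (IsLocalRing.residue_eq_zero_iff μ).2 hμ
  have hspan : reductionSubmodule π hπ E =
      Submodule.span _ (Set.range fun i => π ⟨f i, hfb i⟩) := by
    refine le_antisymm ?_ (Submodule.span_le.2 (Set.range_subset_iff.2 fun i => ⟨_, hfE i, rfl⟩))
    rintro _ ⟨g, hg, rfl⟩
    choose v hv using fun i => apply_mem_range_of_mem_specializationSpan g.2 (hl i)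
    have h1 : g = ∑ i, (⟨_, smul_mem_ballSubring (v i) (hfb i)⟩ : ballSubring V K σ B) := by
      refine Subtype.ext ?_
      rw [AddSubmonoidClass.coe_finsetSum]
      simp only [hv]
      exact hgen _ hg
    rw [h1, map_sum]
    refine sum_mem fun i _ => ?_
    rw [← hsmul (v i) ⟨f i, hfb i⟩]
    exact Submodule.smul_mem _ _ (Submodule.subset_span ⟨i, rfl⟩)
  constructor
  · rw [hspan]
    exact FiniteDimensional.span_of_finite _ (Set.finite_range _)
  · conv_lhs => rw [hspan]
    conv_rhs => rw [hE]
    rw [finrank_span_eq_card hliK, finrank_span_eq_card hlik]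

end

section

open Polynomial

theorem coeff_gradedEval {R S σ : Type*} [CommRing R] [CommRing S] [Algebra R S] (y : σ → S)
    (p : MvPolynomial σ R) (n : ℕ) :
    (gradedEval R y p).coeff n =
      MvPolynomial.aeval y (MvPolynomial.homogeneousComponent n p) := by
  classical
  induction p using MvPolynomial.induction_on' with
  | add p q hp hq => rw [map_add, coeff_add, hp, hq, map_add, map_add]
  | monomial v a =>
    have : gradedEval R y (MvPolynomial.monomial v a) =
        monomial v.degree (MvPolynomial.aeval y (MvPolynomial.monomial v a)) := by
      rw [gradedEval, MvPolynomial.aeval_monomial, MvPolynomial.aeval_monomial,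
        ← C_mul_X_pow_eq_monomial, map_mul, Finsupp.prod, Finsupp.prod, map_prod]
      simp only [← C_mul_X_eq_monomial, mul_pow, Finset.prod_mul_distrib,
        Finset.prod_pow_eq_pow_sum, map_pow]
      rw [Finsupp.degree_apply, mul_assoc]
      rfl
    have hm := MvPolynomial.isHomogeneous_monomial (d := v) a rfl
    rw [this, coeff_monomial, MvPolynomial.homogeneousComponent_of_mem hm]
    simp only [eq_comm (a := n)]
    split_ifs <;> simp

/-- A homogeneous polynomial evaluated at linear polynomials. -/
theorem natDegree_aeval_le_and_coeff {R Z σ : Type*} [CommRing R] [CommRing Z] [Algebra R Z]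
    {θ : σ → Z[X]} (hθ : ∀ j, (θ j).natDegree ≤ 1) {c : σ → R}
    (hc : ∀ j, (θ j).coeff 1 = algebraMap R Z (c j)) {p : MvPolynomial σ R} {n : ℕ}
    (hp : p.IsHomogeneous n) : (MvPolynomial.aeval θ p).natDegree ≤ n ∧
      (MvPolynomial.aeval θ p).coeff n = algebraMap R Z (MvPolynomial.eval c p) := by
  classical
  have key : ∀ u : σ →₀ ℕ, (u.prod fun j e => θ j ^ e).natDegree ≤ u.degree ∧
      (u.prod fun j e => θ j ^ e).coeff u.degree =
        algebraMap R Z (u.prod fun j e => c j ^ e) := by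
    intro u
    induction u using Finsupp.induction_linear with
    | zero => simp
    | add u v hu hv =>
      rw [Finsupp.prod_add_index' (by simp) (by simp [pow_add]),
        Finsupp.prod_add_index' (by simp) (by simp [pow_add]), map_add]
      exact ⟨natDegree_mul_le_of_le hu.1 hv.1,
        by rw [coeff_mul_add_eq_of_natDegree_le hu.1 hv.1, hu.2, hv.2, map_mul]⟩
    | single j e =>
      rw [Finsupp.prod_single_index (by simp), Finsupp.prod_single_index (by simp),
        Finsupp.degree_single]
      have h1 := natDegree_pow_le_of_le e (hθ j)
      have h2 := coeff_pow_of_natDegree_le (m := e) (hθ j)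
      rw [mul_one] at h1 h2
      exact ⟨h1, by rw [h2, hc, map_pow]⟩
  have hw : ∀ u ∈ p.support, u.degree = n := fun u hu => by
    rw [← hp (MvPolynomial.mem_support_iff.1 hu)]
    exact DFunLike.congr_fun (Finsupp.degree_eq_weight_one (R := ℕ) (σ := σ)) u
  have hsum : MvPolynomial.aeval θ p = ∑ u ∈ p.support,
      p.coeff u • u.prod fun j e => θ j ^ e := by
    conv_lhs => rw [p.as_sum]
    rw [map_sum]
    refine Finset.sum_congr rfl fun u _ => ?_
    rw [MvPolynomial.aeval_monomial, Algebra.smul_def]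
  rw [hsum]
  constructor
  · refine natDegree_sum_le_of_forall_le _ _ fun u hu => (natDegree_smul_le _ _).trans ?_
    rw [← hw u hu]
    exact (key u).1
  · rw [finsetSum_coeff, MvPolynomial.eval_eq, map_sum]
    refine Finset.sum_congr rfl fun u hu => ?_
    rw [coeff_smul, ← hw u hu, (key u).2, Algebra.smul_def, map_mul]
    rfl

end

section

open Polynomial

variable {V K L : Type*} [CommRing V] [IsDomain V] [ValuationRing V]
  [Field K] [Algebra V K] [IsFractionRing V K] [Field L] [Algebra V L] [Algebra K L]
  [IsScalarTower V K L]

/-- A nonzero polynomial over the fraction field of a valuation ring is proportional to a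
primitive one. -/
theorem exists_smul_eq_map_residue_ne_zero {σ : Type*} {p : MvPolynomial σ K}
    (hp : p ≠ 0) : ∃ γ : K, γ ≠ 0 ∧ ∃ q : MvPolynomial σ V,
      γ • p = MvPolynomial.map (algebraMap V K) q ∧
      MvPolynomial.map (IsLocalRing.residue V) q ≠ 0 := by
  obtain ⟨u, hu, hmax⟩ := Finset.exists_max_image p.support
    (fun z => ValuationRing.valuation V K (p.coeff z)) (by
      rwa [Finset.nonempty_iff_ne_empty, Ne, MvPolynomial.support_eq_empty])
  have hu0 := MvPolynomial.mem_support_iff.1 hu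
  have : (p.coeff u)⁻¹ • p ∈ (MvPolynomial.map (σ := σ) (algebraMap V K)).range := by
    refine MvPolynomial.mem_range_map_iff_coeffs_subset.2 fun z hz => ?_
    obtain ⟨w, hw, rfl⟩ := MvPolynomial.mem_coeffs_iff.1 hz
    rw [MvPolynomial.coeff_smul, smul_eq_mul]
    have hw' : w ∈ p.support := by
      rw [MvPolynomial.mem_support_iff, MvPolynomial.coeff_smul] at hw
      exact MvPolynomial.mem_support_iff.2 (right_ne_zero_of_mul hw)
    refine (ValuationRing.mem_integer_iff V K _).1 ?_
    rw [Valuation.mem_integer_iff, map_mul, map_inv₀, mul_comm, ← div_eq_mul_inv]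
    exact div_le_one_of_le₀ (hmax _ hw') zero_le
  obtain ⟨q, hq⟩ := this
  refine ⟨_, inv_ne_zero hu0, q, hq.symm, fun h0 => ?_⟩
  have h1 := congrArg (MvPolynomial.coeff u) hq
  change MvPolynomial.coeff u (MvPolynomial.map (algebraMap V K) q) = _ at h1
  rw [MvPolynomial.coeff_map, MvPolynomial.coeff_smul, smul_eq_mul, inv_mul_cancel₀ hu0,
    ← map_one (algebraMap V K)] at h1
  have h2 := congrArg (MvPolynomial.coeff u) h0
  rw [MvPolynomial.coeff_map, IsFractionRing.injective V K h1, map_one,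
    MvPolynomial.coeff_zero] at h2
  exact one_ne_zero h2

theorem exists_homIntegral_of_not_injective [Infinite (IsLocalRing.ResidueField V)] {m : ℕ}
    {y : Fin m → L} (hy : ¬ Function.Injective (gradedEval K y)) :
    ∃ m', m = m' + 1 ∧ ∃ y' : Fin m' → L,
      (∀ i, y' i ∈ Submodule.span V (Set.range y)) ∧ ∀ j, IsHomIntegral V y' 1 (y j) := by
  rw [injective_iff_map_eq_zero] at hy
  push Not at hy
  obtain ⟨p, hp0, hp⟩ := hy
  obtain ⟨n, hn⟩ : ∃ n, MvPolynomial.homogeneousComponent n p ≠ 0 := by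
    by_contra! hcon
    apply hp
    rw [← MvPolynomial.sum_homogeneousComponent p]
    exact Finset.sum_eq_zero fun i _ => hcon i
  obtain ⟨γ, hγ, q, hq, hq0⟩ := exists_smul_eq_map_residue_ne_zero (V := V) hn
  have hqh : q.IsHomogeneous n := by
    have h1 : (MvPolynomial.map (algebraMap V K) q).IsHomogeneous n := by
      rw [← hq]
      exact (MvPolynomial.homogeneousSubmodule _ K n).smul_mem _
        (MvPolynomial.homogeneousComponent_isHomogeneous n p)
    exact MvPolynomial.IsHomogeneous.of_map (IsFractionRing.injective V K) h1
  have hqy : MvPolynomial.aeval y q = 0 := by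
    have h1 := coeff_gradedEval y p n
    rw [hp0, coeff_zero] at h1
    have h2 := congrArg (MvPolynomial.aeval y) hq
    rw [map_smul, ← h1, smul_zero, MvPolynomial.aeval_map_algebraMap] at h2
    exact h2.symm
  obtain ⟨c',
      hc'⟩ : ∃ c', MvPolynomial.eval c' (MvPolynomial.map (IsLocalRing.residue V) q) ≠ 0 := by
    by_contra! hcon
    exact hq0 (MvPolynomial.funext fun x => by rw [hcon x, map_zero])
  have hqh' : (MvPolynomial.map (IsLocalRing.residue V) q).IsHomogeneous n := hqh.map _
  obtain ⟨l, hl⟩ : ∃ l, c' l ≠ 0 := by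
    by_contra! hcon
    have hc0 : c' = 0 := funext hcon
    rw [hc0, MvPolynomial.eval_zero, MvPolynomial.constantCoeff_eq] at hc'
    have hn0 : n = 0 := by
      by_contra hne
      exact hc' (hqh'.coeff_eq_zero (by simpa using Ne.symm hne))
    subst hn0
    have h1 := MvPolynomial.totalDegree_eq_zero_iff_eq_C.1
      (Nat.le_zero.1 hqh.totalDegree_le)
    rw [h1, MvPolynomial.aeval_C, IsScalarTower.algebraMap_apply V K L, map_eq_zero] at hqy
    rw [MvPolynomial.coeff_map, IsFractionRing.injective V K (hqy.trans (map_zero _).symm),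
      map_zero] at hc'
    exact hc' rfl
  choose c hc using fun j => IsLocalRing.residue_surjective (c' j)
  have hcl : IsUnit (c l) := (IsLocalRing.residue_ne_zero_iff_isUnit _).1 (by rwa [hc])
  have hcq : IsUnit (MvPolynomial.eval c q) := by
    rw [← IsLocalRing.residue_ne_zero_iff_isUnit]
    rwa [MvPolynomial.map_eval, show (IsLocalRing.residue V) ∘ c = c' from funext hc]
  obtain ⟨w, hw⟩ := hcl.exists_right_inv
  obtain ⟨v, hv⟩ := hcq.exists_left_inv
  obtain _ | m' := m
  · exact l.elim0
  let y' : Fin m' → L := fun i => y (l.succAbove i) - c (l.succAbove i) • w • y l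
  let θ : Fin (m' + 1) → (MvPolynomial (Fin m') V)[X] :=
    l.insertNth (algebraMap V _ (c l) * X)
      fun i => C (MvPolynomial.X i) + algebraMap V _ (c (l.succAbove i)) * X
  have hmon : ∀ (r : V) (z : L), C (algebraMap V L r) * monomial 1 z = monomial 1 (r • z) :=
    fun r z => by rw [C_mul_monomial, Algebra.smul_def]
  have hθ : ∀ j, (θ j).natDegree ≤ 1 := by
    refine (Fin.forall_iff_succAbove l).2 ⟨?_, fun i => ?_⟩
    · simp only [θ, Fin.insertNth_apply_same]
      exact natDegree_C_mul_le _ _ |>.trans natDegree_X_le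
    · simp only [θ, Fin.insertNth_apply_succAbove]
      refine natDegree_add_le_of_degree_le (by simp) ?_
      exact natDegree_C_mul_le _ _ |>.trans natDegree_X_le
  have hθc : ∀ j, (θ j).coeff 1 = algebraMap V _ (c j) := by
    refine (Fin.forall_iff_succAbove l).2 ⟨?_, fun i => ?_⟩
    · simp only [θ, Fin.insertNth_apply_same]
      rw [Polynomial.algebraMap_apply, coeff_C_mul, coeff_X_one, mul_one]
    · simp only [θ, Fin.insertNth_apply_succAbove]
      rw [Polynomial.algebraMap_apply, coeff_add, coeff_C_mul, coeff_X_one, mul_one,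
        coeff_C_of_ne_zero one_ne_zero,
        zero_add]
  obtain ⟨hdeg, hlead⟩ := natDegree_aeval_le_and_coeff hθ hθc hqh
  have hev : (eval₂RingHom (gradedEval V y' : MvPolynomial (Fin m') V →+* L[X])
      (monomial 1 (w • y l))).comp (MvPolynomial.aeval θ : MvPolynomial _ V →ₐ[V] _).toRingHom =
      (gradedEval V y : MvPolynomial (Fin (m' + 1)) V →+* L[X]) := by
    have hcomm : ∀ r : V, eval₂ (gradedEval V y' : MvPolynomial (Fin m') V →+* L[X])
        (monomial 1 (w • y l)) (algebraMap V (MvPolynomial (Fin m') V)[X] r) =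
        C (algebraMap V L r) := fun r => by
      rw [Polynomial.algebraMap_apply, eval₂_C, MvPolynomial.algebraMap_eq,
        IsHomIntegral.coe_gradedEval_C]
    refine MvPolynomial.ringHom_ext (fun r => ?_) ?_
    · rw [RingHom.comp_apply, IsHomIntegral.coe_gradedEval_C, ← hcomm r]
      exact congrArg _ (MvPolynomial.aeval_C θ r)
    · have hX : ∀ j, (MvPolynomial.aeval θ : MvPolynomial _ V →ₐ[V] _).toRingHom
        (MvPolynomial.X j) = θ j := MvPolynomial.aeval_X θ
      refine (Fin.forall_iff_succAbove l).2 ⟨?_, fun i => ?_⟩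
      · rw [RingHom.comp_apply, hX, IsHomIntegral.coe_gradedEval_X]
        simp only [θ, Fin.insertNth_apply_same, coe_eval₂RingHom, eval₂_mul, hcomm, eval₂_X]
        rw [hmon, smul_smul, hw, one_smul]
      · rw [RingHom.comp_apply, hX, IsHomIntegral.coe_gradedEval_X]
        simp only [θ, Fin.insertNth_apply_succAbove, coe_eval₂RingHom, eval₂_mul, hcomm, eval₂_X,
          eval₂_add, eval₂_C, IsHomIntegral.coe_gradedEval_X]
        rw [hmon, ← map_add, sub_add_cancel]
  have hq1 : gradedEval V y q = 0 := by
    ext i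
    rw [coeff_gradedEval, coeff_zero]
    by_cases hi : i = n
    · rw [hi, MvPolynomial.homogeneousComponent_of_mem hqh, if_pos rfl, hqy]
    · rw [MvPolynomial.homogeneousComponent_of_mem hqh, if_neg hi, map_zero]
  have hwy : IsHomIntegral V y' 1 (w • y l) := by
    refine ⟨C (MvPolynomial.C v) * MvPolynomial.aeval θ q, ?_, ?_⟩
    · refine monic_of_natDegree_le_of_coeff_eq_one n ((natDegree_C_mul_le _ _).trans hdeg) ?_
      rw [coeff_C_mul, hlead, MvPolynomial.algebraMap_eq, ← map_mul, hv, map_one]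
    · rw [eval₂_mul]
      have h1 := DFunLike.congr_fun hev q
      change eval₂ _ _ (MvPolynomial.aeval θ q) = gradedEval V y q at h1
      rw [h1, hq1, mul_zero]
  have hyl : IsHomIntegral V y' 1 (y l) := by
    have := hwy.smul (c l)
    rwa [smul_smul, hw, one_smul] at this
  refine ⟨m', rfl, y', fun i => ?_, (Fin.forall_iff_succAbove l).2 ⟨hyl, fun i => ?_⟩⟩
  · exact sub_mem (Submodule.subset_span ⟨_, rfl⟩)
      (Submodule.smul_mem _ _ (Submodule.smul_mem _ _ (Submodule.subset_span ⟨_, rfl⟩)))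
  · have := (IsHomIntegral.gen (R := V) (y := y') i).add (hwy.smul (c (l.succAbove i)))
    rwa [sub_add_cancel] at this

/-- Linear homogeneous Noether normalization over a valuation ring. -/
theorem exists_linear_noether_normalization [Infinite (IsLocalRing.ResidueField V)] {ι : Type*}
    [Finite ι] {x : ι → L} {i₀ : ι} (hx : x i₀ ≠ 0) : ∃ (d : ℕ) (y : Fin (d + 1) → L),
      (∀ j, y j ∈ Submodule.span V (Set.range x)) ∧ (∀ i, IsHomIntegral V y 1 (x i)) ∧
      Function.Injective (gradedEval K y) := by
  classical
  let P : ℕ → Prop := fun m => ∃ y : Fin m → L, (∀ j, y j ∈ Submodule.span V (Set.range x)) ∧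
    ∀ i, IsHomIntegral V y 1 (x i)
  have hP : ∃ m, P m := by
    obtain ⟨m, ⟨e⟩⟩ := Finite.exists_equiv_fin ι
    refine ⟨m, fun j => x (e.symm j), fun j => Submodule.subset_span ⟨_, rfl⟩, fun i => ?_⟩
    have := IsHomIntegral.gen (R := V) (y := fun j => x (e.symm j)) (e i)
    simpa using this
  obtain ⟨m, hPm, hmin⟩ : ∃ m, P m ∧ ∀ m' < m, ¬ P m' :=
    ⟨_, Nat.find_spec hP, fun _ h => Nat.find_min hP h⟩
  obtain ⟨y, hy, hxy⟩ := hPm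
  have hinj : Function.Injective (gradedEval K y) := by
    by_contra hcon
    obtain ⟨m', hm', y', hy', hyy⟩ := exists_homIntegral_of_not_injective (V := V) hcon
    refine hmin m' (by omega) ⟨y', fun j => ?_, fun i => (hxy i).trans hyy⟩
    exact Submodule.span_le.2 (Set.range_subset_iff.2 hy) (hy' j)
  have hne : m ≠ 0 := by
    intro h0
    have : IsEmpty (Fin m) := by rw [h0]; infer_instance
    have h1 : (gradedEval V y : MvPolynomial _ V →+* L[X]) =
        C.comp (MvPolynomial.aeval y : _ →ₐ[V] L).toRingHom := by
      refine MvPolynomial.ringHom_ext (fun r => ?_) fun j => isEmptyElim j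
      rw [IsHomIntegral.coe_gradedEval_C, RingHom.comp_apply]
      exact congrArg C (MvPolynomial.aeval_C y r).symm
    have h2 := hxy i₀
    rw [IsHomIntegral, h1] at h2
    have h3 : IsIntegral L (monomial 1 (x i₀)) := h2.of_comp_left
    have h4 : (monomial 1 (x i₀)).natDegree = 1 := natDegree_monomial_eq 1 hx
    exact transcendental (monomial 1 (x i₀)) (by omega)
      (mem_nonZeroDivisors_of_ne_zero (by rwa [leadingCoeff_monomial])) h3.isAlgebraic
  obtain ⟨d, hd⟩ := Nat.exists_eq_succ_of_ne_zero hne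
  subst hd
  exact ⟨d, y, hy, hxy, hinj⟩

end

section

open Polynomial

theorem IsHomIntegral.monomial {R S σ : Type*} [CommRing R] [CommRing S] [Algebra R S]
    {y : σ → S} {n : ℕ} {b : S} (hb : IsHomIntegral R y n b) :
    IsHomIntegral R (fun j => Polynomial.monomial 1 (y j)) n (Polynomial.monomial n b) := by
  let φ : S[X] →+* S[X][X] := eval₂RingHom (C.comp C) (Polynomial.monomial 1 X)
  have hφ : ∀ m (c : S), φ (Polynomial.monomial m c) =
      Polynomial.monomial m (Polynomial.monomial m c) := by
    intro m c
    simp only [φ, coe_eval₂RingHom, eval₂_monomial, RingHom.comp_apply]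
    rw [monomial_pow, C_mul_monomial, one_mul, C_mul_X_pow_eq_monomial]
  have h1 := RingHom.IsIntegralElem.map hb φ
  rw [hφ] at h1
  have h2 : φ.comp (gradedEval R y : MvPolynomial σ R →+* S[X]) =
      (gradedEval R fun j => Polynomial.monomial 1 (y j) : MvPolynomial σ R →+* S[X][X]) := by
    refine MvPolynomial.ringHom_ext (fun r => ?_) fun j => ?_
    · rw [RingHom.comp_apply, coe_gradedEval_C, coe_gradedEval_C]
      simp [φ]
    · rw [RingHom.comp_apply, coe_gradedEval_X, coe_gradedEval_X, hφ]
  rwa [h2] at h1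

/-- The submodule of homogeneously integral elements of a given degree. -/
def homIntegralSubmodule (R : Type*) {S σ : Type*} [CommRing R] [CommRing S] [Algebra R S]
    (y : σ → S) (n : ℕ) : Submodule R S where
  carrier := {b | IsHomIntegral R y n b}
  zero_mem' := IsHomIntegral.zero
  add_mem' := IsHomIntegral.add
  smul_mem' := fun r _ => IsHomIntegral.smul r

theorem homIntegralSubmodule_eq {R S σ τ : Type*} [CommRing R] [CommRing S] [Algebra R S]
    {y : σ → S} {z : τ → S} (hyz : ∀ i, IsHomIntegral R y 1 (z i))
    (hzy : ∀ i, IsHomIntegral R z 1 (y i)) (n : ℕ) :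
    homIntegralSubmodule R y n = homIntegralSubmodule R z n :=
  le_antisymm (fun _ h => IsHomIntegral.trans hzy h) fun _ h => IsHomIntegral.trans hyz h

theorem IsHomIntegral.of_mem_span {R S σ : Type*} [CommRing R] [CommRing S] [Algebra R S]
    {y : σ → S} {b : S} (hb : b ∈ Submodule.span R (Set.range y)) : IsHomIntegral R y 1 b :=
  Submodule.span_le (p := homIntegralSubmodule R y 1).2
    (Set.range_subset_iff.2 fun j => IsHomIntegral.gen j) hb

/-- Homogeneous integrality after extending the base ring. -/
theorem IsHomIntegral.extend {V K S σ : Type*} [CommRing V] [CommRing K] [CommRing S] [Algebra V K]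
    [Algebra V S] [Algebra K S] [IsScalarTower V K S] {y : σ → S} {n : ℕ} {b : S}
    (hb : IsHomIntegral V y n b) : IsHomIntegral K y n b :=
  hb.map (algebraMap V K) (RingHom.id S) fun r => (IsScalarTower.algebraMap_apply V K S r).symm

end

section

open Polynomial

variable (K L : Type u) [Field K] [Field L] [Algebra K L] (d : ℕ)
  [Algebra (MvPolynomial (Fin (d + 1)) K) L[X]]
  [IsScalarTower K (MvPolynomial (Fin (d + 1)) K) L[X]]

/-- The integral closure of a polynomial ring in `L[X]`. -/
noncomputable abbrev GradedClosure : Subalgebra (MvPolynomial (Fin (d + 1)) K) L[X] :=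
  integralClosure (MvPolynomial (Fin (d + 1)) K) L[X]

/-- The monomials of a given degree in the integral closure. -/
noncomputable def monomialSubmodule (n : ℕ) : Submodule K (GradedClosure K L d) where
  carrier := {b | ∃ c, (b : L[X]) = monomial n c}
  zero_mem' := ⟨0, by simp⟩
  add_mem' := by
    rintro a b ⟨c, hc⟩ ⟨c', hc'⟩
    exact ⟨c + c', by rw [map_add, ← hc, ← hc']; rfl⟩
  smul_mem' := by
    rintro r b ⟨c, hc⟩
    refine ⟨r • c, ?_⟩
    rw [← smul_monomial, ← hc]
    rfl

variable {K L d}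

variable {y : Fin (d + 1) → L} (halg : ∀ p, algebraMap (MvPolynomial (Fin (d + 1)) K) L[X] p =
  gradedEval K y p)

include halg

omit [IsScalarTower K (MvPolynomial (Fin (d + 1)) K) L[X]] in
theorem isIntegral_monomial_iff {n : ℕ} {c : L} :
    IsIntegral (MvPolynomial (Fin (d + 1)) K) (monomial n c) ↔ IsHomIntegral K y n c := by
  unfold IsHomIntegral
  rw [← show algebraMap (MvPolynomial (Fin (d + 1)) K) L[X] =
    (gradedEval K y : MvPolynomial (Fin (d + 1)) K →+* L[X]) from RingHom.ext halg]
  rfl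

omit [IsScalarTower K (MvPolynomial (Fin (d + 1)) K) L[X]] in
theorem coe_algebraMap_gradedClosure_X (j : Fin (d + 1)) :
    ((algebraMap (MvPolynomial (Fin (d + 1)) K) (GradedClosure K L d) (MvPolynomial.X j) :
      GradedClosure K L d) : L[X]) = monomial 1 (y j) := by
  change algebraMap (MvPolynomial (Fin (d + 1)) K) L[X] (MvPolynomial.X j) = _
  rw [halg]
  exact IsHomIntegral.coe_gradedEval_X j

theorem isGradedSystem_monomialSubmodule :
    IsGradedSystem K d (GradedClosure K L d) (monomialSubmodule K L d) where
  isHomIntegral := by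
    rintro n b ⟨c, hc⟩
    have hb : IsIntegral (MvPolynomial (Fin (d + 1)) K) (b : L[X]) := b.2
    rw [hc, isIntegral_monomial_iff halg] at hb
    refine IsHomIntegral.of_map ((GradedClosure K L d).val.restrictScalars K)
      Subtype.val_injective ?_
    convert hb.monomial using 1
    · funext j
      exact coe_algebraMap_gradedClosure_X halg j
    · exact hc
  one_mem := ⟨1, rfl⟩
  mul_mem := by
    rintro n m a ⟨c, hc⟩ b ⟨c', hc'⟩
    exact ⟨c * c', by rw [← monomial_mul_monomial, ← hc, ← hc']; rfl⟩
  X_mem := fun j => ⟨y j, coe_algebraMap_gradedClosure_X halg j⟩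

theorem finrank_monomialSubmodule (n : ℕ) : Module.finrank K (monomialSubmodule K L d n) =
    Module.finrank K (homIntegralSubmodule K y n) := by
  symm
  let e : homIntegralSubmodule K y n →ₗ[K] monomialSubmodule K L d n :=
    { toFun := fun c => ⟨⟨monomial n (c : L), (isIntegral_monomial_iff halg).2 c.2⟩, c, rfl⟩
      map_add' := fun a b => Subtype.ext (Subtype.ext (map_add _ _ _))
      map_smul' := fun r a => Subtype.ext (Subtype.ext (smul_monomial _ _ _).symm) }
  refine LinearEquiv.finrank_eq (LinearEquiv.ofBijective e ⟨?_, ?_⟩)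
  · intro a b hab
    have h1 : monomial n (a : L) = monomial n (b : L) :=
      congrArg (fun z : monomialSubmodule K L d n => ((z : GradedClosure K L d) : L[X])) hab
    exact Subtype.ext (monomial_injective n h1)
  · rintro ⟨b, c, hc⟩
    have hb : IsIntegral (MvPolynomial (Fin (d + 1)) K) (b : L[X]) := b.2
    rw [hc, isIntegral_monomial_iff halg] at hb
    exact ⟨⟨c, hb⟩, Subtype.ext (Subtype.ext hc.symm)⟩

end

section

open Polynomial

variable {K L : Type u} [Field K] [Field L] [Algebra K L] {d : ℕ}
  [Algebra (MvPolynomial (Fin (d + 1)) K) L[X]]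

/-- Families independent over the polynomial ring are bounded in size when `L` is generated by
elements homogeneously integral over the variables. -/
theorem exists_linearIndependent_bound {y : Fin (d + 1) → L}
    (halg : ∀ p, algebraMap (MvPolynomial (Fin (d + 1)) K) L[X] p = gradedEval K y p)
    (hinj : Function.Injective (gradedEval K y)) {ι : Type*} [Finite ι] {x : ι → L} {i₀ : ι}
    (hx : x i₀ = 1) (hxy : ∀ i, IsHomIntegral K y 1 (x i))
    (hadj : IntermediateField.adjoin K (Set.range x) = ⊤) :
    ∃ M, ∀ m (b : Fin m → GradedClosure K L d),
      LinearIndependent (MvPolynomial (Fin (d + 1)) K) b → m ≤ M := by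
  have hinj' : Function.Injective (algebraMap (MvPolynomial (Fin (d + 1)) K) L[X]) := by
    intro p q hpq
    rw [halg, halg] at hpq
    exact hinj hpq
  have hΩ : FaithfulSMul (MvPolynomial (Fin (d + 1)) K) (FractionRing L[X]) := by
    rw [faithfulSMul_iff_algebraMap_injective,
      IsScalarTower.algebraMap_eq (MvPolynomial (Fin (d + 1)) K) L[X] (FractionRing L[X])]
    exact (IsFractionRing.injective L[X] (FractionRing L[X])).comp hinj'
  let F := FractionRing (MvPolynomial (Fin (d + 1)) K)
  let : Algebra F (FractionRing L[X]) :=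
    FractionRing.liftAlgebra (MvPolynomial (Fin (d + 1)) K) (FractionRing L[X])
  have htower : IsScalarTower (MvPolynomial (Fin (d + 1)) K) F (FractionRing L[X]) :=
    FractionRing.isScalarTower_liftAlgebra _ _
  let z : ι → FractionRing L[X] := fun i => algebraMap L[X] _ (monomial 1 (x i))
  let E : IntermediateField F (FractionRing L[X]) := IntermediateField.adjoin F (Set.range z)
  have hzE : ∀ i, z i ∈ E := fun i => IntermediateField.subset_adjoin _ _ ⟨i, rfl⟩
  have hfin : FiniteDimensional F E := by
    refine IntermediateField.finiteDimensional_adjoin ?_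
    rintro _ ⟨i, rfl⟩
    have h1 : IsIntegral (MvPolynomial (Fin (d + 1)) K) (monomial 1 (x i)) :=
      (isIntegral_monomial_iff halg).2 (hxy i)
    exact (h1.algebraMap (B := FractionRing L[X])).tower_top
  have hX : algebraMap L[X] (FractionRing L[X]) X ∈ E := by
    have := hzE i₀
    simp only [z, hx] at this
    exact this
  have hX0 : algebraMap L[X] (FractionRing L[X]) X ≠ 0 :=
    (map_ne_zero_iff _ (IsFractionRing.injective L[X] (FractionRing L[X]))).2 X_ne_zero
  have hC : ∀ c : L, algebraMap L[X] (FractionRing L[X]) (C c) ∈ E := by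
    let I : IntermediateField K L := (E.toSubfield.comap
      ((algebraMap L[X] (FractionRing L[X])).comp C)).toIntermediateField (fun r => by
        change algebraMap L[X] (FractionRing L[X]) (C (algebraMap K L r)) ∈ E
        have h1 : C (algebraMap K L r) =
            algebraMap (MvPolynomial (Fin (d + 1)) K) L[X] (MvPolynomial.C r) := by
          rw [halg]
          exact (IsHomIntegral.coe_gradedEval_C r).symm
        rw [h1, ← IsScalarTower.algebraMap_apply, IsScalarTower.algebraMap_apply _ F]
        exact E.algebraMap_mem _)
    have hI : I = ⊤ := by
      rw [eq_top_iff, ← hadj, IntermediateField.adjoin_le_iff]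
      rintro _ ⟨i, rfl⟩
      change algebraMap L[X] (FractionRing L[X]) (C (x i)) ∈ E
      have h1 : algebraMap L[X] (FractionRing L[X]) (C (x i)) =
          z i / algebraMap L[X] (FractionRing L[X]) X := by
        rw [eq_div_iff hX0, ← map_mul, C_mul_X_eq_monomial]
      rw [h1]
      exact div_mem (hzE i) hX
    intro c
    have : c ∈ I := hI ▸ IntermediateField.mem_top
    exact this
  have hE : E = ⊤ := by
    rw [eq_top_iff]
    intro w _
    have hp : ∀ p : L[X], algebraMap L[X] (FractionRing L[X]) p ∈ E := by
      intro p
      induction p using Polynomial.induction_on' with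
      | add p q hp hq => rw [map_add]; exact add_mem hp hq
      | monomial n c =>
        rw [← C_mul_X_pow_eq_monomial, map_mul, map_pow]
        exact mul_mem (hC c) (pow_mem hX n)
    obtain ⟨p, q, -, rfl⟩ := IsFractionRing.div_surjective (A := L[X]) w
    exact div_mem (hp p) (hp q)
  have hfin' : FiniteDimensional F (FractionRing L[X]) := by
    rw [hE] at hfin
    exact IntermediateField.topEquiv.toLinearEquiv.finiteDimensional
  refine ⟨Module.finrank F (FractionRing L[X]), fun m b hb => ?_⟩
  let ψ : GradedClosure K L d →ₗ[MvPolynomial (Fin (d + 1)) K] FractionRing L[X] :=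
    ((Algebra.ofId L[X] (FractionRing L[X])).restrictScalars
      (MvPolynomial (Fin (d + 1)) K)).toLinearMap ∘ₗ (GradedClosure K L d).val.toLinearMap
  have hψ : Function.Injective ψ :=
    (IsFractionRing.injective L[X] (FractionRing L[X])).comp Subtype.val_injective
  have h1 := hb.map_injOn ψ hψ.injOn
  rw [LinearIndependent.iff_fractionRing (MvPolynomial (Fin (d + 1)) K) F] at h1
  simpa using h1.fintype_card_le_finrank

end

section

open Polynomial

variable {V K L : Type u} [CommRing V] [Field K] [Algebra V K] [Field L] [Algebra K L]
  [Algebra V L] [IsScalarTower V K L] {d : ℕ}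
  [Algebra (MvPolynomial (Fin (d + 1)) K) L[X]]
  {y : Fin (d + 1) → L} (halg : ∀ p, algebraMap (MvPolynomial (Fin (d + 1)) K) L[X] p =
    gradedEval K y p)

include halg

theorem val_comp_algebraMap_comp_map :
    ((GradedClosure K L d).val : GradedClosure K L d →+* L[X]).comp
    ((algebraMap (MvPolynomial (Fin (d + 1)) K) (GradedClosure K L d)).comp
      (MvPolynomial.map (algebraMap V K))) =
    (gradedEval V y : MvPolynomial (Fin (d + 1)) V →+* L[X]) := by
  refine MvPolynomial.ringHom_ext (fun r => ?_) fun j => ?_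
  · change algebraMap (MvPolynomial (Fin (d + 1)) K) L[X]
      (MvPolynomial.map _ (MvPolynomial.C r)) = _
    rw [halg, MvPolynomial.map_C, IsHomIntegral.coe_gradedEval_C,
      IsScalarTower.algebraMap_apply V K L]
    exact IsHomIntegral.coe_gradedEval_C _
  · change algebraMap (MvPolynomial (Fin (d + 1)) K) L[X]
      (MvPolynomial.map _ (MvPolynomial.X j)) = _
    rw [halg, MvPolynomial.map_X, IsHomIntegral.coe_gradedEval_X]
    exact IsHomIntegral.coe_gradedEval_X _

/-- A monomial is integral over `V[X]` exactly when its coefficient is homogeneously integral. -/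
theorem mem_ballSubring_iff_isHomIntegral {n : ℕ} {c : L} {f : GradedClosure K L d}
    (hf : (f : L[X]) = monomial n c) :
    f ∈ ballSubring V K (Fin (d + 1)) (GradedClosure K L d) ↔ IsHomIntegral V y n c := by
  rw [mem_ballSubring, IsBallElem, IsHomIntegral, ← val_comp_algebraMap_comp_map halg, ← hf]
  exact ⟨fun h => RingHom.IsIntegralElem.map h _,
    fun h => RingHom.IsIntegralElem.of_comp_injective Subtype.val_injective h⟩

variable [IsScalarTower K (MvPolynomial (Fin (d + 1)) K) L[X]] [IsDomain V] [ValuationRing V]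
  {G : Type u} [CommRing G] [Algebra (MvPolynomial (Fin (d + 1)) (IsLocalRing.ResidueField V)) G]
  [Algebra (IsLocalRing.ResidueField V) G]
  (π : ballSubring V K (Fin (d + 1)) (GradedClosure K L d) →+* G)
  (hπ : ∀ v : V, algebraMap (IsLocalRing.ResidueField V) G (IsLocalRing.residue V v) =
        π ⟨_, algebraMap_mem_ballSubring v⟩)

/-- The reductions of the monomials form a graded system in the special fibre. -/
theorem isGradedSystem_reductionSubmodule
    (hπX : ∀ a, algebraMap (MvPolynomial (Fin (d + 1)) (IsLocalRing.ResidueField V)) G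
      (MvPolynomial.map (IsLocalRing.residue V) a) = π ⟨_, algebraMap_map_mem_ballSubring a⟩) :
    IsGradedSystem (IsLocalRing.ResidueField V) d G
      (fun n => reductionSubmodule π hπ (monomialSubmodule K L d n)) := by
  have hX : ∀ j, algebraMap (MvPolynomial (Fin (d + 1)) (IsLocalRing.ResidueField V)) G
      (MvPolynomial.X j) = π ⟨_, algebraMap_map_mem_ballSubring (MvPolynomial.X j)⟩ := by
    intro j
    rw [← hπX, MvPolynomial.map_X]
  have hXm : ∀ j, ((algebraMap (MvPolynomial (Fin (d + 1)) K) (GradedClosure K L d)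
      (MvPolynomial.map (algebraMap V K) (MvPolynomial.X j)) : GradedClosure K L d) : L[X]) =
      monomial 1 (y j) := by
    intro j
    rw [MvPolynomial.map_X]
    exact coe_algebraMap_gradedClosure_X halg j
  refine ⟨?_, ⟨1, ⟨1, rfl⟩, map_one _⟩, ?_, fun j => ⟨_, ⟨y j, hXm j⟩, (hX j).symm⟩⟩
  · rintro n _ ⟨f, ⟨c, hc⟩, rfl⟩
    have h1 := ((mem_ballSubring_iff_isHomIntegral halg hc).1 f.2).monomial
    let ρ : V →+* ballSubring V K (Fin (d + 1)) (GradedClosure K L d) :=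
      ((algebraMap K (GradedClosure K L d)).comp (algebraMap V K)).codRestrict _
        fun v => algebraMap_mem_ballSubring v
    let : Algebra V (ballSubring V K (Fin (d + 1)) (GradedClosure K L d)) := ρ.toAlgebra
    let ψ : ballSubring V K (Fin (d + 1)) (GradedClosure K L d) →ₐ[V] L[X] :=
      { ((GradedClosure K L d).val : GradedClosure K L d →+* L[X]).comp (Subring.subtype _) with
        commutes' := fun v => by
          change algebraMap K L[X] (algebraMap V K v) = _
          rw [← IsScalarTower.algebraMap_apply V K L[X]] }
    have hψ : Function.Injective ψ := Subtype.val_injective.comp Subtype.val_injective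
    have h2 : IsHomIntegral V (fun j => (⟨_, algebraMap_map_mem_ballSubring (MvPolynomial.X j)⟩ :
        ballSubring V K (Fin (d + 1)) (GradedClosure K L d))) n f := by
      refine IsHomIntegral.of_map ψ hψ ?_
      convert h1 using 1
      · funext j
        exact hXm j
      · exact hc
    have h3 := h2.map (R' := IsLocalRing.ResidueField V) (IsLocalRing.residue V) π hπ
    rw [← funext hX] at h3
    exact h3
  · rintro n m _ ⟨f, ⟨c, hc⟩, rfl⟩ _ ⟨g, ⟨c', hc'⟩, rfl⟩
    refine ⟨f * g, ⟨c * c', ?_⟩, map_mul _ _ _⟩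
    rw [← monomial_mul_monomial, ← hc, ← hc']
    rfl

end

section

open Polynomial

variable {V K L : Type u} [CommRing V] [Field K] [Algebra V K] [Field L] [Algebra K L]
  [Algebra V L] [IsScalarTower V K L] {d : ℕ}
  [Algebra (MvPolynomial (Fin (d + 1)) K) L[X]]
  [IsScalarTower K (MvPolynomial (Fin (d + 1)) K) L[X]]
  {y : Fin (d + 1) → L} (halg : ∀ p, algebraMap (MvPolynomial (Fin (d + 1)) K) L[X] p =
    gradedEval K y p)
  (hinj : Function.Injective (gradedEval K y))

include halg hinj

omit [IsScalarTower K (MvPolynomial (Fin (d + 1)) K) L[X]] in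
theorem faithfulSMul_gradedClosure :
    FaithfulSMul (MvPolynomial (Fin (d + 1)) K) (GradedClosure K L d) := by
  rw [faithfulSMul_iff_algebraMap_injective]
  intro p q hpq
  have h1 := congrArg (fun z : GradedClosure K L d => (z : L[X])) hpq
  change algebraMap _ L[X] p = algebraMap _ L[X] q at h1
  rw [halg, halg] at h1
  exact hinj h1

/-- Growth of the dimension of the space of homogeneously integral elements. -/
theorem finrank_homIntegralSubmodule_growth [PerfectField K] {ι : Type*} [Finite ι] {x : ι → L}
    {i₀ : ι} (hx : x i₀ = 1) (hxy : ∀ i, IsHomIntegral K y 1 (x i))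
    (hadj : IntermediateField.adjoin K (Set.range x) = ⊤) :
    (∀ n, FiniteDimensional K (monomialSubmodule K L d n)) ∧ ∃ r C : ℕ, 1 ≤ r ∧
      (∀ n, Module.finrank K (homIntegralSubmodule K y n) ≤ r * (n + C + d).choose d) ∧
      ∀ n, r * (n + d).choose d ≤ Module.finrank K (homIntegralSubmodule K y (n + C)) := by
  have := faithfulSMul_gradedClosure halg hinj
  have : Module.IsTorsionFree (MvPolynomial (Fin (d + 1)) K) (GradedClosure K L d) :=
    Module.isTorsionFree_iff_algebraMap_injective.2 (FaithfulSMul.algebraMap_injective _ _)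
  obtain ⟨M, hM⟩ := exists_linearIndependent_bound halg hinj hx hxy hadj
  obtain ⟨h1, r, C, hr, h2, h3⟩ :=
    (isGradedSystem_monomialSubmodule (K := K) (L := L) halg).exists_growth hM
  refine ⟨h1, r, C, hr, fun n => ?_, fun n => ?_⟩
  · rw [← finrank_monomialSubmodule halg]
    exact h2 n
  · rw [← finrank_monomialSubmodule halg]
    exact h3 n

variable [IsDomain V] [ValuationRing V] [IsFractionRing V K] [IsAlgClosed K]

theorem fg_homIntegralSubmodule (n : ℕ) [FiniteDimensional K (monomialSubmodule K L d n)] :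
    (homIntegralSubmodule V y n).FG := by
  have := faithfulSMul_gradedClosure halg hinj
  obtain ⟨m, f, l, hfE, hfb, hl, -, hgen⟩ :=
    exists_dual_specializations V (Fin (d + 1)) (monomialSubmodule K L d n)
  choose c hc using hfE
  have hcV := fun i => (mem_ballSubring_iff_isHomIntegral halg (hc i)).1 (hfb i)
  suffices h : homIntegralSubmodule V y n = Submodule.span V (Set.range c) by
    rw [h]
    exact Submodule.fg_span (Set.finite_range c)
  refine le_antisymm (fun b hb => ?_)
    (Submodule.span_le.2 (Set.range_subset_iff.2 fun i => hcV i))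
  let g : GradedClosure K L d :=
    ⟨monomial n b, (isIntegral_monomial_iff halg).2 (IsHomIntegral.extend hb)⟩
  have hg : g ∈ ballSubring V K (Fin (d + 1)) (GradedClosure K L d) :=
    (mem_ballSubring_iff_isHomIntegral halg rfl).2 hb
  choose v hv using fun i => apply_mem_range_of_mem_specializationSpan hg (hl i)
  have h1 := congrArg (fun z : GradedClosure K L d => (z : L[X]).coeff n) (hgen g ⟨b, rfl⟩)
  have h2 : b = ∑ i, v i • c i := by
    simp only [g, coeff_monomial_same, AddSubmonoidClass.coe_finsetSum, finsetSum_coeff] at h1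
    rw [h1]
    refine Finset.sum_congr rfl fun i _ => ?_
    change (l i g • (f i : L[X])).coeff n = _
    rw [coeff_smul, hc, coeff_monomial_same, ← hv, algebraMap_smul]
  rw [h2]
  exact Submodule.sum_mem _ fun i _ => Submodule.smul_mem _ _ (Submodule.subset_span ⟨i, rfl⟩)

/-- From the uniform generation bound on, homogeneously integral elements over the valuation ring
are generated by the variables. -/
theorem homIntegralSubmodule_succ_le {n₀ : ℕ} (hgb : IsUniformGenerationBound.{u} d
      (fun n => Module.finrank K (homIntegralSubmodule K y n)) n₀)
    (hfd : ∀ n, FiniteDimensional K (monomialSubmodule K L d n)) {n : ℕ} (hn : n₀ ≤ n) :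
    homIntegralSubmodule V y (n + 1) ≤
      Submodule.span V {z | ∃ j c, IsHomIntegral V y n c ∧ z = y j * c} := by
  have := faithfulSMul_gradedClosure halg hinj
  obtain ⟨G, _, _, _, _, π, _, _, _, _, hπs, hker, hπX, hπ⟩ :=
    exists_special_fibre V K (Fin (d + 1)) (GradedClosure K L d)
  have : IsAlgClosed (IsLocalRing.ResidueField V) := isAlgClosed_residueField K
  have hred := fun n => finrank_reductionSubmodule π hπ hker (monomialSubmodule K L d n)
  have hgen := hgb (IsLocalRing.ResidueField V) G _
    (isGradedSystem_reductionSubmodule halg π hπ hπX) (fun n => (hred n).1)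
    (fun n => (hred n).2.trans (finrank_monomialSubmodule halg n)) n hn
  set N' := Submodule.span V {z | ∃ j c, IsHomIntegral V y n c ∧ z = y j * c}
  have hlift : ∀ z ∈ Submodule.span (IsLocalRing.ResidueField V)
      {z | ∃ i, ∃ w ∈ reductionSubmodule π hπ (monomialSubmodule K L d n),
        z = algebraMap (MvPolynomial (Fin (d + 1)) (IsLocalRing.ResidueField V)) G
          (MvPolynomial.X i) * w},
      ∃ f : ballSubring V K (Fin (d + 1)) (GradedClosure K L d), ∃ c ∈ N',
        ((f : GradedClosure K L d) : L[X]) = monomial (n + 1) c ∧ π f = z := by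
    intro z hz
    induction hz using Submodule.span_induction with
    | mem z hz =>
      obtain ⟨i, _, ⟨f, ⟨c, hc⟩, rfl⟩, rfl⟩ := hz
      refine ⟨⟨_, algebraMap_map_mem_ballSubring (MvPolynomial.X i)⟩ * f, y i * c,
        Submodule.subset_span ⟨i, c, (mem_ballSubring_iff_isHomIntegral halg hc).1 f.2, rfl⟩,
        ?_, ?_⟩
      · rw [add_comm n 1, ← monomial_mul_monomial, ← hc, ← coe_algebraMap_gradedClosure_X halg,
          ← MvPolynomial.map_X (algebraMap V K)]
        rfl
      · rw [map_mul, ← hπX, MvPolynomial.map_X]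
    | zero => exact ⟨0, 0, zero_mem _, by simp, map_zero _⟩
    | add z w _ _ hz hw =>
      obtain ⟨f, c, hc, hf, rfl⟩ := hz
      obtain ⟨g, c', hc', hg, rfl⟩ := hw
      refine ⟨f + g, c + c', add_mem hc hc', ?_, map_add _ _ _⟩
      rw [map_add, ← hf, ← hg]
      rfl
    | smul r z _ hz =>
      obtain ⟨f, c, hc, hf, rfl⟩ := hz
      obtain ⟨v, rfl⟩ := IsLocalRing.residue_surjective r
      refine ⟨⟨_, smul_mem_ballSubring v f.2⟩, v • c, Submodule.smul_mem _ _ hc, ?_, ?_⟩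
      · rw [← algebraMap_smul K v c, ← smul_monomial, ← hf]
        rfl
      · refine Eq.trans ?_ (Algebra.smul_def _ _).symm
        rw [hπ, ← map_mul]
        exact congrArg π (Subtype.ext (Algebra.smul_def _ _))
  refine Submodule.le_of_le_smul_of_le_jacobson_bot (I := IsLocalRing.maximalIdeal V)
    (fg_homIntegralSubmodule halg hinj (n + 1)) (IsLocalRing.maximalIdeal_le_jacobson _) ?_
  intro b hb
  let f : ballSubring V K (Fin (d + 1)) (GradedClosure K L d) :=
    ⟨⟨monomial (n + 1) b, (isIntegral_monomial_iff halg).2 (IsHomIntegral.extend hb)⟩,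
      (mem_ballSubring_iff_isHomIntegral halg rfl).2 hb⟩
  obtain ⟨f', c, hc, hf', hff'⟩ := hlift (π f) (hgen _ ⟨f, ⟨b, rfl⟩, rfl⟩)
  obtain ⟨μ, hμ, g, hg, h⟩ : f - f' ∈ ballIdeal V K (Fin (d + 1)) (GradedClosure K L d) := by
    rw [← hker, map_sub, hff', sub_self]
  have h1 : monomial (n + 1) (b - c) = algebraMap V K μ • (g : L[X]) := by
    rw [map_sub, ← hf']
    exact congrArg (fun z : GradedClosure K L d => (z : L[X])) h
  suffices h2 : b - c ∈ IsLocalRing.maximalIdeal V • homIntegralSubmodule V y (n + 1) by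
    rw [← add_sub_cancel c b]
    exact Submodule.add_mem_sup hc h2
  by_cases hμ0 : algebraMap V K μ = 0
  · rw [hμ0, zero_smul, monomial_eq_zero_iff] at h1
    rw [h1]
    exact zero_mem _
  · have hgc : (g : L[X]) = monomial (n + 1) ((algebraMap V K μ)⁻¹ • (b - c)) := by
      rw [← smul_monomial, h1, smul_smul, inv_mul_cancel₀ hμ0, one_smul]
    have h3 := (mem_ballSubring_iff_isHomIntegral halg hgc).1 hg
    have h4 : b - c = μ • ((algebraMap V K μ)⁻¹ • (b - c)) := by
      rw [← algebraMap_smul K μ, smul_smul, mul_inv_cancel₀ hμ0, one_smul]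
    rw [h4]
    exact Submodule.smul_mem_smul hμ h3

end

section

open Polynomial

theorem IsHomIntegral.rescale {R S σ : Type*} [CommRing R] [CommRing S] [Algebra R S]
    {y : σ → S} {n : ℕ} {b : S} (hb : IsHomIntegral R y n b) (r : S) :
    IsHomIntegral R (fun j => r * y j) n (r ^ n * b) := by
  let φ : S[X] →+* S[X] := eval₂RingHom C (Polynomial.monomial 1 r)
  have hφ : ∀ m (c : S), φ (Polynomial.monomial m c) = Polynomial.monomial m (r ^ m * c) := by
    intro m c
    simp only [φ, coe_eval₂RingHom, eval₂_monomial]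
    rw [monomial_pow, C_mul_monomial, mul_comm c, one_mul]
  have h1 := RingHom.IsIntegralElem.map hb φ
  rw [hφ] at h1
  have h2 : φ.comp (gradedEval R y : MvPolynomial σ R →+* S[X]) =
      (gradedEval R fun j => r * y j : MvPolynomial σ R →+* S[X]) := by
    refine MvPolynomial.ringHom_ext (fun r => ?_) fun j => ?_
    · rw [RingHom.comp_apply, coe_gradedEval_C, coe_gradedEval_C]
      simp [φ]
    · rw [RingHom.comp_apply, coe_gradedEval_X, coe_gradedEval_X, hφ, pow_one]
  rwa [h2] at h1

/-- Homogeneous integrality over values in an integrally closed domain, with denominators. -/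
theorem IsHomIntegral.pow_mul_mem_range {R K σ : Type*} [CommRing R] [IsDomain R]
    [IsIntegrallyClosed R] [Field K] [Algebra R K] [IsFractionRing R K] {t : σ → K} {n : ℕ} {b : K}
    (hb : IsHomIntegral R t n b) {r : R}
    (hr : ∀ j, algebraMap R K r * t j ∈ (algebraMap R K).range) :
    algebraMap R K r ^ n * b ∈ (algebraMap R K).range := by
  have h1 := (hb.rescale (algebraMap R K r)).isIntegralElem
  refine IsIntegrallyClosed.isIntegral_iff.1 (RingHom.IsIntegralElem.trans_of_range
    (g := algebraMap R K) (fun p => ?_) h1 : (algebraMap R K).IsIntegralElem _)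
  choose v hv using hr
  have h2 : (MvPolynomial.aeval (R := R) fun j => algebraMap R K r * t j).toRingHom p =
      algebraMap R K (MvPolynomial.eval v p) := by
    change MvPolynomial.aeval _ p = _
    rw [← funext hv]
    change MvPolynomial.aeval (algebraMap R K ∘ v) p = _
    rw [MvPolynomial.aeval_algebraMap_apply]
    rfl
  rw [h2]
  exact RingHom.isIntegralElem_map (algebraMap R K)

/-- Homogeneous integrality over a localization, with denominators. -/
theorem IsHomIntegral.exists_smul_of_isLocalization {R V L ι : Type*} [CommRing R]
    [CommRing V] [CommRing L] [Algebra R V] [Algebra R L] [Algebra V L] [IsScalarTower R V L]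
    (M : Submonoid R) [IsLocalization M V] {x : ι → L} {n : ℕ} {b : L}
    (hb : IsHomIntegral V x n b) : ∃ r ∈ M, IsHomIntegral R x n (r • b) := by
  let : Algebra (MvPolynomial ι V) L[X] :=
    (gradedEval V x : MvPolynomial ι V →+* L[X]).toAlgebra
  let : Algebra (MvPolynomial ι R) L[X] :=
    (gradedEval R x : MvPolynomial ι R →+* L[X]).toAlgebra
  let : Algebra (MvPolynomial ι R) (MvPolynomial ι V) := MvPolynomial.algebraMvPolynomial
  have : IsScalarTower (MvPolynomial ι R) (MvPolynomial ι V) L[X] := by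
    refine IsScalarTower.of_algebraMap_eq' (MvPolynomial.ringHom_ext (fun r => ?_) fun j => ?_)
    · refine (IsHomIntegral.coe_gradedEval_C r).trans ?_
      rw [RingHom.comp_apply, MvPolynomial.algebraMap_def, MvPolynomial.map_C,
        IsScalarTower.algebraMap_apply R V L]
      exact (IsHomIntegral.coe_gradedEval_C _).symm
    · refine (IsHomIntegral.coe_gradedEval_X j).trans ?_
      rw [RingHom.comp_apply, MvPolynomial.algebraMap_def, MvPolynomial.map_X]
      exact (IsHomIntegral.coe_gradedEval_X j).symm
  have := MvPolynomial.isLocalization (σ := ι) M V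
  obtain ⟨⟨_, r, hr, rfl⟩, h⟩ := IsIntegral.exists_multiple_integral_of_isLocalization
    (Submonoid.map (MvPolynomial.C (σ := ι)) M) (Rₘ := MvPolynomial ι V)
    (Polynomial.monomial n b) hb
  refine ⟨r, hr, ?_⟩
  have h1 : (⟨MvPolynomial.C r, r, hr, rfl⟩ : Submonoid.map (MvPolynomial.C (σ := ι)) M) •
      (Polynomial.monomial n b : L[X]) = Polynomial.monomial n (r • b) := by
    change (gradedEval R x : MvPolynomial ι R →+* L[X]) (MvPolynomial.C r) *
      Polynomial.monomial n b = _
    rw [IsHomIntegral.coe_gradedEval_C, Algebra.smul_def, C_mul_monomial]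
  rw [h1] at h
  exact h

end

section

open Polynomial

variable {R V K L : Type u} [CommRing R] [IsDomain R] [IsIntegrallyClosed R] [CommRing V] [Field K]
  [Field L] [Algebra R V] [Algebra R K] [Algebra R L] [Algebra V K] [Algebra K L] [Algebra V L]
  [IsScalarTower R V K] [IsScalarTower R K L] [IsScalarTower R V L]
  [IsScalarTower V K L] {d : ℕ}
  [IsFractionRing R K] (M : Submonoid R) [IsLocalization M V]
  [Algebra (MvPolynomial (Fin (d + 1)) K) L[X]]
  [IsScalarTower K (MvPolynomial (Fin (d + 1)) K) L[X]]
  [IsDomain V] [ValuationRing V] [IsFractionRing V K]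
  {y : Fin (d + 1) → L} (halg : ∀ p, algebraMap (MvPolynomial (Fin (d + 1)) K) L[X] p =
    gradedEval K y p)
  {ι : Type*} [Finite ι] {x : ι → L} (hxy : ∀ i, IsHomIntegral V y 1 (x i))

include halg hxy

omit [IsScalarTower R V L] in
/-- The values of a combination of specializations at homogeneously integral elements of a given
degree have a common denominator. -/
theorem exists_common_denominator (n : ℕ) {l : GradedClosure K L d →ₗ[K] K}
    (hl : l ∈ specializationSpan V K (Fin (d + 1)) (GradedClosure K L d)) :
    ∃ r ∈ M, ∀ b, IsHomIntegral R x n b → ∀ f : GradedClosure K L d, (f : L[X]) = monomial n b →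
      algebraMap R K r * l f ∈ (algebraMap R K).range := by
  induction hl using Submodule.span_induction with
  | mem l hl =>
    obtain ⟨P, hP, rfl⟩ := hl
    let z : ι → GradedClosure K L d := fun i =>
      ⟨monomial 1 (x i), (isIntegral_monomial_iff halg).2 (hxy i).extend⟩
    have hz : ∀ i, P (z i) ∈ (algebraMap V K).range := fun i =>
      specialization_mem_range ((mem_ballSubring_iff_isHomIntegral halg rfl).2 (hxy i)) P hP
    choose v hv using hz
    obtain ⟨⟨r, hr⟩, hrv⟩ := IsLocalization.exist_integer_multiples_of_finite M v
    refine ⟨r ^ n, pow_mem hr n, fun b hb f hf => ?_⟩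
    let : Algebra R (GradedClosure K L d) :=
      ((algebraMap K (GradedClosure K L d)).comp (algebraMap R K)).toAlgebra
    let ψ : GradedClosure K L d →ₐ[R] L[X] :=
      { (GradedClosure K L d).val with
        commutes' := fun r => by
          change algebraMap K L[X] (algebraMap R K r) = _
          rw [← IsScalarTower.algebraMap_apply R K L[X]] }
    let P' : GradedClosure K L d →ₐ[R] K :=
      { P with commutes' := fun r => P.commutes (algebraMap R K r) }
    have h1 : IsHomIntegral R z n f := by
      refine IsHomIntegral.of_map ψ Subtype.val_injective ?_
      have h := hb.monomial
      rw [← hf] at h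
      exact h
    have h2 : IsHomIntegral R (fun i => P (z i)) n (P f) := h1.map_algHom P'
    rw [map_pow]
    refine h2.pow_mul_mem_range fun i => ?_
    obtain ⟨w, hw⟩ := hrv i
    refine ⟨w, ?_⟩
    rw [← hv, IsScalarTower.algebraMap_apply R V K, hw, Algebra.smul_def, map_mul,
      ← IsScalarTower.algebraMap_apply R V K]
  | zero => exact ⟨1, one_mem _, fun _ _ _ _ => ⟨0, by simp⟩⟩
  | add l l' _ _ h h' =>
    obtain ⟨r, hr, h⟩ := h
    obtain ⟨r', hr', h'⟩ := h'
    refine ⟨r * r', mul_mem hr hr', fun b hb f hf => ?_⟩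
    obtain ⟨v, hv⟩ := h b hb f hf
    obtain ⟨v', hv'⟩ := h' b hb f hf
    refine ⟨r' * v + r * v', ?_⟩
    rw [map_add, map_mul, map_mul, hv, hv', LinearMap.add_apply, map_mul]
    ring
  | smul v l _ h =>
    obtain ⟨r, hr, h⟩ := h
    obtain ⟨⟨p, q⟩, hpq⟩ := IsLocalization.surj M v
    refine ⟨r * q, mul_mem hr q.2, fun b hb f hf => ?_⟩
    obtain ⟨w, hw⟩ := h b hb f hf
    refine ⟨p * w, ?_⟩
    have h1 := congrArg (algebraMap V K) hpq
    rw [map_mul, ← IsScalarTower.algebraMap_apply R V K, ← IsScalarTower.algebraMap_apply R V K]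
      at h1
    rw [map_mul, map_mul, hw, LinearMap.smul_apply, Algebra.smul_def, ← h1]
    ring

variable [IsAlgClosed K] (hinj : Function.Injective (gradedEval K y))

include hinj

theorem exists_fg_of_finiteDimensional (hyx : ∀ j, IsHomIntegral V x 1 (y j)) (n : ℕ)
    [FiniteDimensional K (monomialSubmodule K L d n)] :
    ∃ r ∈ M, ∃ N : Submodule R L, N.FG ∧ N ≤ homIntegralSubmodule R x n ∧
      ∀ b ∈ homIntegralSubmodule R x n, r • b ∈ N := by
  have := faithfulSMul_gradedClosure halg hinj
  obtain ⟨m, f, l, hfE, hfb, hl, -, hgen⟩ :=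
    exists_dual_specializations V (Fin (d + 1)) (monomialSubmodule K L d n)
  choose c hc using hfE
  have hcV := fun i => IsHomIntegral.trans hyx
    ((mem_ballSubring_iff_isHomIntegral halg (hc i)).1 (hfb i))
  choose w hwM hw using fun i => IsHomIntegral.exists_smul_of_isLocalization M (hcV i)
  choose u huM hu using fun i => exists_common_denominator M halg hxy n (hl i)
  refine ⟨(∏ i, w i) * ∏ i, u i, mul_mem (prod_mem fun i _ => hwM i) (prod_mem fun i _ => huM i),
    Submodule.span R (Set.range fun i => w i • c i), Submodule.fg_span (Set.finite_range _),
    Submodule.span_le.2 (Set.range_subset_iff.2 hw), fun b hb => ?_⟩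
  have hbV : IsHomIntegral V y n b := IsHomIntegral.trans hxy hb.extend
  let g : GradedClosure K L d :=
    ⟨monomial n b, (isIntegral_monomial_iff halg).2 (IsHomIntegral.extend hbV)⟩
  choose v hv using fun i => hu i b hb g rfl
  have h1 := congrArg (fun z : GradedClosure K L d => (z : L[X]).coeff n) (hgen g ⟨b, rfl⟩)
  have h2 : b = ∑ i, l i g • c i := by
    simp only [g, coeff_monomial_same, AddSubmonoidClass.coe_finsetSum, finsetSum_coeff] at h1
    rw [h1]
    refine Finset.sum_congr rfl fun i _ => ?_
    change (l i g • (f i : L[X])).coeff n = _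
    rw [coeff_smul, hc, coeff_monomial_same]
  rw [h2, Finset.smul_sum]
  refine Submodule.sum_mem _ fun i hi => ?_
  have h3 : ((∏ i, w i) * ∏ i, u i) • l i g • c i =
      ((∏ j ∈ Finset.univ.erase i, w j) * (∏ j ∈ Finset.univ.erase i, u j) * v i) •
        (w i • c i) := by
    rw [← Finset.mul_prod_erase _ w hi, ← Finset.mul_prod_erase _ u hi]
    simp only [← algebraMap_smul (R := R) K, map_mul, hv, smul_smul]
    congr 1
    ring
  rw [h3]
  exact Submodule.smul_mem _ _ (Submodule.subset_span ⟨i, rfl⟩)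

end

section

open Polynomial

theorem span_mul_le_of_mem_span {V L ι τ : Type*} [CommRing V] [CommRing L] [Algebra V L]
    {x : ι → L} {y : τ → L} (hyx : ∀ j, y j ∈ Submodule.span V (Set.range x)) (E : Set L) :
    Submodule.span V {z | ∃ j, ∃ c ∈ E, z = y j * c} ≤
      Submodule.span V {z | ∃ i, ∃ c ∈ E, z = x i * c} := by
  rw [Submodule.span_le]
  rintro _ ⟨j, c, hc, rfl⟩
  have h1 : Submodule.span V (Set.range x) ≤
      (Submodule.span V {z | ∃ i, ∃ c ∈ E, z = x i * c}).comap (LinearMap.mulRight V c) :=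
    Submodule.span_le.2 (Set.range_subset_iff.2 fun i => Submodule.subset_span ⟨i, c, hc, rfl⟩)
  exact h1 (hyx j)

variable {R V K L : Type u} [CommRing R] [IsDomain R] [IsIntegrallyClosed R] [CommRing V] [Field K]
  [Field L] [Algebra R V] [Algebra R K] [Algebra R L] [Algebra V K] [Algebra K L] [Algebra V L]
  [IsScalarTower R V K] [IsScalarTower R K L] [IsScalarTower R V L]
  [IsScalarTower V K L] [IsFractionRing R K] (M : Submonoid R) [IsLocalization M V]
  [IsDomain V] [ValuationRing V] [IsFractionRing V K] [IsAlgClosed K]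
  {ι : Type*} [Finite ι] {x : ι → L} {i₀ : ι} (hx : x i₀ = 1)
  (hadj : IntermediateField.adjoin K (Set.range x) = ⊤)

variable (V) in
include hx hadj in
/-- The structure of the homogeneously integral elements over a valuation ring that is a
localization of a normal domain. -/
theorem exists_local_structure : ∃ d r C : ℕ, 1 ≤ r ∧
    (∀ n, Module.finrank K (homIntegralSubmodule K x n) ≤ r * (n + C + d).choose d) ∧
    (∀ n, r * (n + d).choose d ≤ Module.finrank K (homIntegralSubmodule K x (n + C))) ∧
    (∀ n₀, IsUniformGenerationBound.{u} d
        (fun n => Module.finrank K (homIntegralSubmodule K x n)) n₀ →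
      ∀ n ≥ n₀, homIntegralSubmodule V x (n + 1) ≤
        Submodule.span V {z | ∃ i, ∃ c ∈ homIntegralSubmodule V x n, z = x i * c}) ∧
    ∀ n, ∃ r ∈ M, ∃ N : Submodule R L, N.FG ∧ N ≤ homIntegralSubmodule R x n ∧
      ∀ b ∈ homIntegralSubmodule R x n, r • b ∈ N := by
  have : IsAlgClosed (IsLocalRing.ResidueField V) := isAlgClosed_residueField K
  have : Infinite (IsLocalRing.ResidueField V) := IsAlgClosed.instInfinite
  obtain ⟨d, y, hyx, hxy, hinj⟩ := exists_linear_noether_normalization (V := V) (K := K) (x := x)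
    (i₀ := i₀) (by rw [hx]; exact one_ne_zero)
  have hyx' := fun j => IsHomIntegral.of_mem_span (hyx j)
  have hV := homIntegralSubmodule_eq (R := V) hxy hyx'
  have hK := homIntegralSubmodule_eq (R := K) (fun i => (hxy i).extend) fun j => (hyx' j).extend
  let : Algebra (MvPolynomial (Fin (d + 1)) K) L[X] :=
    (gradedEval K y : MvPolynomial (Fin (d + 1)) K →+* L[X]).toAlgebra
  have halg : ∀ p, algebraMap (MvPolynomial (Fin (d + 1)) K) L[X] p = gradedEval K y p :=
    fun _ => rfl
  have : IsScalarTower K (MvPolynomial (Fin (d + 1)) K) L[X] :=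
    IsScalarTower.of_algebraMap_eq fun r => (IsHomIntegral.coe_gradedEval_C r).symm
  obtain ⟨hfd, r, C, hr, hup, hlow⟩ := finrank_homIntegralSubmodule_growth halg hinj hx
    (fun i => (hxy i).extend) hadj
  have hK' : ∀ n, Module.finrank K (homIntegralSubmodule K x n) =
      Module.finrank K (homIntegralSubmodule K y n) := fun n => by rw [hK]
  simp only [hK']
  refine ⟨d, r, C, hr, hup, hlow, fun n₀ hn₀ n hn => ?_, fun n => ?_⟩
  · rw [← hV, ← hV]
    refine (homIntegralSubmodule_succ_le halg hinj hn₀ hfd hn).trans ?_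
    exact span_mul_le_of_mem_span hyx (homIntegralSubmodule V y n)
  · have := hfd n
    exact exists_fg_of_finiteDimensional M halg hxy hinj hyx' n

end

section

variable {R K L : Type u} [CommRing R] [IsDomain R] [IsIntegrallyClosed R] [Field K]
  [Field L] [Algebra R K] [Algebra R L] [Algebra K L] [IsScalarTower R K L] [IsFractionRing R K]
  [IsAlgClosed K] {ι : Type*} [Finite ι] {x : ι → L} {i₀ : ι} (hx : x i₀ = 1)
  (hadj : IntermediateField.adjoin K (Set.range x) = ⊤)

include hx hadj

theorem exists_localization_structure (s : Ideal R) [s.IsPrime]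
    [ValuationRing (Localization.AtPrime s)] : ∃ d r C : ℕ, 1 ≤ r ∧
    (∀ n, Module.finrank K (homIntegralSubmodule K x n) ≤ r * (n + C + d).choose d) ∧
    (∀ n, r * (n + d).choose d ≤ Module.finrank K (homIntegralSubmodule K x (n + C))) ∧
    (∀ n₀, IsUniformGenerationBound.{u} d
        (fun n => Module.finrank K (homIntegralSubmodule K x n)) n₀ →
      ∀ n ≥ n₀, ∀ b ∈ homIntegralSubmodule R x (n + 1), ∃ r ∉ s, r • b ∈
        Submodule.span R {z | ∃ i, ∃ c ∈ homIntegralSubmodule R x n, z = x i * c}) ∧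
    ∀ n, ∃ r ∉ s, ∃ N : Submodule R L, N.FG ∧ N ≤ homIntegralSubmodule R x n ∧
      ∀ b ∈ homIntegralSubmodule R x n, r • b ∈ N := by
  have hu : ∀ r : s.primeCompl, IsUnit (algebraMap R K r) := fun r => by
    rw [isUnit_iff_ne_zero, map_ne_zero_iff _ (IsFractionRing.injective R K)]
    intro h
    exact r.2 (by rw [h]; exact zero_mem s)
  let : Algebra (Localization.AtPrime s) K :=
    (IsLocalization.lift (S := Localization.AtPrime s) hu).toAlgebra
  have : IsScalarTower R (Localization.AtPrime s) K :=
    IsScalarTower.of_algebraMap_eq fun r => (IsLocalization.lift_eq hu r).symm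
  let : Algebra (Localization.AtPrime s) L :=
    ((algebraMap K L).comp (algebraMap (Localization.AtPrime s) K)).toAlgebra
  have : IsScalarTower (Localization.AtPrime s) K L := IsScalarTower.of_algebraMap_eq fun _ => rfl
  have : IsScalarTower R (Localization.AtPrime s) L := by
    refine IsScalarTower.of_algebraMap_eq fun r => ?_
    rw [IsScalarTower.algebraMap_apply R K L,
      IsScalarTower.algebraMap_apply (Localization.AtPrime s) K L,
      ← IsScalarTower.algebraMap_apply R (Localization.AtPrime s) K]
  have : IsFractionRing (Localization.AtPrime s) K :=
    IsFractionRing.isFractionRing_of_isDomain_of_isLocalization s.primeCompl _ _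
  obtain ⟨d, r, C, hr, hup, hlow, hgen, hfg⟩ :=
    exists_local_structure (Localization.AtPrime s) s.primeCompl hx hadj
  refine ⟨d, r, C, hr, hup, hlow, fun n₀ hn₀ n hn b hb => ?_, hfg⟩
  have h1 := hgen n₀ hn₀ n hn (IsHomIntegral.extend hb)
  clear hb
  induction h1 using Submodule.span_induction with
  | mem z hz =>
    obtain ⟨i, c, hc, rfl⟩ := hz
    obtain ⟨r, hr, h⟩ := IsHomIntegral.exists_smul_of_isLocalization s.primeCompl hc
    exact ⟨r, hr, Submodule.subset_span ⟨i, r • c, h, (mul_smul_comm _ _ _).symm⟩⟩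
  | zero => exact ⟨1, s.primeCompl.one_mem, by simp⟩
  | add z w _ _ hz hw =>
    obtain ⟨r, hr, h⟩ := hz
    obtain ⟨r', hr', h'⟩ := hw
    refine ⟨r * r', s.primeCompl.mul_mem hr hr', ?_⟩
    rw [smul_add]
    refine add_mem ?_ ?_
    · rw [mul_comm, mul_smul]
      exact Submodule.smul_mem _ _ h
    · rw [mul_smul]
      exact Submodule.smul_mem _ _ h'
  | smul v z _ hz =>
    obtain ⟨r, hr, h⟩ := hz
    obtain ⟨⟨p, q⟩, hpq⟩ := IsLocalization.surj s.primeCompl v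
    refine ⟨r * q, s.primeCompl.mul_mem hr q.2, ?_⟩
    have h1 : (r * q : R) • v • z = p • r • z := by
      rw [← algebraMap_smul (Localization.AtPrime s) (r * q : R), smul_smul, map_mul, mul_assoc,
        mul_comm (algebraMap _ _ _) v, hpq, ← map_mul, algebraMap_smul, smul_smul, mul_comm]
    rw [h1]
    exact Submodule.smul_mem _ _ h

/-- Over a normal Prüfer domain with algebraically closed fraction field, the spaces of
homogeneously integral elements are finitely generated, and generated by the given elements in
high degree. -/
theorem homIntegralSubmodule_global_structure (hR : IsPruferDomain R) :
    (∀ n, (homIntegralSubmodule R x n).FG) ∧ ∃ n₀, ∀ n ≥ n₀, homIntegralSubmodule R x (n + 1) ≤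
      Submodule.span R {z | ∃ i, ∃ c ∈ homIntegralSubmodule R x n, z = x i * c} := by
  have hloc := fun (s : Ideal R) (hs : s.IsPrime) =>
    have := hR s
    exists_localization_structure hx hadj s
  refine ⟨fun n => ?_, ?_⟩
  · let J : Ideal R :=
      { carrier := {r | ∃ N : Submodule R L, N.FG ∧ N ≤ homIntegralSubmodule R x n ∧
          ∀ b ∈ homIntegralSubmodule R x n, r • b ∈ N}
        zero_mem' := ⟨⊥, Submodule.fg_bot, bot_le, fun b _ => by simp⟩
        add_mem' := by
          rintro r r' ⟨N, hN, hNM, h⟩ ⟨N', hN', hNM', h'⟩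
          refine ⟨N ⊔ N', hN.sup hN', sup_le hNM hNM', fun b hb => ?_⟩
          rw [add_smul]
          exact Submodule.add_mem_sup (h b hb) (h' b hb)
        smul_mem' := by
          rintro r r' ⟨N, hN, hNM, h⟩
          refine ⟨N, hN, hNM, fun b hb => ?_⟩
          rw [smul_assoc]
          exact N.smul_mem r (h b hb) }
    have hJ : J = ⊤ := by
      by_contra hJ
      obtain ⟨s, hs, hJs⟩ := Ideal.exists_le_maximal J hJ
      obtain ⟨d, r, C, -, -, -, -, hfg⟩ := hloc s hs.isPrime
      obtain ⟨r, hr, h⟩ := hfg n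
      exact hr (hJs h)
    obtain ⟨N, hN, hNM, h⟩ : (1 : R) ∈ J := hJ ▸ Submodule.mem_top
    rwa [← le_antisymm hNM fun b hb => by simpa using h b hb]
  · obtain ⟨s₀, hs₀⟩ := Ideal.exists_maximal R
    obtain ⟨d, r, C, hr, hup, hlow, -, -⟩ := hloc s₀ hs₀.isPrime
    obtain ⟨n₀, hn₀⟩ := exists_uniform_generation_bound.{u} d r C hr _ hup hlow
    refine ⟨n₀, fun n hn b hb => ?_⟩
    let J : Ideal R := (Submodule.span R {z | ∃ i, ∃ c ∈ homIntegralSubmodule R x n,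
      z = x i * c}).comap (LinearMap.toSpanSingleton R L b)
    have hJ : J = ⊤ := by
      by_contra hJ
      obtain ⟨s, hs, hJs⟩ := Ideal.exists_le_maximal J hJ
      obtain ⟨d', r', C', hr', hup', hlow', hgen, -⟩ := hloc s hs.isPrime
      have hdd : d' = d := by
        have h1 := growth_comparison (C := C' + C) hr' fun n => (hlow' n).trans <| by
          have := hup (n + C')
          rwa [add_assoc n C' C] at this
        have h2 := growth_comparison (C := C + C') hr fun n => (hlow n).trans <| by
          have := hup' (n + C)
          rwa [add_assoc n C C'] at this
        omega
      subst hdd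
      obtain ⟨t, ht, h⟩ := hgen n₀ hn₀ n hn b hb
      exact ht (hJs h)
    have h1 : (1 : R) ∈ J := hJ ▸ Submodule.mem_top
    simpa [J] using h1

end

section

open Polynomial

variable {R S σ : Type*} [CommRing R] [CommRing S] [Algebra R S] {y : σ → S} {i₀ : σ}

theorem exists_gradedEval_eq_monomial (hy : y i₀ = 1) (p : MvPolynomial σ R) :
    ∃ m, ∀ k ≥ m, ∃ q : MvPolynomial σ R,
      (gradedEval R y : MvPolynomial σ R →+* S[X]) q =
        monomial k (MvPolynomial.aeval y p) := by
  induction p using MvPolynomial.induction_on with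
  | C r =>
    refine ⟨0, fun k _ => ⟨MvPolynomial.C r * MvPolynomial.X i₀ ^ k, ?_⟩⟩
    rw [map_mul, map_pow, IsHomIntegral.coe_gradedEval_C, IsHomIntegral.coe_gradedEval_X, hy,
      monomial_pow, one_pow, one_mul, C_mul_monomial, mul_one, MvPolynomial.aeval_C]
  | add p q hp hq =>
    obtain ⟨m, hm⟩ := hp
    obtain ⟨m', hm'⟩ := hq
    refine ⟨max m m', fun k hk => ?_⟩
    obtain ⟨f, hf⟩ := hm k (le_of_max_le_left hk)
    obtain ⟨g, hg⟩ := hm' k (le_of_max_le_right hk)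
    exact ⟨f + g, by rw [map_add, hf, hg, map_add, map_add]⟩
  | mul_X p j hp =>
    obtain ⟨m, hm⟩ := hp
    refine ⟨m + 1, fun k hk => ?_⟩
    obtain ⟨f, hf⟩ := hm (k - 1) (by omega)
    refine ⟨f * MvPolynomial.X j, ?_⟩
    rw [map_mul, hf, IsHomIntegral.coe_gradedEval_X, monomial_mul_monomial,
      map_mul (MvPolynomial.aeval y),
      MvPolynomial.aeval_X, Nat.sub_add_cancel (by omega)]

theorem IsHomIntegral.exists_of_isIntegralElem (hy : y i₀ = 1) {b : S}
    (hb : (MvPolynomial.aeval y : MvPolynomial σ R →ₐ[R] S).toRingHom.IsIntegralElem b) :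
    ∃ n, IsHomIntegral R y n b := by
  obtain ⟨p, hp, hpb⟩ := hb
  choose m hm using fun i => exists_gradedEval_eq_monomial hy (p.coeff i)
  let n := (Finset.range p.natDegree).sup m
  have hq : ∀ i ∈ Finset.range p.natDegree, ∃ q : MvPolynomial σ R,
      (gradedEval R y : MvPolynomial σ R →+* S[X]) q =
        Polynomial.monomial ((p.natDegree - i) * n) (MvPolynomial.aeval y (p.coeff i)) := by
    intro i hi
    refine hm i _ ((Finset.le_sup (f := m) hi).trans ?_)
    exact Nat.le_mul_of_pos_left _ (Nat.sub_pos_of_lt (Finset.mem_range.1 hi))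
  choose! q hq using hq
  refine ⟨n, X ^ p.natDegree + ∑ i ∈ Finset.range p.natDegree, C (q i) * X ^ i,
    monic_X_pow_add ?_, ?_⟩
  · refine (degree_sum_le _ _).trans_lt ((Finset.sup_lt_iff (WithBot.bot_lt_coe _)).2 ?_)
    exact fun i hi => (degree_C_mul_X_pow_le _ _).trans_lt
      (WithBot.coe_lt_coe.2 (Finset.mem_range.1 hi))
  · rw [hp.as_sum] at hpb
    simp only [eval₂_add, eval₂_X_pow, eval₂_finsetSum, eval₂_mul, eval₂_C] at hpb ⊢
    have h : ∀ i ∈ Finset.range p.natDegree,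
        (gradedEval R y : MvPolynomial σ R →+* S[X]) (q i) * Polynomial.monomial n b ^ i =
          Polynomial.monomial (n * p.natDegree) (MvPolynomial.aeval y (p.coeff i) * b ^ i) := by
      intro i hi
      rw [hq i hi, monomial_pow, monomial_mul_monomial]
      congr 1
      rw [mul_comm n i, ← add_mul, Nat.sub_add_cancel (Finset.mem_range.1 hi).le, mul_comm]
    rw [Finset.sum_congr rfl h, monomial_pow, ← map_sum, ← map_add]
    rw [← map_zero (Polynomial.monomial (n * p.natDegree))]
    exact congrArg _ hpb

end

section

variable {R A : Type u} [CommRing R] [IsDomain R] [IsIntegrallyClosed R] [CommRing A] [IsDomain A]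
  [Algebra R A]

theorem isN1_of_isPruferDomain_of_isAlgClosed [IsAlgClosed (FractionRing R)]
    (hR : IsPruferDomain R) (hinj : Function.Injective (algebraMap R A))
    (hA : Algebra.FiniteType R A) : IsN1 A := by
  have : FaithfulSMul R A := (faithfulSMul_iff_algebraMap_injective R A).2 hinj
  let K := FractionRing R
  let L := FractionRing A
  have : FaithfulSMul R L := (faithfulSMul_iff_algebraMap_injective R L).2 <| by
    rw [IsScalarTower.algebraMap_eq R A L]
    exact (IsFractionRing.injective A L).comp hinj
  let : Algebra K L := FractionRing.liftAlgebra R L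
  have : IsScalarTower R K L := FractionRing.isScalarTower_liftAlgebra R L
  obtain ⟨s, hs⟩ := hA
  let x' : Option s → A := fun o => o.elim 1 Subtype.val
  let x : Option s → L := fun o => algebraMap A L (x' o)
  have hx : x none = 1 := map_one _
  have hrange : ∀ a : A, ∃ p : MvPolynomial (Option s) R, MvPolynomial.aeval x' p = a := by
    intro a
    rw [← AlgHom.mem_range, ← Algebra.adjoin_range_eq_range_aeval]
    refine Algebra.adjoin_mono ?_ (hs ▸ Algebra.mem_top : a ∈ Algebra.adjoin R (s : Set A))
    exact fun z hz => ⟨some ⟨z, hz⟩, rfl⟩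
  have haeval : ∀ p : MvPolynomial (Option s) R,
      MvPolynomial.aeval x p = algebraMap A L (MvPolynomial.aeval x' p) := fun p =>
    MvPolynomial.aeval_algebraMap_apply _ _ _
  have hadj : IntermediateField.adjoin K (Set.range x) = ⊤ := by
    refine eq_top_iff.2 fun z _ => ?_
    have h : ∀ a : A, algebraMap A L a ∈ IntermediateField.adjoin K (Set.range x) := by
      intro a
      obtain ⟨p, rfl⟩ := hrange a
      rw [← haeval]
      induction p using MvPolynomial.induction_on with
      | C r =>
        rw [MvPolynomial.aeval_C, IsScalarTower.algebraMap_apply R K L]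
        exact IntermediateField.algebraMap_mem _ _
      | add p q hp hq => rw [map_add]; exact add_mem hp hq
      | mul_X p j hp =>
        rw [map_mul, MvPolynomial.aeval_X]
        exact mul_mem hp (IntermediateField.subset_adjoin _ _ ⟨j, rfl⟩)
    obtain ⟨a, b, -, rfl⟩ := IsFractionRing.div_surjective (A := A) z
    exact div_mem (h a) (h b)
  obtain ⟨hfg, n₀, hn₀⟩ := homIntegralSubmodule_global_structure hx hadj hR
  have hle : ∀ n, homIntegralSubmodule R x n ≤ homIntegralSubmodule R x (n + 1) := by
    intro n b hb
    have h := IsHomIntegral.mul hb (IsHomIntegral.gen (R := R) (y := x) none)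
    rwa [hx, mul_one] at h
  have hint : ∀ n, ∀ b ∈ homIntegralSubmodule R x n, IsIntegral A b := by
    intro n b hb
    refine RingHom.IsIntegralElem.trans_of_range (fun p => ?_) (IsHomIntegral.isIntegralElem hb)
    have : (MvPolynomial.aeval x : MvPolynomial (Option s) R →ₐ[R] L).toRingHom p =
      algebraMap A L (MvPolynomial.aeval x' p) := haeval p
    rw [this]
    exact RingHom.isIntegralElem_map _
  obtain ⟨G, hG⟩ := hfg n₀
  have hspan : ∀ n, ∀ b ∈ homIntegralSubmodule R x n, b ∈ Submodule.span A (G : Set L) := by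
    intro n
    induction n with
    | zero =>
      intro b hb
      have h := monotone_nat_of_le_succ hle (Nat.zero_le n₀) hb
      rw [← hG] at h
      exact Submodule.span_le_restrictScalars R A _ h
    | succ n ih =>
      intro b hb
      rcases le_or_gt n₀ n with h | h
      · have h1 := hn₀ n h hb
        refine Submodule.span_le (p := (Submodule.span A (G : Set L)).restrictScalars R).2 ?_ h1
        rintro _ ⟨i, c, hc, rfl⟩
        rw [← Algebra.smul_def]
        exact Submodule.smul_mem _ _ (ih c hc)
      · have h := monotone_nat_of_le_succ hle (Nat.succ_le_of_lt h) hb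
        rw [← hG] at h
        exact Submodule.span_le_restrictScalars R A _ h
  have heq : Submodule.span A (G : Set L) = Subalgebra.toSubmodule (integralClosure A L) := by
    refine le_antisymm (Submodule.span_le.2 fun g hg => hint n₀ g ?_) fun b hb => ?_
    · rw [← hG]
      exact Submodule.subset_span hg
    · obtain ⟨n, hn⟩ := IsHomIntegral.exists_of_isIntegralElem (R := R) hx (b := b) <| by
        refine RingHom.IsIntegralElem.trans_of_range (f := algebraMap A L) (fun a => ?_) hb
        obtain ⟨p, rfl⟩ := hrange a
        rw [← haeval]
        exact RingHom.isIntegralElem_map _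
      exact hspan n b hn
  exact Module.Finite.iff_fg.2 (⟨G, heq⟩ : (Subalgebra.toSubmodule (integralClosure A L)).FG)

end

section AbsoluteIntegralClosure

open Polynomial

/-- Every monic polynomial of positive degree has a root in the ring. -/
def HasMonicRoots (R : Type*) [CommRing R] : Prop :=
  ∀ p : R[X], p.Monic → p.natDegree ≠ 0 → ∃ r, p.eval r = 0

/-- Divisibility is total locally at every prime ideal. -/
def LocallyDvdTotal (R : Type*) [CommRing R] : Prop :=
  ∀ s : Ideal R, s.IsPrime → ∀ a b : R, ∃ u, u ∉ s ∧ (a ∣ u * b ∨ b ∣ u * a)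

theorem HasMonicRoots.of_surjective {R R' : Type*} [CommRing R] [CommRing R'] (h : HasMonicRoots R)
    {f : R →+* R'} (hf : Function.Surjective f) : HasMonicRoots R' := by
  intro p hp hd
  obtain ⟨q, rfl, hqd, hq⟩ := lifts_and_natDegree_eq_and_monic (f := f) (p := p)
    ((mem_lifts p).2 (Polynomial.map_surjective f hf p)) hp
  obtain ⟨r, hr⟩ := h q hq (hqd ▸ hd)
  exact ⟨f r, by rw [eval_map, eval₂_hom, hr, map_zero]⟩

theorem LocallyDvdTotal.of_surjective {R R' : Type*} [CommRing R] [CommRing R']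
    (h : LocallyDvdTotal R) {f : R →+* R'} (hf : Function.Surjective f) : LocallyDvdTotal R' := by
  intro s hs a b
  obtain ⟨a, rfl⟩ := hf a
  obtain ⟨b, rfl⟩ := hf b
  obtain ⟨u, hu, h⟩ := h (s.comap f) (hs.comap f) a b
  refine ⟨f u, hu, ?_⟩
  rw [← map_mul, ← map_mul]
  exact h.imp (fun h => _root_.map_dvd f h) fun h => _root_.map_dvd f h

theorem HasMonicRoots.isAlgClosed_fractionRing {R : Type*} [CommRing R] [IsDomain R]
    (h : HasMonicRoots R) : IsAlgClosed (FractionRing R) := by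
  refine IsAlgClosed.of_exists_root _ fun p hp hirr => ?_
  set s := IsLocalization.commonDenom (nonZeroDivisors R) p.support p.coeff
  have hs : algebraMap R (FractionRing R) s ≠ 0 :=
    IsLocalization.to_map_ne_zero_of_mem_nonZeroDivisors _ le_rfl s.2
  obtain ⟨q, hq, hqd, hqm⟩ := lifts_and_natDegree_eq_and_monic
    (IsLocalization.scaleRoots_commonDenom_mem_lifts (nonZeroDivisors R) p
      ⟨1, by rw [hp.leadingCoeff, map_one]⟩) ((monic_scaleRoots_iff _).2 hp)
  obtain ⟨r, hr⟩ := h q hqm (by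
    rw [hqd, natDegree_scaleRoots]
    exact hirr.natDegree_pos.ne')
  refine ⟨algebraMap R _ r / algebraMap R _ s, ?_⟩
  have h1 := scaleRoots_eval₂_mul (p := p) (RingHom.id (FractionRing R))
    (algebraMap R _ r / algebraMap R _ s) (algebraMap R _ s)
  rw [RingHom.id_apply, mul_div_cancel₀ _ hs, ← hq, eval₂_map, RingHom.id_comp, eval₂_hom, hr,
    map_zero] at h1
  exact (mul_eq_zero.1 h1.symm).resolve_left (pow_ne_zero _ hs)

theorem HasMonicRoots.isIntegrallyClosed {R : Type*} [CommRing R] [IsDomain R]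
    (h : HasMonicRoots R) : IsIntegrallyClosed R := by
  refine (isIntegrallyClosed_iff (FractionRing R)).2 fun {x} hx => ?_
  obtain ⟨p, hp, hpx⟩ := hx
  induction hd : p.natDegree generalizing p with
  | zero =>
    rw [hp.natDegree_eq_zero.1 hd, eval₂_one] at hpx
    exact absurd hpx one_ne_zero
  | succ n ih =>
    obtain ⟨r, hr⟩ := h p hp (by omega)
    obtain ⟨q, rfl⟩ := dvd_iff_isRoot.2 hr
    have hq : q.Monic := (monic_X_sub_C r).of_mul_monic_left hp
    rw [eval₂_mul, eval₂_sub, eval₂_X, eval₂_C, mul_eq_zero] at hpx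
    rcases hpx with hpx | hpx
    · exact ⟨r, (sub_eq_zero.1 hpx).symm⟩
    · refine ih q hq hpx ?_
      rw [(monic_X_sub_C r).natDegree_mul hq, natDegree_X_sub_C] at hd
      omega

theorem LocallyDvdTotal.isPruferDomain {R : Type u} [CommRing R] [IsDomain R]
    (h : LocallyDvdTotal R) : IsPruferDomain R := by
  intro P hP
  have key : ∀ a b : R, ∀ s t : P.primeCompl, ∀ u ∉ P, a ∣ u * b →
      IsLocalization.mk' (Localization.AtPrime P) a s ∣ IsLocalization.mk' _ b t := by
    rintro a b s t u hu ⟨c, hc⟩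
    refine ⟨IsLocalization.mk' _ (c * s) (⟨u, hu⟩ * t), ?_⟩
    rw [← IsLocalization.mk'_mul, IsLocalization.mk'_eq_iff_eq]
    congr 1
    simp only [Submonoid.coe_mul]
    linear_combination (s : R) * t * hc
  refine ValuationRing.iff_dvd_total.2 ⟨fun x y => ?_⟩
  obtain ⟨a, s, rfl⟩ := IsLocalization.exists_mk'_eq P.primeCompl x
  obtain ⟨b, t, rfl⟩ := IsLocalization.exists_mk'_eq P.primeCompl y
  obtain ⟨u, hu, h⟩ := h P hP a b
  exact h.imp (key a b s t u hu) (key b a t s u hu)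

theorem IsPruferDomain.locallyDvdTotal {R : Type u} [CommRing R] [IsDomain R]
    (h : IsPruferDomain R) : LocallyDvdTotal R := by
  intro P hP
  have key : ∀ a b : R, algebraMap R (Localization.AtPrime P) a ∣ algebraMap R _ b →
      ∃ u, u ∉ P ∧ a ∣ u * b := by
    rintro a b ⟨z, hz⟩
    obtain ⟨c, s, rfl⟩ := IsLocalization.exists_mk'_eq P.primeCompl z
    refine ⟨s, s.2, c, ?_⟩
    refine IsLocalization.injective (Localization.AtPrime P) P.primeCompl_le_nonZeroDivisors ?_
    rw [map_mul, map_mul, hz, mul_left_comm, mul_comm (algebraMap R _ (s : R)),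
      IsLocalization.mk'_spec]
  intro a b
  have := h P
  rcases ValuationRing.dvd_total (algebraMap R (Localization.AtPrime P) a)
    (algebraMap R _ b) with h | h
  · obtain ⟨u, hu, h⟩ := key a b h
    exact ⟨u, hu, Or.inl h⟩
  · obtain ⟨u, hu, h⟩ := key b a h
    exact ⟨u, hu, Or.inr h⟩

theorem LocallyDvdTotal.exists_dvd_finset {R ι : Type*} [CommRing R] (h : LocallyDvdTotal R)
    (P : Ideal R) [P.IsPrime] {s : Finset ι} (hs : s.Nonempty) (c : ι → R) :
    ∃ j ∈ s, ∃ u, u ∉ P ∧ ∀ i ∈ s, c j ∣ u * c i := by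
  classical
  induction hs using Finset.Nonempty.cons_induction with
  | singleton i =>
    refine ⟨i, by simp, 1, P.one_notMem, fun k hk => ?_⟩
    rw [Finset.mem_singleton.1 hk, one_mul]
  | cons i s hi hs ih =>
    obtain ⟨j, hj, u, hu, hdvd⟩ := ih
    obtain ⟨v, hv, h | h⟩ := h P inferInstance (c i) (c j)
    · refine ⟨i, Finset.mem_cons_self _ _, v * u, fun hvu => ?_, fun k hk => ?_⟩
      · exact (Ideal.IsPrime.mem_or_mem inferInstance hvu).elim hv hu
      · rcases Finset.mem_cons.1 hk with rfl | hk
        · exact Dvd.intro_left _ rfl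
        · exact h.trans (by rw [mul_assoc]; exact mul_dvd_mul_left v (hdvd k hk))
    · refine ⟨j, Finset.mem_cons_of_mem hj, v * u, fun hvu => ?_, fun k hk => ?_⟩
      · exact (Ideal.IsPrime.mem_or_mem inferInstance hvu).elim hv hu
      · rcases Finset.mem_cons.1 hk with rfl | hk
        · rw [mul_right_comm]
          exact h.mul_right u
        · rw [mul_assoc]
          exact (hdvd k hk).mul_left v

/-- A root of a polynomial over an integrally closed ring which is nonzero modulo a prime lies
together with its inverse in a local total order. -/
theorem exists_mul_eq_of_root {B F : Type*} [CommRing B] [Field F] [Algebra B F]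
    [IsIntegrallyClosedIn B F] (Q : Ideal B) [Q.IsPrime] (x : F) (n : ℕ) (p : B[X])
    (hn : p.natDegree ≤ n) (hp : aeval x p = 0) (hpQ : ∃ i, p.coeff i ∉ Q) :
    ∃ γ δ : B, δ ∉ Q ∧
      (algebraMap B F δ * x = algebraMap B F γ ∨ algebraMap B F δ = algebraMap B F γ * x) := by
  have hinj : Function.Injective (algebraMap B F) :=
    IsIntegralClosure.algebraMap_injective B B F
  induction hm : p.natDegree using Nat.strong_induction_on generalizing p with
  | _ m ih =>
  obtain ⟨z, hz⟩ := IsIntegrallyClosedIn.isIntegral_iff.1 (isIntegral_leadingCoeff_smul p x hp)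
  rw [Algebra.smul_def] at hz
  by_cases hc : p.leadingCoeff ∈ Q
  · by_cases hzQ : z ∈ Q
    · cases m with
      | zero =>
        obtain ⟨i, hi⟩ := hpQ
        rw [eq_C_of_natDegree_eq_zero hm, leadingCoeff_C] at hc
        rw [eq_C_of_natDegree_eq_zero hm, coeff_C] at hi
        split_ifs at hi
        exacts [absurd hc hi, absurd Q.zero_mem hi]
      | succ m =>
        have hdeg : (p.eraseLead + C z * X ^ m).natDegree ≤ m := by
          refine natDegree_add_le_of_degree_le ?_ (natDegree_C_mul_X_pow_le _ _)
          exact (eraseLead_natDegree_le _).trans (by omega)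
        refine ih _ (Nat.lt_succ_of_le hdeg) (p.eraseLead + C z * X ^ m) (by omega) ?_ ?_ rfl
        · rw [← eraseLead_add_C_mul_X_pow p, hm] at hp
          simp only [map_add, map_mul, aeval_C, map_pow, aeval_X] at hp ⊢
          rw [hz, ← hp]
          ring
        · obtain ⟨i, hi⟩ := hpQ
          refine ⟨i, fun hi' => hi ?_⟩
          rw [← eraseLead_add_C_mul_X_pow p]
          simp only [coeff_add, coeff_C_mul, coeff_X_pow] at hi' ⊢
          rw [add_comm] at hi'
          rw [add_comm]
          exact Q.add_mem (Q.mul_mem_right _ hc)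
            ((Q.add_mem_iff_right (Q.mul_mem_right _ hzQ)).1 hi')
    · exact ⟨p.leadingCoeff, z, hzQ, Or.inr hz⟩
  · exact ⟨z, p.leadingCoeff, hc, Or.inl hz.symm⟩

theorem LocallyDvdTotal.of_isAlgebraic {D B F : Type*} [CommRing D] [IsDomain D] [CommRing B]
    [Field F] [Algebra D B] [Algebra D F] [Algebra B F] [IsScalarTower D B F]
    [IsIntegrallyClosedIn B F] [FaithfulSMul D F] [Algebra.IsAlgebraic D F]
    (h : LocallyDvdTotal D) : LocallyDvdTotal B := by
  classical
  intro Q hQ α β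
  have hinj : Function.Injective (algebraMap B F) :=
    IsIntegralClosure.algebraMap_injective B B F
  have hinjD : Function.Injective (algebraMap D F) := FaithfulSMul.algebraMap_injective D F
  by_cases hβ : β = 0
  · exact ⟨1, Q.one_notMem, Or.inl (by simp [hβ])⟩
  have hβF : algebraMap B F β ≠ 0 := (map_ne_zero_iff _ hinj).2 hβ
  obtain ⟨f, hf, hfx⟩ := Algebra.IsAlgebraic.isAlgebraic (R := D)
    (algebraMap B F α / algebraMap B F β)
  set x := algebraMap B F α / algebraMap B F β with hx
  obtain ⟨j, hj, u, hu, hdvd⟩ := h.exists_dvd_finset (Q.comap (algebraMap D B))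
    (nonempty_support_iff.2 hf) f.coeff
  choose! d hd using hdvd
  have hcj : f.coeff j ≠ 0 := mem_support_iff.1 hj
  let g : D[X] := ∑ i ∈ f.support, C (d i) * X ^ i
  have hgj : g.coeff j = u := by
    have h1 : g.coeff j = d j := by
      simp only [g, finsetSum_coeff, coeff_C_mul, coeff_X_pow, mul_ite, mul_one, mul_zero]
      rw [Finset.sum_ite_eq, if_pos hj]
    rw [h1]
    have := hd j hj
    rw [mul_comm] at this
    exact (mul_left_cancel₀ hcj this).symm
  have hg : C (f.coeff j) * g = C u * f := by
    conv_rhs => rw [f.as_sum_support_C_mul_X_pow]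
    rw [Finset.mul_sum, Finset.mul_sum]
    refine Finset.sum_congr rfl fun i hi => ?_
    rw [← mul_assoc, ← mul_assoc, ← C_mul, ← C_mul, hd i hi]
  have hgx : aeval x g = 0 := by
    have h1 := congrArg (aeval x) hg
    rw [map_mul, map_mul, hfx, mul_zero, aeval_C] at h1
    exact (mul_eq_zero.1 h1).resolve_left ((map_ne_zero_iff _ hinjD).2 hcj)
  obtain ⟨γ, δ, hδ, h1⟩ := exists_mul_eq_of_root Q x _ (g.map (algebraMap D B)) le_rfl
    (by rw [aeval_map_algebraMap, hgx]) ⟨j, by rw [coeff_map, hgj]; exact hu⟩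
  refine ⟨δ, hδ, ?_⟩
  rcases h1 with h1 | h1
  · refine Or.inr ⟨γ, hinj ?_⟩
    rw [map_mul, map_mul, mul_comm (algebraMap B F β), ← h1, mul_assoc, hx, div_mul_cancel₀ _ hβF]
  · refine Or.inl ⟨γ, hinj ?_⟩
    rw [map_mul, map_mul, h1, mul_assoc, hx, div_mul_cancel₀ _ hβF, mul_comm]

theorem hasMonicRoots_of_isIntegrallyClosedIn {B F : Type*} [CommRing B] [Field F] [Algebra B F]
    [IsAlgClosed F] [IsIntegrallyClosedIn B F] : HasMonicRoots B := by
  intro p hp hd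
  have hinj : Function.Injective (algebraMap B F) :=
    IsIntegralClosure.algebraMap_injective B B F
  obtain ⟨x, hx⟩ := IsAlgClosed.exists_eval₂_eq_zero_of_injective (algebraMap B F) hinj p
    (fun h => hd (natDegree_eq_of_degree_eq_some h))
  obtain ⟨r, rfl⟩ := IsIntegrallyClosedIn.isIntegral_iff.1
    (⟨p, hp, hx⟩ : _root_.IsIntegral B x)
  refine ⟨r, hinj ?_⟩
  rw [map_zero, ← hx, eval₂_hom]

end AbsoluteIntegralClosure

section

theorem universallyJapanese_of_hasMonicRoots {R : Type u} [CommRing R] (h : HasMonicRoots R)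
    (h' : LocallyDvdTotal R) : UniversallyJapanese R := by
  intro A _ _ _ hA
  let S := (algebraMap R A).range
  let f : R →+* S := (algebraMap R A).rangeRestrict
  have hf : Function.Surjective f := (algebraMap R A).rangeRestrict_surjective
  let : Algebra R S := f.toAlgebra
  have : IsScalarTower R S A := IsScalarTower.of_algebraMap_eq fun _ => rfl
  have hS := h.of_surjective hf
  have := hS.isAlgClosed_fractionRing
  have := hS.isIntegrallyClosed
  exact isN1_of_isPruferDomain_of_isAlgClosed (R := S) (h'.of_surjective hf).isPruferDomain
    Subtype.val_injective (.of_restrictScalars_finiteType R S A)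

end

/-- The absolute integral closure (the integral closure in an algebraic closure
of the fraction field) of a Prüfer domain is universally Japanese. -/
theorem absoluteIntegralClosure_pruferDomain_universallyJapanese
    (D : Type u) [CommRing D] [IsDomain D] (hD : IsPruferDomain D) :
    UniversallyJapanese
      (integralClosure D (AlgebraicClosure (FractionRing D))) := by
  have : Algebra.IsAlgebraic D (AlgebraicClosure (FractionRing D)) :=
    ⟨fun x => (IsFractionRing.isAlgebraic_iff D (FractionRing D) _).2
      (Algebra.IsAlgebraic.isAlgebraic x)⟩
  have : FaithfulSMul D (AlgebraicClosure (FractionRing D)) :=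
    (faithfulSMul_iff_algebraMap_injective D _).2 <| by
      rw [IsScalarTower.algebraMap_eq D (FractionRing D)]
      exact (algebraMap (FractionRing D) _).injective.comp (IsFractionRing.injective D _)
  exact universallyJapanese_of_hasMonicRoots
    (hasMonicRoots_of_isIntegrallyClosedIn (F := AlgebraicClosure (FractionRing D)))
    (hD.locallyDvdTotal.of_isAlgebraic (F := AlgebraicClosure (FractionRing D)))
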